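/- arXiv:math/0103180 — 2 statements merged into one kernel-verified Lean document; each statement's English description precedes it below -/
import Mathlib

section
/- Let F be an even real-analytic function on a neighborhood of 0 with F(0) = 0 and F''(0) ≠ 0. Suppose the origin is a center of the Rayleigh equation x'' + F(x') + x = 0: there exists δ > 0 such that for every c ∈ (0,δ), every solution u : ℝ → ℝ of the equation with u(0) = c, u'(0) = 0 is periodic. Then the period function T, assigning to each c ∈ (0,δ) the minimal positive period of the solution through (c,0), is strictly increasing on some interval (0,ε). -/
open Set Real Filter

/-- A (C²) solution of the Rayleigh equation `x'' + F(x') + x = 0`. -/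
def IsRayleighSolution (F : ℝ → ℝ) (u : ℝ → ℝ) : Prop :=
  ContDiff ℝ 2 u ∧ ∀ t, deriv (deriv u) t + F (deriv u t) + u t = 0

/-- Near the origin `F y = a * y ^ 2 + y * E y` is even, where the remainder `E` has Lipschitz
constant `O(m ^ 2)` on `[-m, m]`. -/
structure EvenQuadraticExpansion (F E : ℝ → ℝ) (a K η : ℝ) : Prop where
  one_le : 1 ≤ K
  abs_coeff_le : |a| ≤ K
  radius_pos : 0 < η
  radius_le : η ≤ 1
  eq : ∀ y, |y| ≤ η → F y = a * y ^ 2 + y * E y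
  even : ∀ y, |y| ≤ η → F (-y) = F y
  remainder_zero : E 0 = 0
  remainder_lipschitz : ∀ m ≤ η, ∀ y z, |y| ≤ m → |z| ≤ m → |E y - E z| ≤ K * m ^ 2 * |y - z|

theorem analyticAt_dslope_self {f : ℝ → ℝ} {x : ℝ} (hf : AnalyticAt ℝ f x) :
    AnalyticAt ℝ (dslope f x) x := by
  obtain ⟨p, hp⟩ := hf
  exact ⟨_, hp.has_fpower_series_dslope_fslope⟩

theorem eq_mul_dslope_zero {f : ℝ → ℝ} (hf : f 0 = 0) (y : ℝ) : f y = y * dslope f 0 y := by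
  have := sub_smul_dslope f 0 y
  simp only [sub_zero, smul_eq_mul, hf] at this
  exact this.symm

theorem zero_of_eventually_odd {g : ℝ → ℝ} (hg : ContinuousAt g 0)
    (hodd : ∀ᶠ y in nhdsWithin (0 : ℝ) {0}ᶜ, g (-y) = -g y) : g 0 = 0 := by
  have h1 : Tendsto (fun y : ℝ => -g y) (nhdsWithin 0 {0}ᶜ) (nhds (-g 0)) :=
    (hg.tendsto.mono_left nhdsWithin_le_nhds).neg
  have h2 : Tendsto (fun y : ℝ => g (-y)) (nhds 0) (nhds (g 0)) := by
    have : Tendsto (fun y : ℝ => -y) (nhds 0) (nhds 0) := by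
      simpa using (continuous_neg (G := ℝ)).tendsto 0
    exact hg.tendsto.comp this
  have h3 := (h2.mono_left (nhdsWithin_le_nhds (s := {0}ᶜ))).congr' hodd
  have := tendsto_nhds_unique h1 h3
  linarith

theorem exists_evenQuadraticExpansion {F : ℝ → ℝ} (hFan : AnalyticAt ℝ F 0)
    (hFeven : ∀ᶠ x in nhds (0 : ℝ), F (-x) = F x) (hF0 : F 0 = 0)
    (hF2 : iteratedDeriv 2 F 0 ≠ 0) :
    ∃ E a K η, a ≠ 0 ∧ EvenQuadraticExpansion F E a K η := by
  set F₁ := dslope F 0 with hF₁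
  have an₁ : AnalyticAt ℝ F₁ 0 := analyticAt_dslope_self hFan
  have e₁ : ∀ y, F y = y * F₁ y := eq_mul_dslope_zero hF0
  have odd₁ : ∀ᶠ y in nhdsWithin (0 : ℝ) {0}ᶜ, F₁ (-y) = -F₁ y := by
    filter_upwards [hFeven.filter_mono nhdsWithin_le_nhds, self_mem_nhdsWithin] with y hy hy0
    rw [e₁, e₁ y] at hy
    exact mul_left_cancel₀ hy0 (by linarith)
  have z₁ : F₁ 0 = 0 := zero_of_eventually_odd an₁.continuousAt odd₁
  set F₂ := dslope F₁ 0 with hF₂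
  have an₂ : AnalyticAt ℝ F₂ 0 := analyticAt_dslope_self an₁
  have e₂ : ∀ y, F₁ y = y * F₂ y := eq_mul_dslope_zero z₁
  have even₂ : ∀ᶠ y in nhdsWithin (0 : ℝ) {0}ᶜ, F₂ (-y) = F₂ y := by
    filter_upwards [odd₁, self_mem_nhdsWithin] with y hy hy0
    rw [e₂, e₂ y] at hy
    exact mul_left_cancel₀ hy0 (by linarith)
  set a := F₂ 0 with ha
  set G := fun y => F₂ y - a with hG
  have anG : AnalyticAt ℝ G 0 := an₂.sub analyticAt_const
  have zG : G 0 = 0 := by simp [hG, ha]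
  set F₃ := dslope G 0 with hF₃
  have an₃ : AnalyticAt ℝ F₃ 0 := analyticAt_dslope_self anG
  have e₃ : ∀ y, G y = y * F₃ y := eq_mul_dslope_zero zG
  have odd₃ : ∀ᶠ y in nhdsWithin (0 : ℝ) {0}ᶜ, F₃ (-y) = -F₃ y := by
    filter_upwards [even₂, self_mem_nhdsWithin] with y hy hy0
    have hy' : G (-y) = G y := by simp [hG, hy]
    rw [e₃, e₃ y] at hy'
    exact mul_left_cancel₀ hy0 (by linarith)
  have z₃ : F₃ 0 = 0 := zero_of_eventually_odd an₃.continuousAt odd₃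
  have eF : ∀ y, F y = a * y ^ 2 + y * (y ^ 2 * F₃ y) := by
    intro y
    have h3 := e₃ y
    simp only [hG] at h3
    rw [e₁, e₂]
    linear_combination y ^ 2 * h3
  have ha0 : a ≠ 0 := by
    intro ha0
    apply hF2
    rw [iteratedDeriv_succ, iteratedDeriv_one]
    have hd : deriv F =ᶠ[nhds 0] fun y => 3 * y ^ 2 * F₃ y + y ^ 3 * deriv F₃ y := by
      filter_upwards [an₃.eventually_analyticAt] with y hy
      have h : F = fun y => y ^ 3 * F₃ y := by
        ext y
        rw [eF, ha0]
        ring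
      rw [h]
      have := ((hasDerivAt_pow 3 y).mul hy.differentiableAt.hasDerivAt).deriv
      simpa [Pi.mul_def] using this
    rw [hd.deriv_eq]
    have h1 := ((hasDerivAt_pow 2 (0 : ℝ)).const_mul 3).mul
      an₃.differentiableAt.hasDerivAt
    have h2 := (hasDerivAt_pow 3 (0 : ℝ)).mul
      an₃.deriv.differentiableAt.hasDerivAt
    have := (h1.add h2).deriv
    simpa [Pi.mul_def, Pi.add_def] using this
  obtain ⟨L, t, ht, hL⟩ := (an₃.contDiffAt (n := 1)).exists_lipschitzOnWith
  obtain ⟨η, hη, hηt⟩ := Metric.eventually_nhds_iff.1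
    (hFeven.and (show ∀ᶠ y in nhds (0 : ℝ), y ∈ t from ht))
  have hin : ∀ y : ℝ, |y| ≤ min (η / 2) 1 → F (-y) = F y ∧ y ∈ t := by
    intro y hy
    apply hηt
    rw [Real.dist_eq, sub_zero]
    have := hy.trans (min_le_left _ _)
    linarith
  refine ⟨fun y => y ^ 2 * F₃ y, a, max (max 1 |a|) (3 * L), min (η / 2) 1, ha0,
    ⟨le_max_of_le_left (le_max_left _ _), le_max_of_le_left (le_max_right _ _),
      by positivity, min_le_right _ _, fun y _ => eF y, fun y hy => (hin y hy).1, by simp, ?_⟩⟩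
  intro m hm y z hy hz
  have hm0 : 0 ≤ m := (abs_nonneg _).trans hy
  have hlip : ∀ y z : ℝ, |y| ≤ m → |z| ≤ m → |F₃ y - F₃ z| ≤ L * |y - z| := by
    intro y z hy hz
    have := hL.dist_le_mul y (hin y (hy.trans hm)).2 z (hin z (hz.trans hm)).2
    simpa [Real.dist_eq] using this
  have hyL : |F₃ y| ≤ L * m := by
    have := hlip y 0 hy (by simpa using hm0)
    rw [z₃, sub_zero, sub_zero] at this
    exact this.trans (by gcongr)
  calc |y ^ 2 * F₃ y - z ^ 2 * F₃ z|
      = |(y - z) * (y + z) * F₃ y + z ^ 2 * (F₃ y - F₃ z)| := by ring_nf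
    _ ≤ |y - z| * (|y| + |z|) * |F₃ y| + |z| ^ 2 * |F₃ y - F₃ z| := by
      refine (abs_add_le _ _).trans ?_
      rw [abs_mul, abs_mul, abs_mul, abs_pow]
      gcongr
      exact abs_add_le _ _
    _ ≤ |y - z| * (m + m) * (L * m) + m ^ 2 * (L * |y - z|) := by
      gcongr
      exact hlip y z hy hz
    _ = 3 * L * m ^ 2 * |y - z| := by ring
    _ ≤ _ := by
      gcongr
      exact le_max_right _ _

namespace EvenQuadraticExpansion

variable {F E : ℝ → ℝ} {a K η : ℝ}

theorem abs_remainder_le (h : EvenQuadraticExpansion F E a K η) {m y : ℝ} (hm : m ≤ η)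
    (hy : |y| ≤ m) : |E y| ≤ K * m ^ 3 := by
  have hm0 : 0 ≤ m := (abs_nonneg _).trans hy
  have hK := h.one_le
  have := h.remainder_lipschitz m hm y 0 hy (by simpa using hm0)
  rw [h.remainder_zero, sub_zero, sub_zero] at this
  calc |E y| ≤ K * m ^ 2 * |y| := this
    _ ≤ K * m ^ 2 * m := by gcongr
    _ = _ := by ring

theorem abs_le (h : EvenQuadraticExpansion F E a K η) {y : ℝ} (hy : |y| ≤ η) :
    |F y| ≤ 2 * K * y ^ 2 := by
  have hK := h.one_le
  have hy1 : |y| ≤ 1 := hy.trans h.radius_le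
  rw [h.eq y hy]
  calc |a * y ^ 2 + y * E y| ≤ |a| * y ^ 2 + |y| * |E y| := by
        refine (abs_add_le _ _).trans ?_
        rw [abs_mul, abs_mul, abs_pow, sq_abs]
    _ ≤ K * y ^ 2 + |y| * (K * |y| ^ 3) := by
        gcongr
        · exact h.abs_coeff_le
        · exact h.abs_remainder_le hy le_rfl
    _ = K * y ^ 2 + K * y ^ 2 * |y| ^ 2 := by
        rw [← sq_abs y]
        ring
    _ ≤ K * y ^ 2 + K * y ^ 2 * 1 ^ 2 := by gcongr
    _ = _ := by ring

theorem abs_sub_le (h : EvenQuadraticExpansion F E a K η) {y z : ℝ} (hy : |y| ≤ η)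
    (hz : |z| ≤ η) : |F y - F z| ≤ 4 * K * |y - z| := by
  have hK := h.one_le
  have hη0 := h.radius_pos
  have hη := h.radius_le
  rw [h.eq y hy, h.eq z hz]
  have hE := h.abs_remainder_le le_rfl hy
  have hL := h.remainder_lipschitz η le_rfl y z hy hz
  calc |a * y ^ 2 + y * E y - (a * z ^ 2 + z * E z)|
      = |a * (y - z) * (y + z) + (y - z) * E y + z * (E y - E z)| := by ring_nf
    _ ≤ |a| * |y - z| * (|y| + |z|) + |y - z| * |E y| + |z| * |E y - E z| := by
        refine (abs_add_le _ _).trans (add_le_add ((abs_add_le _ _).trans (add_le_add ?_ ?_)) ?_)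
        · rw [abs_mul, abs_mul]
          gcongr
          exact abs_add_le _ _
        · rw [abs_mul]
        · rw [abs_mul]
    _ ≤ K * |y - z| * (1 + 1) + |y - z| * (K * 1 ^ 3) + 1 * (K * 1 ^ 2 * |y - z|) := by
        have := h.abs_coeff_le
        gcongr
        · exact hy.trans hη
        · exact hz.trans hη
        · exact hE.trans (by gcongr)
        · exact hz.trans hη
        · exact hL.trans (by gcongr)
    _ = _ := by ring

/-- Two trajectories of the planar system that stay in the strip where `F` is Lipschitz agree as
soon as they start at the same point. -/
theorem eqOn_of_trajectories (h : EvenQuadraticExpansion F E a K η) {x₁ y₁ x₂ y₂ : ℝ → ℝ} {b : ℝ}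
    (hx₁ : ∀ t ∈ Icc 0 b, HasDerivAt x₁ (y₁ t) t)
    (hy₁ : ∀ t ∈ Icc 0 b, HasDerivAt y₁ (-x₁ t - F (y₁ t)) t)
    (hx₂ : ∀ t ∈ Icc 0 b, HasDerivAt x₂ (y₂ t) t)
    (hy₂ : ∀ t ∈ Icc 0 b, HasDerivAt y₂ (-x₂ t - F (y₂ t)) t)
    (hs₁ : ∀ t ∈ Icc 0 b, |y₁ t| ≤ η) (hs₂ : ∀ t ∈ Icc 0 b, |y₂ t| ≤ η)
    (hx0 : x₁ 0 = x₂ 0) (hy0 : y₁ 0 = y₂ 0) :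
    ∀ t ∈ Icc 0 b, x₁ t = x₂ t ∧ y₁ t = y₂ t := by
  have hK := h.one_le
  have key := ODE_solution_unique_of_mem_Icc_right (a := 0) (b := b)
    (v := fun (_ : ℝ) (p : ℝ × ℝ) => (p.2, -p.1 - F p.2)) (s := fun _ => {p : ℝ × ℝ | |p.2| ≤ η})
    (K := Real.toNNReal (1 + 4 * K)) (f := fun t => (x₁ t, y₁ t)) (g := fun t => (x₂ t, y₂ t))
    ?_ ?_ ?_ ?_ ?_ ?_ ?_ ?_
  · intro t ht
    exact Prod.mk.inj (key ht)
  · intro t _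
    refine LipschitzOnWith.of_dist_le_mul fun p hp q hq => ?_
    rw [Real.coe_toNNReal _ (by linarith), Prod.dist_eq, Prod.dist_eq]
    simp only [Real.dist_eq]
    have h1 := le_max_left |p.1 - q.1| |p.2 - q.2|
    have h2 := le_max_right |p.1 - q.1| |p.2 - q.2|
    have h3 := h.abs_sub_le hp hq
    have h0 := (abs_nonneg _).trans h1
    refine max_le (by nlinarith) ?_
    calc |-p.1 - F p.2 - (-q.1 - F q.2)| = |-(p.1 - q.1) - (F p.2 - F q.2)| := by ring_nf
      _ ≤ |p.1 - q.1| + |F p.2 - F q.2| := by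
        refine (abs_sub _ _).trans ?_
        rw [abs_neg]
      _ ≤ _ := by nlinarith
  · exact fun t ht =>
      ((hx₁ t ht).continuousAt.prodMk (hy₁ t ht).continuousAt).continuousWithinAt
  · exact fun t ht =>
      ((hx₁ t (Ico_subset_Icc_self ht)).prodMk (hy₁ t (Ico_subset_Icc_self ht))).hasDerivWithinAt
  · exact fun t ht => hs₁ t (Ico_subset_Icc_self ht)
  · exact fun t ht =>
      ((hx₂ t ht).continuousAt.prodMk (hy₂ t ht).continuousAt).continuousWithinAt
  · exact fun t ht =>
      ((hx₂ t (Ico_subset_Icc_self ht)).prodMk (hy₂ t (Ico_subset_Icc_self ht))).hasDerivWithinAt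
  · exact fun t ht => hs₂ t (Ico_subset_Icc_self ht)
  · simp only [hx0, hy0]

end EvenQuadraticExpansion

namespace IsRayleighSolution

variable {F E u : ℝ → ℝ} {a K η c : ℝ}

theorem hasDerivAt (hu : IsRayleighSolution F u) (t : ℝ) : HasDerivAt u (deriv u t) t :=
  (hu.1.differentiable (by norm_num) t).hasDerivAt

theorem contDiff_deriv (hu : IsRayleighSolution F u) : ContDiff ℝ 1 (deriv u) :=
  (contDiff_succ_iff_deriv (n := 1).1 hu.1).2.2

theorem hasDerivAt_deriv (hu : IsRayleighSolution F u) (t : ℝ) :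
    HasDerivAt (deriv u) (-u t - F (deriv u t)) t := by
  have h := (hu.contDiff_deriv.differentiable (by norm_num) t).hasDerivAt
  have := hu.2 t
  rwa [show deriv (deriv u) t = -u t - F (deriv u t) by linarith] at h

theorem comp_add_const (hu : IsRayleighSolution F u) (s : ℝ) :
    IsRayleighSolution F fun t => u (t + s) := by
  have hd : deriv (fun t => u (t + s)) = fun t => deriv u (t + s) := by
    ext t
    exact deriv_comp_add_const u s t
  refine ⟨hu.1.comp (contDiff_id.add contDiff_const), fun t => ?_⟩
  rw [hd, deriv_comp_add_const]
  exact hu.2 _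

theorem hasDerivAt_energy (hu : IsRayleighSolution F u) (t : ℝ) :
    HasDerivAt (fun t => u t ^ 2 + deriv u t ^ 2) (-(2 * deriv u t * F (deriv u t))) t := by
  convert! ((hu.hasDerivAt t).pow 2).add ((hu.hasDerivAt_deriv t).pow 2) using 1
  push_cast
  ring

theorem energy_bounds (hu : IsRayleighSolution F u) (h : EvenQuadraticExpansion F E a K η)
    (hc : 0 < c) (hcK : 2000 * K * c ≤ 1) (hcη : 2 * c ≤ η) (h0 : u 0 = c)
    (h0' : deriv u 0 = 0) :
    ∀ t ∈ Icc (0 : ℝ) 20, c ^ 2 / 2 ≤ u t ^ 2 + deriv u t ^ 2 ∧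
      u t ^ 2 + deriv u t ^ 2 ≤ 2 * c ^ 2 := by
  have hK := h.one_le
  have hderiv : ∀ t, u t ^ 2 + deriv u t ^ 2 ≤ 2 * c ^ 2 →
      |2 * deriv u t * F (deriv u t)| < c ^ 2 / 40 := by
    intro t ht
    have hy : |deriv u t| ≤ 2 * c :=
      abs_le_of_sq_le_sq (by nlinarith [sq_nonneg (u t)]) (by linarith)
    calc |2 * deriv u t * F (deriv u t)| = 2 * |deriv u t| * |F (deriv u t)| := by
          rw [abs_mul, abs_mul, abs_two]
      _ ≤ 2 * (2 * c) * (2 * K * (2 * c) ^ 2) := by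
          have := h.abs_le (hy.trans hcη)
          gcongr
          refine this.trans ?_
          rw [← sq_abs]
          gcongr
      _ = c ^ 2 * (32 * (K * c)) := by ring
      _ < c ^ 2 * (1 / 40) := by
          gcongr
          linarith
      _ = _ := by ring
  have hcont : Continuous fun t => u t ^ 2 + deriv u t ^ 2 :=
    continuous_iff_continuousAt.2 fun t => (hu.hasDerivAt_energy t).continuousAt
  have upper := image_le_of_deriv_right_lt_deriv_boundary (a := 0) (b := 20)
    (f := fun t => u t ^ 2 + deriv u t ^ 2) (B := fun t => c ^ 2 + c ^ 2 / 20 * t)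
    (B' := fun _ => c ^ 2 / 20) hcont.continuousOn
    (fun t _ => (hu.hasDerivAt_energy t).hasDerivWithinAt) (by simp [h0, h0'])
    (fun t => by simpa using ((hasDerivAt_id t).const_mul (c ^ 2 / 20)).const_add (c ^ 2)) (by
      intro t ht heq
      have := hderiv t (by rw [heq]; nlinarith [ht.2, sq_nonneg c])
      rw [abs_lt] at this
      nlinarith [sq_nonneg c])
  have lower := image_le_of_deriv_right_lt_deriv_boundary (a := 0) (b := 20)
    (f := fun t => -(u t ^ 2 + deriv u t ^ 2)) (B := fun t => -c ^ 2 + c ^ 2 / 40 * t)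
    (B' := fun _ => c ^ 2 / 40) hcont.neg.continuousOn
    (fun t _ => (hu.hasDerivAt_energy t).neg.hasDerivWithinAt) (by simp [h0, h0'])
    (fun t => by simpa using ((hasDerivAt_id t).const_mul (c ^ 2 / 40)).const_add (-c ^ 2)) (by
      intro t ht heq
      have := hderiv t (by nlinarith [ht.1, sq_nonneg c])
      rw [abs_lt] at this
      linarith)
  intro t ht
  have h1 := upper ht
  have h2 := lower ht
  constructor <;> nlinarith [ht.1, ht.2, sq_nonneg c]

theorem abs_deriv_le (hu : IsRayleighSolution F u) (h : EvenQuadraticExpansion F E a K η)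
    (hc : 0 < c) (hcK : 2000 * K * c ≤ 1) (hcη : 2 * c ≤ η) (h0 : u 0 = c)
    (h0' : deriv u 0 = 0) {t : ℝ} (ht : t ∈ Icc (0 : ℝ) 20) : |deriv u t| ≤ 2 * c := by
  have := hu.energy_bounds h hc hcK hcη h0 h0' t ht
  exact abs_le_of_sq_le_sq (by nlinarith [sq_nonneg (u t)]) (by linarith)

end IsRayleighSolution

/-- On `[0, π]` the polar angle `φ` parametrizes the trajectory of `u` through `(c, 0)`: at time
`τ φ` it is at `(r φ * cos φ, -(r φ * sin φ))`. -/
structure IsPolarParametrization (F u : ℝ → ℝ) (c : ℝ) (τ r : ℝ → ℝ) : Prop where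
  time_strictMono : StrictMono τ
  time_continuous : Continuous τ
  time_zero : τ 0 = 0
  time_pi_le : τ π ≤ 10
  radius_zero : r 0 = c
  radius_pos : ∀ φ ∈ Icc 0 π, 0 < r φ
  radius_le : ∀ φ ∈ Icc 0 π, r φ ≤ 2 * c
  position : ∀ φ ∈ Icc 0 π, u (τ φ) = r φ * cos φ
  velocity : ∀ φ ∈ Icc 0 π, deriv u (τ φ) = -(r φ * sin φ)
  hasDerivAt_time : ∀ φ ∈ Icc 0 π,
    HasDerivAt τ (1 + cos φ * (F (r φ * sin φ) / r φ))⁻¹ φ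
  hasDerivAt_radius : ∀ φ ∈ Icc 0 π,
    HasDerivAt r (sin φ * F (r φ * sin φ) * (1 + cos φ * (F (r φ * sin φ) / r φ))⁻¹) φ

theorem monotone_sub_half_of_half_le_deriv {θ θ' : ℝ → ℝ} (hθ : ∀ t, HasDerivAt θ (θ' t) t)
    (hθ' : ∀ t, 1 / 2 ≤ θ' t) : Monotone fun t => θ t - t / 2 := by
  have hd : ∀ t, HasDerivAt (fun t => θ t - t / 2) (θ' t - 1 / 2) t := fun t =>
    (hθ t).sub ((hasDerivAt_id t).div_const 2)
  refine monotone_of_deriv_nonneg (fun t => (hd t).differentiableAt) fun t => ?_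
  rw [(hd t).deriv]
  linarith [hθ' t]

/-- A function whose derivative is at least `1 / 2` has a strictly increasing
differentiable inverse. -/
theorem exists_inverse_of_half_le_deriv {θ θ' : ℝ → ℝ} (hθ : ∀ t, HasDerivAt θ (θ' t) t)
    (hθ' : ∀ t, 1 / 2 ≤ θ' t) :
    ∃ τ : ℝ → ℝ, StrictMono τ ∧ Continuous τ ∧ (∀ φ, θ (τ φ) = φ) ∧ (∀ t, τ (θ t) = t) ∧
      ∀ φ, HasDerivAt τ (θ' (τ φ))⁻¹ φ := by
  have hmono : StrictMono θ := strictMono_of_deriv_pos fun t => by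
    rw [(hθ t).deriv]
    linarith [hθ' t]
  have hcont : Continuous θ := continuous_iff_continuousAt.2 fun t => (hθ t).continuousAt
  have hsub := monotone_sub_half_of_half_le_deriv hθ hθ'
  have hsurj : Function.Surjective θ := by
    refine hcont.surjective ?_ ?_
    · have : Tendsto (fun t : ℝ => t / 2 + θ 0) atTop atTop :=
        tendsto_atTop_add_const_right _ _ (tendsto_id.atTop_div_const (by norm_num))
      refine tendsto_atTop_mono' _ ?_ this
      filter_upwards [eventually_ge_atTop 0] with t ht
      have := hsub ht
      simp only at this
      linarith
    · have : Tendsto (fun t : ℝ => t / 2 + θ 0) atBot atBot :=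
        tendsto_atBot_add_const_right _ _ (tendsto_id.atBot_div_const (by norm_num))
      refine tendsto_atBot_mono' _ ?_ this
      filter_upwards [eventually_le_atBot 0] with t ht
      have := hsub ht
      simp only at this
      linarith
  let e := hmono.orderIsoOfSurjective θ hsurj
  have he : ∀ φ, θ (e.symm φ) = φ := fun φ => e.apply_symm_apply φ
  refine ⟨e.symm, e.symm.strictMono, e.symm.continuous, he, fun t => e.symm_apply_apply t,
    fun φ => ?_⟩
  exact (hθ _).of_local_left_inverse e.symm.continuous.continuousAt
    (by linarith [hθ' (e.symm φ)]) (Eventually.of_forall he)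

theorem IsRayleighSolution.exists_polarParametrization {F E u : ℝ → ℝ} {a K η c : ℝ}
    (hu : IsRayleighSolution F u) (h : EvenQuadraticExpansion F E a K η)
    (hc : 0 < c) (hcK : 2000 * K * c ≤ 1) (hcη : 2 * c ≤ η) (h0 : u 0 = c)
    (h0' : deriv u 0 = 0) : ∃ τ r, IsPolarParametrization F u c τ r := by
  have hK := h.one_le
  have hbd := hu.energy_bounds h hc hcK hcη h0 h0'
  have hcu : Continuous u := hu.1.continuous
  have hcu' : Continuous (deriv u) := hu.contDiff_deriv.continuous
  have hF_eq : (fun t => F (deriv u t)) = fun t => -u t - deriv (deriv u) t := by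
    ext t
    linarith [hu.2 t]
  have hcF : Continuous fun t => F (deriv u t) := by
    rw [hF_eq]
    exact hcu.neg.sub (hu.contDiff_deriv.continuous_deriv (by norm_num))
  set κ : ℝ → ℝ := fun t => max (-(1 / 2)) (min (1 / 2)
    (u t * F (deriv u t) / max (u t ^ 2 + deriv u t ^ 2) (c ^ 2 / 2))) with hκ
  have hcκ : Continuous κ := by
    refine continuous_const.max (continuous_const.min ((hcu.mul hcF).div
      (((hcu.pow 2).add (hcu'.pow 2)).max continuous_const) fun t => ?_))
    exact ne_of_gt (lt_max_of_lt_right (by positivity))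
  have hκ_eq : ∀ t ∈ Icc (0 : ℝ) 20,
      κ t = u t * F (deriv u t) / (u t ^ 2 + deriv u t ^ 2) := by
    intro t ht
    obtain ⟨hl, hr⟩ := hbd t ht
    have hR : 0 < u t ^ 2 + deriv u t ^ 2 := lt_of_lt_of_le (by positivity) hl
    have hx : |u t| ≤ 2 * c :=
      abs_le_of_sq_le_sq (by nlinarith [sq_nonneg (deriv u t)]) (by linarith)
    have hy := hu.abs_deriv_le h hc hcK hcη h0 h0' ht
    have hF := h.abs_le (hy.trans hcη)
    have habs : |u t * F (deriv u t) / (u t ^ 2 + deriv u t ^ 2)| ≤ 1 / 2 := by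
      rw [abs_div, abs_of_pos hR, div_le_iff₀ hR, abs_mul]
      calc |u t| * |F (deriv u t)| ≤ (2 * c) * (2 * K * (2 * c) ^ 2) := by
            gcongr
            refine hF.trans ?_
            rw [← sq_abs]
            gcongr
        _ = c ^ 2 * (16 * (K * c)) := by ring
        _ ≤ c ^ 2 * (1 / 4) := by
            gcongr
            linarith
        _ ≤ _ := by linarith
    obtain ⟨h1, h2⟩ := _root_.abs_le.1 habs
    rw [hκ]
    simp only
    rw [max_eq_left hl, min_eq_right h2, max_eq_right h1]
  set θ : ℝ → ℝ := fun t => ∫ s in (0 : ℝ)..t, (1 + κ s) with hθ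
  have hθd : ∀ t, HasDerivAt θ (1 + κ t) t := fun t =>
    ((continuous_const.add hcκ).integral_hasStrictDerivAt 0 t).hasDerivAt
  have hθ' : ∀ t, 1 / 2 ≤ 1 + κ t := fun t => by
    have : -(1 / 2) ≤ κ t := le_max_left _ _
    linarith
  have hθ0 : θ 0 = 0 := intervalIntegral.integral_same
  obtain ⟨τ, hτm, hτc, hθτ, hτθ, hτd⟩ := exists_inverse_of_half_le_deriv hθd hθ'
  have hτ0 : τ 0 = 0 := by simpa [hθ0] using hτθ 0
  have hτπ : τ π ≤ 10 := by
    have hm := monotone_sub_half_of_half_le_deriv hθd hθ'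
    have hp : 0 ≤ τ π := by
      rw [← hτ0]
      exact hτm.monotone pi_pos.le
    have := hm hp
    simp only [hθτ, hθ0] at this
    linarith [pi_le_four, pi_lt_d2]
  have hτmem : ∀ φ ∈ Icc 0 π, τ φ ∈ Icc (0 : ℝ) 20 := by
    intro φ hφ
    constructor
    · rw [← hτ0]
      exact hτm.monotone hφ.1
    · linarith [hτm.monotone hφ.2]
  -- The coordinates of `(u, u')` in the frame rotating with angle `θ`.
  set W : ℝ → ℝ := fun t => u t * cos (θ t) - deriv u t * sin (θ t) with hW
  set V : ℝ → ℝ := fun t => u t * sin (θ t) + deriv u t * cos (θ t) with hV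
  have hVd : ∀ t, HasDerivAt V (deriv u t * sin (θ t) + u t * (cos (θ t) * (1 + κ t)) +
      ((-u t - F (deriv u t)) * cos (θ t) + deriv u t * (-sin (θ t) * (1 + κ t)))) t := fun t =>
    ((hu.hasDerivAt t).mul (hθd t).sin).add ((hu.hasDerivAt_deriv t).mul (hθd t).cos)
  have hWd : ∀ t, HasDerivAt W (deriv u t * cos (θ t) + u t * (-sin (θ t) * (1 + κ t)) -
      ((-u t - F (deriv u t)) * sin (θ t) + deriv u t * (cos (θ t) * (1 + κ t)))) t := fun t =>
    ((hu.hasDerivAt t).mul (hθd t).cos).sub ((hu.hasDerivAt_deriv t).mul (hθd t).sin)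
  have hVW : ∀ t, V t ^ 2 + W t ^ 2 = u t ^ 2 + deriv u t ^ 2 := by
    intro t
    simp only [hV, hW]
    linear_combination (u t ^ 2 + deriv u t ^ 2) * sin_sq_add_cos_sq (θ t)
  have hV0 : ∀ t ∈ Icc (0 : ℝ) 20, V t = 0 := by
    have hgr := norm_le_gronwallBound_of_norm_deriv_right_le (f := V) (a := 0) (b := 20)
      (δ := 0) (K := 1) (ε := 0)
      (fun t _ => (hVd t).continuousAt.continuousWithinAt)
      (fun t _ => (hVd t).hasDerivWithinAt) (by simp [hV, hθ0, h0']) (by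
        intro t ht
        obtain ⟨hl, hr⟩ := hbd t (Ico_subset_Icc_self ht)
        have hR : 0 < u t ^ 2 + deriv u t ^ 2 := lt_of_lt_of_le (by positivity) hl
        have hy := hu.abs_deriv_le h hc hcK hcη h0 h0' (Ico_subset_Icc_self ht)
        have hF := h.abs_le (hy.trans hcη)
        rw [hκ_eq t (Ico_subset_Icc_self ht)]
        rw [show deriv u t * sin (θ t) + u t * (cos (θ t) *
            (1 + u t * F (deriv u t) / (u t ^ 2 + deriv u t ^ 2))) +
            ((-u t - F (deriv u t)) * cos (θ t) + deriv u t * (-sin (θ t) *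
            (1 + u t * F (deriv u t) / (u t ^ 2 + deriv u t ^ 2)))) =
            -(deriv u t * F (deriv u t) / (u t ^ 2 + deriv u t ^ 2)) * V t by
          simp only [hV]
          field_simp
          ring]
        rw [norm_mul, add_zero]
        gcongr
        rw [norm_neg, Real.norm_eq_abs, abs_div, abs_of_pos hR, div_le_one hR, abs_mul]
        calc |deriv u t| * |F (deriv u t)| ≤ (2 * c) * (2 * K * (2 * c) ^ 2) := by
              gcongr
              refine hF.trans ?_
              rw [← sq_abs]
              gcongr
          _ = c ^ 2 * (16 * (K * c)) := by ring
          _ ≤ c ^ 2 * (1 / 2) := by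
              gcongr
              linarith
          _ ≤ _ := by linarith)
    intro t ht
    simpa [gronwallBound_ε0_δ0] using hgr t ht
  have hWsq : ∀ t ∈ Icc (0 : ℝ) 20, W t ^ 2 = u t ^ 2 + deriv u t ^ 2 := by
    intro t ht
    rw [← hVW, hV0 t ht]
    ring
  have hx : ∀ t ∈ Icc (0 : ℝ) 20, u t = W t * cos (θ t) := by
    intro t ht
    have := hV0 t ht
    simp only [hV] at this
    simp only [hW]
    linear_combination sin (θ t) * this - u t * sin_sq_add_cos_sq (θ t)
  have hy : ∀ t ∈ Icc (0 : ℝ) 20, deriv u t = -(W t * sin (θ t)) := by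
    intro t ht
    have := hV0 t ht
    simp only [hV] at this
    simp only [hW]
    linear_combination cos (θ t) * this - deriv u t * sin_sq_add_cos_sq (θ t)
  have hW0 : W 0 = c := by simp [hW, hθ0, h0]
  have hWpos : ∀ t ∈ Icc (0 : ℝ) 20, 0 < W t := by
    intro t ht
    by_contra! hneg
    have hWc : ContinuousOn W (Icc 0 t) := fun s _ => (hWd s).continuousAt.continuousWithinAt
    obtain ⟨s, hs, hs0⟩ := intermediate_value_Icc' ht.1 hWc
      (show (0 : ℝ) ∈ Icc (W t) (W 0) from ⟨hneg, by rw [hW0]; exact hc.le⟩)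
    have hs' : s ∈ Icc (0 : ℝ) 20 := ⟨hs.1, hs.2.trans ht.2⟩
    have h1 := hWsq s hs'
    have h2 := (hbd s hs').1
    rw [hs0] at h1
    have : 0 < c ^ 2 := by positivity
    linarith
  have hκW : ∀ t ∈ Icc (0 : ℝ) 20, κ t = cos (θ t) * (F (W t * sin (θ t)) / W t) := by
    intro t ht
    have hW1 := (hWpos t ht).ne'
    have hyη := (hu.abs_deriv_le h hc hcK hcη h0 h0' ht).trans hcη
    have hFe := h.even _ hyη
    rw [show -deriv u t = W t * sin (θ t) by rw [hy t ht]; ring] at hFe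
    rw [hκ_eq t ht, ← hWsq t ht, ← hFe, hx t ht]
    field_simp
  refine ⟨τ, fun φ => W (τ φ), hτm, hτc, hτ0, hτπ, by simp only [hτ0, hW0],
    fun φ hφ => hWpos _ (hτmem φ hφ), fun φ hφ => ?_, fun φ hφ => ?_, fun φ hφ => ?_,
    fun φ hφ => ?_, fun φ hφ => ?_⟩
  · have h1 := hWsq _ (hτmem φ hφ)
    have h2 := (hbd _ (hτmem φ hφ)).2
    exact (le_abs_self _).trans (abs_le_of_sq_le_sq (by nlinarith [sq_nonneg c]) (by linarith))
  · rw [hx _ (hτmem φ hφ), hθτ]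
  · rw [hy _ (hτmem φ hφ), hθτ]
  · have := hτd φ
    rwa [hκW _ (hτmem φ hφ), hθτ] at this
  · have h1 := hτd φ
    have h2 := (hWd (τ φ)).comp φ h1
    have hyη := (hu.abs_deriv_le h hc hcK hcη h0 h0' (hτmem φ hφ)).trans hcη
    have hFe := h.even _ hyη
    rw [show -deriv u (τ φ) = W (τ φ) * sin φ by rw [hy _ (hτmem φ hφ), hθτ]; ring] at hFe
    convert! h2 using 1
    rw [hκW _ (hτmem φ hφ), hθτ, ← hFe]
    congr 1
    have hx1 := hx _ (hτmem φ hφ)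
    have hy1 := hy _ (hτmem φ hφ)
    rw [hθτ] at hx1 hy1
    rw [hx1, hy1]
    ring

/-- The half period is the time at which the polar angle reaches `π`. -/
theorem IsPolarParametrization.isLeast_period {F E u τ r : ℝ → ℝ} {a K η c p : ℝ}
    (hpol : IsPolarParametrization F u c τ r) (hu : IsRayleighSolution F u)
    (h : EvenQuadraticExpansion F E a K η)
    (hc : 0 < c) (hcK : 2000 * K * c ≤ 1) (hcη : 2 * c ≤ η) (h0 : u 0 = c)
    (h0' : deriv u 0 = 0)
    (hp : IsLeast {p : ℝ | 0 < p ∧ ∀ t, u (t + p) = u t} p) : p = 2 * τ π := by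
  set Q := τ π with hQ
  have hQpos : 0 < Q := by
    rw [hQ, ← hpol.time_zero]
    exact hpol.time_strictMono pi_pos
  have hQ10 : Q ≤ 10 := hpol.time_pi_le
  have hQ' : deriv u Q = 0 := by
    simpa using hpol.velocity π (right_mem_Icc.2 pi_pos.le)
  have hsmall : ∀ t ∈ Icc (0 : ℝ) 20, |deriv u t| ≤ η := fun t ht =>
    (hu.abs_deriv_le h hc hcK hcη h0 h0' ht).trans hcη
  have hrefl : ∀ t ∈ Icc 0 Q, u (t + Q) = u (Q - t) ∧ deriv u (t + Q) = -deriv u (Q - t) := by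
    refine h.eqOn_of_trajectories (fun t _ => (hu.hasDerivAt _).comp_add_const t Q)
      (fun t _ => (hu.hasDerivAt_deriv _).comp_add_const t Q)
      (fun t _ => (hu.hasDerivAt _).comp_const_sub Q t) (fun t ht => ?_) (fun t ht => ?_)
      (fun t ht => ?_) (by simp) (by simp [hQ'])
    · have hs := hsmall (Q - t) ⟨by linarith [ht.2], by linarith [ht.1]⟩
      rw [h.even _ hs]
      convert! ((hu.hasDerivAt_deriv _).comp_const_sub Q t).neg using 1
      ring
    · exact hsmall _ ⟨by linarith [ht.1], by linarith [ht.2]⟩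
    · rw [abs_neg]
      exact hsmall (Q - t) ⟨by linarith [ht.2], by linarith [ht.1]⟩
  have h2Q : u (2 * Q) = c ∧ deriv u (2 * Q) = 0 := by
    have := hrefl Q ⟨hQpos.le, le_rfl⟩
    rw [← two_mul, sub_self, h0, h0', neg_zero] at this
    exact this
  have hiter : ∀ n : ℕ, u (2 * Q * n) = c ∧ deriv u (2 * Q * n) = 0 ∧
      ∀ t ∈ Icc (0 : ℝ) 20, u (t + 2 * Q * n) = u t := by
    have hagree : ∀ s, u s = c → deriv u s = 0 → ∀ t ∈ Icc (0 : ℝ) 20,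
        u (t + s) = u t ∧ deriv u (t + s) = deriv u t := by
      intro s hs hs'
      have hw := hu.comp_add_const s
      have hw' : ∀ t, deriv (fun t => u (t + s)) t = deriv u (t + s) :=
        deriv_comp_add_const u s
      refine h.eqOn_of_trajectories (fun t _ => (hu.hasDerivAt _).comp_add_const t s)
        (fun t _ => (hu.hasDerivAt_deriv _).comp_add_const t s)
        (fun t _ => hu.hasDerivAt t) (fun t _ => hu.hasDerivAt_deriv t) (fun t ht => ?_)
        hsmall (by simp [hs, h0]) (by simp [hs', h0'])
      rw [← hw']
      exact (hw.abs_deriv_le h hc hcK hcη (by simp [hs]) (by rw [hw', zero_add, hs']) ht).trans hcη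
    intro n
    induction n with
    | zero => simp [h0, h0']
    | succ n ih =>
      have hn := hagree _ ih.1 ih.2.1 (2 * Q) ⟨by linarith, by linarith⟩
      rw [h2Q.1, h2Q.2, show 2 * Q + 2 * Q * n = 2 * Q * (n + 1 : ℕ) by push_cast; ring] at hn
      exact ⟨hn.1, hn.2, fun t ht => (hagree _ hn.1 hn.2 t ht).1⟩
  have hpos : ∀ t, 0 ≤ t → u (t + 2 * Q) = u t := by
    intro t ht
    have hn := Nat.floor_le (div_nonneg ht (by linarith : 0 ≤ 2 * Q))
    have hn' := (Nat.lt_floor_add_one (t / (2 * Q))).le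
    rw [le_div_iff₀ (by linarith)] at hn
    rw [div_le_iff₀ (by linarith)] at hn'
    set n := ⌊t / (2 * Q)⌋₊
    have hs : t - 2 * Q * n ∈ Icc (0 : ℝ) 20 := ⟨by linarith, by linarith⟩
    have h1 := (hiter n).2.2 _ hs
    have h2 := (hiter (n + 1)).2.2 _ hs
    rw [show t - 2 * Q * n + 2 * Q * n = t by ring] at h1
    rw [show t - 2 * Q * n + 2 * Q * (n + 1 : ℕ) = t + 2 * Q by push_cast; ring] at h2
    rw [h1, h2]
  obtain ⟨⟨hp0, hper⟩, hleast⟩ := hp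
  have hupper : p ≤ 2 * Q := by
    refine hleast ⟨by linarith, fun t => ?_⟩
    have hP : Function.Periodic u p := hper
    obtain ⟨n, hn⟩ := exists_nat_gt (-t / p)
    rw [div_lt_iff₀ hp0] at hn
    have h1 := hpos (t + n * p) (by linarith)
    rw [hP.nat_mul n t, show t + n * p + 2 * Q = t + 2 * Q + n * p by ring,
      hP.nat_mul n (t + 2 * Q)] at h1
    exact h1
  have hfirst : ∀ t, 0 < t → t ≤ Q → u t = c → deriv u t = 0 → False := by
    intro t ht0 htQ htu htu'
    obtain ⟨φ, hφ, rfl⟩ := intermediate_value_Icc pi_pos.le hpol.time_continuous.continuousOn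
      (show t ∈ Icc (τ 0) (τ π) from ⟨by rw [hpol.time_zero]; exact ht0.le, htQ⟩)
    have hr := hpol.radius_pos φ hφ
    rw [hpol.position φ hφ] at htu
    rw [hpol.velocity φ hφ] at htu'
    have hφ0 : 0 < φ := by
      rw [← hpol.time_zero] at ht0
      exact hpol.time_strictMono.lt_iff_lt.1 ht0
    have hsin : sin φ = 0 := by
      rcases mul_eq_zero.1 (neg_eq_zero.1 htu') with h | h
      · exact absurd h hr.ne'
      · exact h
    rcases hφ.2.lt_or_eq with hlt | heq
    · exact (sin_pos_of_pos_of_lt_pi hφ0 hlt).ne' hsin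
    · rw [heq, cos_pi] at htu
      rw [heq] at hr
      linarith
  have hpu : u p = c := by simpa [h0] using hper 0
  have hpu' : deriv u p = 0 := by
    have : (fun t => u (t + p)) = u := funext hper
    have h2 := deriv_comp_add_const u p 0
    rw [this, h0', zero_add] at h2
    exact h2.symm
  refine le_antisymm hupper (not_lt.1 fun hlt => ?_)
  rcases le_or_gt p Q with hle | hgt
  · exact hfirst p hp0 hle hpu hpu'
  · have hr := hrefl (p - Q) ⟨by linarith, by linarith⟩
    rw [sub_add_cancel, show Q - (p - Q) = 2 * Q - p by ring, hpu, hpu'] at hr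
    exact hfirst (2 * Q - p) (by linarith) (by linarith) hr.1.symm (by linarith [hr.2])

theorem abs_mul_le_mul_of_le {x y A B : ℝ} (hx : |x| ≤ A) (hy : |y| ≤ B) : |x * y| ≤ A * B := by
  rw [abs_mul]
  exact mul_le_mul hx hy (abs_nonneg _) ((abs_nonneg _).trans hx)

theorem abs_add_le_add_of_le {x y A B : ℝ} (hx : |x| ≤ A) (hy : |y| ≤ B) : |x + y| ≤ A + B :=
  (abs_add_le _ _).trans (add_le_add hx hy)

theorem abs_polar_quotient_le {a K m s r e : ℝ} (hK : 1 ≤ K) (ha : |a| ≤ K) (hm : 4 * K * m ≤ 1)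
    (hs : |s| ≤ 1) (hr : |r| ≤ m) (he : |e| ≤ K * m ^ 3) : |a * r * s ^ 2 + s * e| ≤ 2 * K * m := by
  have hm0 : 0 ≤ m := (abs_nonneg _).trans hr
  have hm1 : m ≤ 1 := by nlinarith
  have hs2 : |s ^ 2| ≤ 1 := by
    rw [abs_pow]
    exact pow_le_one₀ (abs_nonneg _) hs
  have := abs_add_le_add_of_le (abs_mul_le_mul_of_le (abs_mul_le_mul_of_le ha hr) hs2)
    (abs_mul_le_mul_of_le hs he)
  refine this.trans ?_
  have : K * m ^ 3 ≤ K * m := by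
    gcongr
    exact pow_le_of_le_one hm0 hm1 (by norm_num)
  linarith

theorem half_le_one_add_mul {C q : ℝ} (hC : |C| ≤ 1) (hq : |q| ≤ 1 / 2) : 1 / 2 ≤ 1 + C * q := by
  have := neg_le_of_abs_le (abs_mul_le_mul_of_le hC hq)
  linarith

theorem abs_inv_le_two {x : ℝ} (hx : 1 / 2 ≤ x) : |x⁻¹| ≤ 2 := by
  rw [abs_inv, abs_of_pos (by linarith)]
  exact inv_le_of_inv_le₀ (by norm_num) (by linarith)

/-- Second order expansion of the differences of the right-hand sides of the equations for the
time and the radius, in terms of the polar angle. -/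
theorem polar_difference_bounds {a K m s C r₁ r₂ e₁ e₂ q₁ q₂ : ℝ} (hK : 1 ≤ K) (ha : |a| ≤ K)
    (hm : 4 * K * m ≤ 1) (hs : |s| ≤ 1) (hC : |C| ≤ 1) (hr₁ : |r₁| ≤ m) (hr₂ : |r₂| ≤ m)
    (he₁ : |e₁| ≤ K * m ^ 3) (he₂ : |e₂| ≤ K * m ^ 3)
    (he : |e₂ - e₁| ≤ K * m ^ 2 * |r₂ - r₁|)
    (hq₁ : q₁ = a * r₁ * s ^ 2 + s * e₁) (hq₂ : q₂ = a * r₂ * s ^ 2 + s * e₂) :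
    |(1 + C * q₂)⁻¹ - (1 + C * q₁)⁻¹ -
      (-(C * a * s ^ 2 * (r₂ - r₁)) + a ^ 2 * C ^ 2 * s ^ 4 * ((r₁ + r₂) * (r₂ - r₁)))|
        ≤ 100 * K ^ 3 * m ^ 2 * |r₂ - r₁| ∧
    |s * (r₂ * q₂) * (1 + C * q₂)⁻¹ - s * (r₁ * q₁) * (1 + C * q₁)⁻¹ -
      a * s ^ 3 * ((r₁ + r₂) * (r₂ - r₁))| ≤ 100 * K ^ 3 * m ^ 2 * |r₂ - r₁| := by
  have hm0 : 0 ≤ m := (abs_nonneg _).trans hr₁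
  have hm1 : m ≤ 1 := by nlinarith
  have hb₁ : |q₁| ≤ 2 * K * m := hq₁ ▸ abs_polar_quotient_le hK ha hm hs hr₁ he₁
  have hb₂ : |q₂| ≤ 2 * K * m := hq₂ ▸ abs_polar_quotient_le hK ha hm hs hr₂ he₂
  have hp₁ := half_le_one_add_mul hC (hb₁.trans (by linarith))
  have hp₂ := half_le_one_add_mul hC (hb₂.trans (by linarith))
  have hg₁ := abs_inv_le_two hp₁
  have hg₂ := abs_inv_le_two hp₂
  have hi₁ : (1 + C * q₁) * (1 + C * q₁)⁻¹ = 1 := mul_inv_cancel₀ (by linarith)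
  have hi₂ : (1 + C * q₂) * (1 + C * q₂)⁻¹ = 1 := mul_inv_cancel₀ (by linarith)
  generalize (1 + C * q₁)⁻¹ = g₁ at *
  generalize (1 + C * q₂)⁻¹ = g₂ at *
  have hd : |r₂ - r₁| ≤ |r₂ - r₁| := le_rfl
  have hD := abs_nonneg (r₂ - r₁)
  set D := |r₂ - r₁|
  have hs2 : |s ^ 2| ≤ 1 := by
    rw [abs_pow]
    exact pow_le_one₀ (abs_nonneg _) hs
  have hC2 : |C ^ 2| ≤ 1 := by
    rw [abs_pow]
    exact pow_le_one₀ (abs_nonneg _) hC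
  have hqd_eq : q₂ - q₁ = a * (r₂ - r₁) * s ^ 2 + s * (e₂ - e₁) := by
    rw [hq₁, hq₂]
    ring
  have hm2 : m ^ 2 ≤ 1 := pow_le_one₀ hm0 hm1
  have hqd : |q₂ - q₁| ≤ 2 * K * D := by
    rw [hqd_eq]
    refine (abs_add_le_add_of_le (abs_mul_le_mul_of_le (abs_mul_le_mul_of_le ha hd) hs2)
      (abs_mul_le_mul_of_le hs he)).trans ?_
    have : K * m ^ 2 * D ≤ K * 1 * D := by gcongr
    linarith
  have hgd_eq : g₂ - g₁ = -(C * (q₂ - q₁) * (g₁ * g₂)) := by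
    linear_combination g₁ * hi₂ - g₂ * hi₁
  have hP₀ : 0 ≤ K ^ 3 * m ^ 2 * D := by positivity
  have hP : ∀ i ≤ 3, ∀ j ≥ 2, K ^ i * m ^ j * D ≤ K ^ 3 * m ^ 2 * D := fun i hi j hj => by
    have h1 := pow_le_pow_right₀ hK hi
    have h2 := pow_le_pow_of_le_one hm0 hm1 hj
    gcongr
  constructor
  · have hρ : g₁ * g₂ - (1 - C * q₁ - C * q₂) =
        C ^ 2 * (q₁ * q₁ * g₁ + q₂ * q₂ * g₂ + q₁ * q₂ * (g₁ * g₂)) := by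
      linear_combination (1 - C * q₁ - C * q₂ * g₂) * hi₁ + (g₁ - C * q₂) * hi₂
    have hρ' := abs_mul_le_mul_of_le hC2 (abs_add_le_add_of_le (abs_add_le_add_of_le
      (abs_mul_le_mul_of_le (abs_mul_le_mul_of_le hb₁ hb₁) hg₁)
      (abs_mul_le_mul_of_le (abs_mul_le_mul_of_le hb₂ hb₂) hg₂))
      (abs_mul_le_mul_of_le (abs_mul_le_mul_of_le hb₁ hb₂) (abs_mul_le_mul_of_le hg₁ hg₂)))
    rw [← hρ] at hρ'
    rw [show g₂ - g₁ - (-(C * a * s ^ 2 * (r₂ - r₁)) +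
        a ^ 2 * C ^ 2 * s ^ 4 * ((r₁ + r₂) * (r₂ - r₁))) =
        -(C * (q₂ - q₁) * (g₁ * g₂ - (1 - C * q₁ - C * q₂)))
        + -(C * (s * (e₂ - e₁)))
        + C ^ 2 * (a * (r₂ - r₁) * s ^ 2 * (s * (e₁ + e₂)) + s * (e₂ - e₁) * (q₁ + q₂)) by
      rw [hgd_eq, hq₁, hq₂]
      ring]
    refine (abs_add_le_add_of_le (abs_add_le_add_of_le
      ((abs_neg _).trans_le (abs_mul_le_mul_of_le (abs_mul_le_mul_of_le hC hqd) hρ'))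
      ((abs_neg _).trans_le (abs_mul_le_mul_of_le hC (abs_mul_le_mul_of_le hs he))))
      (abs_mul_le_mul_of_le hC2 (abs_add_le_add_of_le
        (abs_mul_le_mul_of_le (abs_mul_le_mul_of_le (abs_mul_le_mul_of_le ha hd) hs2)
          (abs_mul_le_mul_of_le hs (abs_add_le_add_of_le he₁ he₂)))
        (abs_mul_le_mul_of_le (abs_mul_le_mul_of_le hs he)
          (abs_add_le_add_of_le hb₁ hb₂))))).trans ?_
    linarith [hP 1 (by simp) 2 le_rfl, hP 2 (by simp) 3 (by simp)]
  · have hgd := abs_mul_le_mul_of_le (abs_mul_le_mul_of_le hC hqd) (abs_mul_le_mul_of_le hg₁ hg₂)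
    rw [← abs_neg, ← hgd_eq] at hgd
    rw [show s * (r₂ * q₂) * g₂ - s * (r₁ * q₁) * g₁ - a * s ^ 3 * ((r₁ + r₂) * (r₂ - r₁)) =
        s * (s * (r₂ * (e₂ - e₁) + (r₂ - r₁) * e₁)) +
        -(s * (C * ((r₂ - r₁) * (q₂ * q₂ * g₂) + r₁ * ((q₂ - q₁) * (q₁ + q₂) * g₂) +
          r₁ * (q₁ * q₁ * (g₂ - g₁))))) by
      have h₁ : g₁ = 1 - C * q₁ * g₁ := by linear_combination hi₁
      have h₂ : g₂ = 1 - C * q₂ * g₂ := by linear_combination hi₂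
      have : s * (r₂ * q₂) * g₂ - s * (r₁ * q₁) * g₁ = s * (r₂ * q₂) * (1 - C * q₂ * g₂) -
          s * (r₁ * q₁) * (1 - C * q₁ * g₁) := by rw [← h₁, ← h₂]
      rw [this]
      have : s * (r₂ * q₂ - r₁ * q₁) = a * s ^ 3 * ((r₁ + r₂) * (r₂ - r₁)) +
          s * (s * (r₂ * (e₂ - e₁) + (r₂ - r₁) * e₁)) := by
        rw [hq₁, hq₂]
        ring
      linear_combination this]
    refine (abs_add_le_add_of_le
      (abs_mul_le_mul_of_le hs (abs_mul_le_mul_of_le hs (abs_add_le_add_of_le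
        (abs_mul_le_mul_of_le hr₂ he) (abs_mul_le_mul_of_le hd he₁))))
      ((abs_neg _).trans_le (abs_mul_le_mul_of_le hs (abs_mul_le_mul_of_le hC
        (abs_add_le_add_of_le (abs_add_le_add_of_le
          (abs_mul_le_mul_of_le hd (abs_mul_le_mul_of_le (abs_mul_le_mul_of_le hb₂ hb₂) hg₂))
          (abs_mul_le_mul_of_le hr₁ (abs_mul_le_mul_of_le
            (abs_mul_le_mul_of_le hqd (abs_add_le_add_of_le hb₁ hb₂)) hg₂)))
          (abs_mul_le_mul_of_le hr₁
            (abs_mul_le_mul_of_le (abs_mul_le_mul_of_le hb₁ hb₁) hgd))))))).trans ?_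
    linarith [hP 1 (by simp) 3 (by simp), hP 2 (by simp) 2 le_rfl, hP 3 le_rfl 3 (by simp)]

theorem abs_le_of_hasDerivAt_on_Icc_pi {f f' : ℝ → ℝ} {B : ℝ}
    (hf : ∀ φ ∈ Icc 0 π, HasDerivAt f (f' φ) φ) (hB : ∀ φ ∈ Icc 0 π, |f' φ| ≤ B) (h0 : f 0 = 0) :
    ∀ φ ∈ Icc 0 π, |f φ| ≤ B * π := by
  intro φ hφ
  have hB0 : 0 ≤ B := (abs_nonneg _).trans (hB φ hφ)
  have := norm_image_sub_le_of_norm_deriv_le_segment' (fun x hx => (hf x hx).hasDerivWithinAt)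
    (fun x hx => hB x (Ico_subset_Icc_self hx)) φ hφ
  rw [h0, sub_zero, sub_zero] at this
  exact this.trans (by gcongr; exact hφ.2)

namespace IsPolarParametrization

variable {F E u τ r : ℝ → ℝ} {a K η c m : ℝ}

theorem abs_radius_mul_sin_le (h : IsPolarParametrization F u c τ r) (hm : 2 * c ≤ m) {φ : ℝ}
    (hφ : φ ∈ Icc 0 π) : |r φ| ≤ m ∧ |r φ * sin φ| ≤ m := by
  have h1 : |r φ| ≤ m := by
    rw [abs_of_pos (h.radius_pos φ hφ)]
    exact (h.radius_le φ hφ).trans hm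
  refine ⟨h1, ?_⟩
  simpa using abs_mul_le_mul_of_le h1 (abs_sin_le_one φ)

theorem quotient_eq (h : IsPolarParametrization F u c τ r)
    (hF : EvenQuadraticExpansion F E a K η) (hm : 2 * c ≤ m) (hmη : m ≤ η) {φ : ℝ}
    (hφ : φ ∈ Icc 0 π) :
    F (r φ * sin φ) = r φ * (a * r φ * sin φ ^ 2 + sin φ * E (r φ * sin φ)) := by
  rw [hF.eq _ ((h.abs_radius_mul_sin_le hm hφ).2.trans hmη)]
  ring

theorem hasDerivAt_time' (h : IsPolarParametrization F u c τ r)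
    (hF : EvenQuadraticExpansion F E a K η) (hm : 2 * c ≤ m) (hmη : m ≤ η) {φ : ℝ}
    (hφ : φ ∈ Icc 0 π) :
    HasDerivAt τ (1 + cos φ * (a * r φ * sin φ ^ 2 + sin φ * E (r φ * sin φ)))⁻¹ φ := by
  have := h.hasDerivAt_time φ hφ
  rwa [h.quotient_eq hF hm hmη hφ, mul_div_cancel_left₀ _ (h.radius_pos φ hφ).ne'] at this

theorem hasDerivAt_radius' (h : IsPolarParametrization F u c τ r)
    (hF : EvenQuadraticExpansion F E a K η) (hm : 2 * c ≤ m) (hmη : m ≤ η) {φ : ℝ}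
    (hφ : φ ∈ Icc 0 π) :
    HasDerivAt r (sin φ * (r φ * (a * r φ * sin φ ^ 2 + sin φ * E (r φ * sin φ))) *
      (1 + cos φ * (a * r φ * sin φ ^ 2 + sin φ * E (r φ * sin φ)))⁻¹) φ := by
  have := h.hasDerivAt_radius φ hφ
  rwa [h.quotient_eq hF hm hmη hφ, mul_div_cancel_left₀ _ (h.radius_pos φ hφ).ne'] at this

theorem abs_radius_sub_le (h : IsPolarParametrization F u c τ r)
    (hF : EvenQuadraticExpansion F E a K η) (hm : 2 * c ≤ m) (hmη : m ≤ η)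
    (hKm : 4 * K * m ≤ 1) : ∀ φ ∈ Icc 0 π, |r φ - c| ≤ 16 * K * m ^ 2 := by
  have hK := hF.one_le
  intro φ hφ
  have := abs_le_of_hasDerivAt_on_Icc_pi (f := fun φ => r φ - c) (B := 4 * K * m ^ 2)
    (fun φ hφ => (h.hasDerivAt_radius' hF hm hmη hφ).sub_const c) (fun φ hφ => ?_)
    (by simp [h.radius_zero]) φ hφ
  · refine this.trans ?_
    have : 4 * K * m ^ 2 * π ≤ 4 * K * m ^ 2 * 4 := by
      gcongr
      exact pi_le_four
    linarith
  · obtain ⟨h1, h2⟩ := h.abs_radius_mul_sin_le hm hφ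
    have hq := abs_polar_quotient_le hK hF.abs_coeff_le hKm (abs_sin_le_one φ) h1
      (hF.abs_remainder_le hmη h2)
    have hp := half_le_one_add_mul (abs_cos_le_one φ) (hq.trans (by linarith))
    refine (abs_mul_le_mul_of_le (abs_mul_le_mul_of_le (abs_sin_le_one φ)
      (abs_mul_le_mul_of_le h1 hq)) (abs_inv_le_two hp)).trans (le_of_eq ?_)
    ring

end IsPolarParametrization

theorem hasDerivAt_sinCube_primitive (φ : ℝ) :
    HasDerivAt (fun φ => 2 / 3 - cos φ + cos φ ^ 3 / 3) (sin φ ^ 3) φ := by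
  convert! (((hasDerivAt_cos φ).const_sub (2 / 3)).add
    (((hasDerivAt_cos φ).pow 3).div_const 3)) using 1
  push_cast
  linear_combination sin φ * sin_sq_add_cos_sq φ

theorem hasDerivAt_secondOrder_primitive (φ : ℝ) :
    HasDerivAt (fun φ => -(sin φ ^ 3 * (2 / 3 - cos φ + cos φ ^ 3 / 3)) / 3 + φ / 6 -
        sin φ ^ 3 * cos φ / 9 - sin φ * cos φ / 6 + sin φ ^ 5 * cos φ / 9)
      (-(cos φ * sin φ ^ 2 * (2 / 3 - cos φ + cos φ ^ 3 / 3)) + cos φ ^ 2 * sin φ ^ 4) φ := by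
  have hs := hasDerivAt_sin φ
  have hc := hasDerivAt_cos φ
  convert! (((((((hs.pow 3).mul (hasDerivAt_sinCube_primitive φ)).neg.div_const 3).add
    ((hasDerivAt_id φ).div_const 6)).sub (((hs.pow 3).mul hc).div_const 9)).sub
    ((hs.mul hc).div_const 6)).add (((hs.pow 5).mul hc).div_const 9)) using 1
  have h2 : cos φ ^ 2 = 1 - sin φ ^ 2 := by linarith [sin_sq_add_cos_sq φ]
  simp only [Pi.pow_apply]
  push_cast
  linear_combination (4 / 9 * sin φ ^ 4 + sin φ ^ 2 / 3 + 1 / 6) * h2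

/-- The half period increases with the amplitude: to leading order it is
`π + π * a ^ 2 * c ^ 2 / 6`. -/
theorem IsPolarParametrization.time_pi_lt {F E u₁ u₂ τ₁ τ₂ r₁ r₂ : ℝ → ℝ} {a K η c₁ c₂ : ℝ}
    (h₁ : IsPolarParametrization F u₁ c₁ τ₁ r₁) (h₂ : IsPolarParametrization F u₂ c₂ τ₂ r₂)
    (hF : EvenQuadraticExpansion F E a K η) (hc₁ : 0 < c₁) (hc : c₁ < c₂) (hη : 2 * c₂ ≤ η)
    (hK : 1000 * K ^ 3 * c₂ ≤ 1) (ha : 400000 * K ^ 5 * c₂ < a ^ 2) : τ₁ π < τ₂ π := by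
  have hK1 := hF.one_le
  have haK := hF.abs_coeff_le
  have hπ4 := pi_le_four
  obtain ⟨m, hm⟩ : ∃ m, m = 2 * c₂ := ⟨_, rfl⟩
  have hm0 : 0 ≤ m := by linarith
  have hm₁ : 2 * c₁ ≤ m := by linarith
  have hm₂ : 2 * c₂ ≤ m := by linarith
  have hmη : m ≤ η := by linarith
  have hK3m : 500 * K ^ 3 * m ≤ 1 := by
    rw [hm]
    linarith
  have hK13 : K ≤ K ^ 3 := le_self_pow₀ hK1 (by norm_num)
  have hKm : 4 * K * m ≤ 1 := by
    have : K * m ≤ K ^ 3 * m := by gcongr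
    nlinarith
  have hm1 : m ≤ 1 := hmη.trans hF.radius_le
  obtain ⟨σ, hσ⟩ : ∃ σ, σ = c₁ + c₂ := ⟨_, rfl⟩
  have hσm : |σ| ≤ m := by
    rw [abs_of_pos (by linarith)]
    linarith
  set Δ := c₂ - c₁ with hΔ
  have hΔ0 : 0 < Δ := by linarith
  have hP : ∀ N, ∀ i ≤ N, ∀ j ≥ 2, K ^ i * m ^ j * Δ ≤ K ^ N * m ^ 2 * Δ := fun N i hi j hj => by
    have e1 := pow_le_pow_right₀ hK1 hi
    have e2 := pow_le_pow_of_le_one hm0 hm1 hj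
    gcongr
  have hs : ∀ φ n, |sin φ ^ n| ≤ 1 := fun φ n => by
    rw [abs_pow]
    exact pow_le_one₀ (abs_nonneg _) (abs_sin_le_one φ)
  have hbd := fun φ (hφ : φ ∈ Icc 0 π) =>
    polar_difference_bounds hK1 haK hKm (abs_sin_le_one φ) (abs_cos_le_one φ)
      (h₁.abs_radius_mul_sin_le hm₁ hφ).1 (h₂.abs_radius_mul_sin_le hm₂ hφ).1
      (hF.abs_remainder_le hmη (h₁.abs_radius_mul_sin_le hm₁ hφ).2)
      (hF.abs_remainder_le hmη (h₂.abs_radius_mul_sin_le hm₂ hφ).2)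
      (by
        refine (hF.remainder_lipschitz m hmη _ _ (h₂.abs_radius_mul_sin_le hm₂ hφ).2
          (h₁.abs_radius_mul_sin_le hm₁ hφ).2).trans ?_
        rw [← sub_mul, abs_mul]
        gcongr
        exact mul_le_of_le_one_right (abs_nonneg _) (abs_sin_le_one φ)) rfl rfl
  have hrd := fun φ (hφ : φ ∈ Icc 0 π) =>
    (h₂.hasDerivAt_radius' hF hm₂ hmη hφ).sub (h₁.hasDerivAt_radius' hF hm₁ hmη hφ)
  have htd := fun φ (hφ : φ ∈ Icc 0 π) =>
    (h₂.hasDerivAt_time' hF hm₂ hmη hφ).sub (h₁.hasDerivAt_time' hF hm₁ hmη hφ)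
  have hσr : ∀ φ ∈ Icc 0 π, |r₁ φ + r₂ φ - σ| ≤ 32 * K * m ^ 2 := by
    intro φ hφ
    have e1 := h₁.abs_radius_sub_le hF hm₁ hmη hKm φ hφ
    have e2 := h₂.abs_radius_sub_le hF hm₂ hmη hKm φ hφ
    rw [show r₁ φ + r₂ φ - σ = (r₁ φ - c₁) + (r₂ φ - c₂) by rw [hσ]; ring]
    linarith [abs_add_le_add_of_le e1 e2]
  set r₁' : ℝ → ℝ := fun φ =>
    sin φ * (r₁ φ * (a * r₁ φ * sin φ ^ 2 + sin φ * E (r₁ φ * sin φ))) *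
      (1 + cos φ * (a * r₁ φ * sin φ ^ 2 + sin φ * E (r₁ φ * sin φ)))⁻¹ with hr₁'
  set r₂' : ℝ → ℝ := fun φ =>
    sin φ * (r₂ φ * (a * r₂ φ * sin φ ^ 2 + sin φ * E (r₂ φ * sin φ))) *
      (1 + cos φ * (a * r₂ φ * sin φ ^ 2 + sin φ * E (r₂ φ * sin φ)))⁻¹ with hr₂'
  set d : ℝ → ℝ := r₂ - r₁ with hd
  have hd0 : d 0 = Δ := by simp [hd, h₁.radius_zero, h₂.radius_zero, hΔ]
  have hd' : ∀ φ ∈ Icc 0 π, |r₂' φ - r₁' φ| ≤ 102 * K ^ 3 * m * |d φ| := by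
    intro φ hφ
    have e1 := (hbd φ hφ).2
    have e2 := abs_mul_le_mul_of_le (abs_mul_le_mul_of_le haK (hs φ 3))
      (abs_mul_le_mul_of_le (abs_add_le_add_of_le (h₁.abs_radius_mul_sin_le hm₁ hφ).1
        (h₂.abs_radius_mul_sin_le hm₂ hφ).1) (le_refl |r₂ φ - r₁ φ|))
    have e3 := abs_add_le_add_of_le e1 e2
    rw [sub_add_cancel] at e3
    refine e3.trans ?_
    have hD : 0 ≤ |r₂ φ - r₁ φ| := abs_nonneg _
    have e4 : K * m * |r₂ φ - r₁ φ| ≤ K ^ 3 * m * |r₂ φ - r₁ φ| := by gcongr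
    have e5 : K ^ 3 * m ^ 2 * |r₂ φ - r₁ φ| ≤ K ^ 3 * m * |r₂ φ - r₁ φ| := by
      gcongr
      exact pow_le_of_le_one hm0 hm1 (by norm_num)
    simp only [hd, Pi.sub_apply]
    linarith
  have hd3 : ∀ φ ∈ Icc 0 π, |d φ| ≤ 3 * Δ := by
    intro φ hφ
    have := norm_le_gronwallBound_of_norm_deriv_right_le (f := d) (a := 0) (b := π)
      (δ := Δ) (K := 102 * K ^ 3 * m) (ε := 0)
      (fun t ht => (hrd t ht).continuousAt.continuousWithinAt)
      (fun t ht => (hrd t (Ico_subset_Icc_self ht)).hasDerivWithinAt)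
      (by rw [hd0, Real.norm_eq_abs, abs_of_pos hΔ0])
      (fun t ht => by simpa using hd' t (Ico_subset_Icc_self ht)) φ hφ
    rw [gronwallBound_ε0, Real.norm_eq_abs] at this
    have he : Real.exp (102 * K ^ 3 * m * (φ - 0)) ≤ 3 := by
      refine (Real.exp_le_exp.2 ?_).trans (exp_one_lt_d9.le.trans (by norm_num : _ ≤ (3 : ℝ)))
      calc 102 * K ^ 3 * m * (φ - 0) ≤ 102 * K ^ 3 * m * 4 := by
            gcongr
            linarith [hφ.2]
        _ ≤ 1 := by
          have : 0 ≤ K ^ 3 * m := by positivity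
          linarith
    nlinarith
  have hdΔ : ∀ φ ∈ Icc 0 π, |d φ - Δ| ≤ 1224 * K ^ 3 * m * Δ := by
    intro φ hφ
    have := abs_le_of_hasDerivAt_on_Icc_pi (f := fun φ => d φ - Δ) (B := 306 * K ^ 3 * m * Δ)
      (fun φ hφ => (hrd φ hφ).sub_const Δ) (fun φ hφ => ?_) (by simp [hd0]) φ hφ
    · refine this.trans ?_
      have : 306 * K ^ 3 * m * Δ * π ≤ 306 * K ^ 3 * m * Δ * 4 := by gcongr
      linarith
    · refine (hd' φ hφ).trans ?_
      have : 102 * K ^ 3 * m * |d φ| ≤ 102 * K ^ 3 * m * (3 * Δ) := by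
        gcongr
        exact hd3 φ hφ
      linarith
  have hprod : ∀ φ ∈ Icc 0 π, |(r₁ φ + r₂ φ) * d φ - σ * Δ| ≤ 1320 * K ^ 3 * m ^ 2 * Δ := by
    intro φ hφ
    rw [show (r₁ φ + r₂ φ) * d φ - σ * Δ = (r₁ φ + r₂ φ - σ) * d φ + σ * (d φ - Δ) by ring]
    refine (abs_add_le_add_of_le (abs_mul_le_mul_of_le (hσr φ hφ) (hd3 φ hφ))
      (abs_mul_le_mul_of_le hσm (hdΔ φ hφ))).trans ?_
    linarith [hP 3 1 (by simp) 2 le_rfl]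
  have herr : ∀ φ ∈ Icc 0 π, 100 * K ^ 3 * m ^ 2 * |r₂ φ - r₁ φ| ≤ 300 * K ^ 3 * m ^ 2 * Δ := by
    intro φ hφ
    have : 100 * K ^ 3 * m ^ 2 * |r₂ φ - r₁ φ| ≤ 100 * K ^ 3 * m ^ 2 * (3 * Δ) := by
      gcongr
      exact hd3 φ hφ
    linarith
  have hd2 : ∀ φ ∈ Icc 0 π,
      |d φ - Δ - a * σ * Δ * (2 / 3 - cos φ + cos φ ^ 3 / 3)| ≤ 6480 * K ^ 4 * m ^ 2 * Δ := by
    intro φ hφ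
    have := abs_le_of_hasDerivAt_on_Icc_pi
      (f := fun φ => d φ - Δ - a * σ * Δ * (2 / 3 - cos φ + cos φ ^ 3 / 3))
      (B := 1620 * K ^ 4 * m ^ 2 * Δ)
      (fun φ hφ => ((hrd φ hφ).sub_const Δ).sub
        ((hasDerivAt_sinCube_primitive φ).const_mul (a * σ * Δ))) (fun φ hφ => ?_)
      (by simp [hd0]; ring_nf; simp) φ hφ
    · refine this.trans ?_
      have : 1620 * K ^ 4 * m ^ 2 * Δ * π ≤ 1620 * K ^ 4 * m ^ 2 * Δ * 4 := by gcongr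
      linarith
    · have e := abs_add_le_add_of_le ((hbd φ hφ).2.trans (herr φ hφ))
        (abs_mul_le_mul_of_le (abs_mul_le_mul_of_le haK (hs φ 3)) (hprod φ hφ))
      refine (le_of_eq ?_).trans (e.trans ?_)
      · congr 1
        simp only [hd, Pi.sub_apply]
        ring
      · linarith [hP 4 3 (by simp) 2 le_rfl]
  have hfinal := abs_le_of_hasDerivAt_on_Icc_pi
    (f := fun φ => (τ₂ - τ₁) φ - (-(a * Δ) * (sin φ ^ 3 / 3) + a ^ 2 * σ * Δ *
      (-(sin φ ^ 3 * (2 / 3 - cos φ + cos φ ^ 3 / 3)) / 3 + φ / 6 -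
        sin φ ^ 3 * cos φ / 9 - sin φ * cos φ / 6 + sin φ ^ 5 * cos φ / 9)))
    (B := 8100 * K ^ 5 * m ^ 2 * Δ)
    (fun φ hφ => (htd φ hφ).sub
      (((((hasDerivAt_sin φ).pow 3).div_const 3).const_mul (-(a * Δ))).add
        ((hasDerivAt_secondOrder_primitive φ).const_mul (a ^ 2 * σ * Δ))))
    (fun φ hφ => ?_) (by simp [h₁.time_zero, h₂.time_zero]) π (right_mem_Icc.2 pi_pos.le)
  · simp only [sin_pi, Pi.sub_apply] at hfinal
    have e := neg_le_of_abs_le hfinal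
    have e1 : 8100 * K ^ 5 * m ^ 2 * Δ * π < a ^ 2 * σ * Δ * (π / 6) := by
      have : 8100 * K ^ 5 * m ^ 2 < a ^ 2 * σ * (1 / 6) := by
        have hσ2 : m / 2 ≤ σ := by linarith
        have hm' : 0 < m := by linarith
        calc 8100 * K ^ 5 * m ^ 2 = 8100 * K ^ 5 * m * m := by ring
          _ ≤ 200000 * K ^ 5 * m * (m / 12) := by nlinarith [show 0 ≤ K ^ 5 * m * m by positivity]
          _ < a ^ 2 * (m / 12) := by
            gcongr
            rw [hm]
            linarith
          _ = a ^ 2 * (m / 2) * (1 / 6) := by ring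
          _ ≤ _ := by gcongr
      have := mul_lt_mul_of_pos_right this (mul_pos hΔ0 pi_pos)
      linarith
    norm_num at e
    linarith
  · have e := abs_add_le_add_of_le (abs_add_le_add_of_le ((hbd φ hφ).1.trans (herr φ hφ))
      ((abs_neg _).trans_le (abs_mul_le_mul_of_le (abs_mul_le_mul_of_le
        (abs_mul_le_mul_of_le (abs_cos_le_one φ) haK) (hs φ 2)) (hd2 φ hφ))))
      (abs_mul_le_mul_of_le (abs_mul_le_mul_of_le (abs_mul_le_mul_of_le
        (abs_mul_le_mul_of_le haK haK) (abs_mul_le_mul_of_le (abs_cos_le_one φ) (abs_cos_le_one φ)))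
        (hs φ 4)) (hprod φ hφ))
    refine (le_of_eq ?_).trans (e.trans ?_)
    · congr 1
      simp only [hd, Pi.sub_apply]
      push_cast
      ring
    · linarith [hP 5 3 (by simp) 2 le_rfl]

/-- If `F` is even and real-analytic near `0` with `F(0) = 0` and `F''(0) ≠ 0`, and the origin
is a center of the Rayleigh equation `x'' + F(x') + x = 0` with period function `T`, then `T`
is strictly increasing on some interval `(0,ε)`. -/
theorem rayleigh_period_strictMono
    (F : ℝ → ℝ) (hFan : AnalyticAt ℝ F 0) (hFeven : ∀ᶠ x in nhds (0:ℝ), F (-x) = F x)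
    (hF0 : F 0 = 0) (hF2 : iteratedDeriv 2 F 0 ≠ 0)
    (δ : ℝ) (hδ : 0 < δ) (T : ℝ → ℝ)
    (hsol : ∀ c ∈ Ioo (0:ℝ) δ, ∃ u, IsRayleighSolution F u ∧ u 0 = c ∧ deriv u 0 = 0)
    (hcenter : ∀ c ∈ Ioo (0:ℝ) δ, ∀ u, IsRayleighSolution F u → u 0 = c → deriv u 0 = 0 →
      ∃ p > 0, ∀ t, u (t + p) = u t)
    (hT : ∀ c ∈ Ioo (0:ℝ) δ, ∀ u, IsRayleighSolution F u → u 0 = c → deriv u 0 = 0 →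
      IsLeast {p : ℝ | 0 < p ∧ ∀ t, u (t + p) = u t} (T c)) :
    ∃ ε, 0 < ε ∧ ε ≤ δ ∧ StrictMonoOn T (Ioo 0 ε) := by
  obtain ⟨E, a, K, η, ha, hF⟩ := exists_evenQuadraticExpansion hFan hFeven hF0 hF2
  have hK := hF.one_le
  have hη := hF.radius_pos
  obtain ⟨ε, hε, hεδ, hεη, hε₁, hε₂, hε₃⟩ : ∃ ε > 0, ε ≤ δ ∧ 2 * ε ≤ η ∧ 2000 * K * ε ≤ 1 ∧
      1000 * K ^ 3 * ε ≤ 1 ∧ 400000 * K ^ 5 * ε ≤ a ^ 2 := by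
    refine ⟨min δ (min (η / 2) (min (1 / (2000 * K)) (min (1 / (1000 * K ^ 3))
      (a ^ 2 / (400000 * K ^ 5))))), by positivity, min_le_left _ _, ?_, ?_, ?_, ?_⟩
    · rw [← le_div_iff₀' (by norm_num)]
      exact min_le_of_right_le (min_le_left _ _)
    · rw [← le_div_iff₀' (by positivity)]
      exact min_le_of_right_le (min_le_of_right_le (min_le_left _ _))
    · rw [← le_div_iff₀' (by positivity)]
      exact min_le_of_right_le (min_le_of_right_le (min_le_of_right_le (min_le_left _ _)))
    · rw [← le_div_iff₀' (by positivity)]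
      exact min_le_of_right_le (min_le_of_right_le (min_le_of_right_le (min_le_right _ _)))
  have hpolar : ∀ c ∈ Ioo (0 : ℝ) ε, ∃ u τ r, IsPolarParametrization F u c τ r ∧
      T c = 2 * τ π := by
    intro c hc
    have hcδ : c ∈ Ioo (0 : ℝ) δ := ⟨hc.1, hc.2.trans_le hεδ⟩
    obtain ⟨u, hu, h0, h0'⟩ := hsol c hcδ
    have h1 : 2000 * K * c ≤ 1 := le_trans (by gcongr; exact hc.2.le) hε₁
    have h2 : 2 * c ≤ η := by linarith [hc.2]
    obtain ⟨τ, r, hpol⟩ := hu.exists_polarParametrization hF hc.1 h1 h2 h0 h0'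
    exact ⟨u, τ, r, hpol, hpol.isLeast_period hu hF hc.1 h1 h2 h0 h0' (hT c hcδ u hu h0 h0')⟩
  refine ⟨ε, hε, hεδ, fun c₁ hc₁ c₂ hc₂ hlt => ?_⟩
  obtain ⟨u₁, τ₁, r₁, h₁, hT₁⟩ := hpolar c₁ hc₁
  obtain ⟨u₂, τ₂, r₂, h₂, hT₂⟩ := hpolar c₂ hc₂
  have := h₁.time_pi_lt h₂ hF hc₁.1 hlt (by linarith [hc₂.2])
    (le_trans (by gcongr; exact hc₂.2.le) hε₂) (lt_of_lt_of_le (by gcongr; exact hc₂.2) hε₃)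
  rw [hT₁, hT₂]
  linarith
end

section
/- Let f : ℝ → ℝ be C¹ and g : ℝ → ℝ be C³ on an interval [a,b] containing 0, with f(0) = g(0) = 0 and g'(0) > 0, and suppose the origin is a center of x'' + f(x)x' + g(x) = 0 with period function T. If g'(0)·g'''(0) − (5/3)·g''(0)² − (2/3)·f'(0)²·g'(0) < 0, then T is strictly increasing on some interval (0,ε); if g'(0)·g'''(0) − (5/3)·g''(0)² − (2/3)·f'(0)²·g'(0) > 0, then T is strictly decreasing on some interval (0,ε). In particular, if this quantity is nonzero, T is strictly monotone in a neighborhood of 0. -/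
open Set Real

/-- A (C²) solution of the Liénard equation `x'' + f(x)x' + g(x) = 0`. -/
def IsLienardSolution (f g : ℝ → ℝ) (u : ℝ → ℝ) : Prop :=
  ContDiff ℝ 2 u ∧ ∀ t, deriv (deriv u) t + f (u t) * deriv u t + g (u t) = 0

open Filter Topology Asymptotics

/-- `h r θ` is `O(r ^ k)` with constant `C`, uniformly in `θ`, and `∂h/∂r` is `O(r ^ (k - 1))`. -/
def DerivBound (C : ℝ) (k : ℕ) (h : ℝ → ℝ → ℝ) : Prop :=
  ∀ᶠ r in 𝓝[>] (0 : ℝ), ∀ θ, ∃ d, HasDerivAt (fun x => h x θ) d r ∧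
    |h r θ| ≤ C * r ^ k ∧ r * |d| ≤ C * r ^ k

def DerivBigO (k : ℕ) (h : ℝ → ℝ → ℝ) : Prop := ∃ C, 0 ≤ C ∧ DerivBound C k h

def DerivLittleO (k : ℕ) (h : ℝ → ℝ → ℝ) : Prop := ∀ ε, 0 < ε → DerivBound ε k h

theorem eventually_pos_nhdsGT : ∀ᶠ r in 𝓝[>] (0 : ℝ), 0 < r := self_mem_nhdsWithin

theorem eventually_lt_nhdsGT {a : ℝ} (ha : 0 < a) : ∀ᶠ r in 𝓝[>] (0 : ℝ), r < a :=
  mem_nhdsWithin_of_mem_nhds (Iio_mem_nhds ha)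

theorem DerivBound.mono {C D : ℝ} {k : ℕ} {h : ℝ → ℝ → ℝ} (hh : DerivBound C k h) (hCD : C ≤ D) :
    DerivBound D k h := by
  filter_upwards [hh, eventually_pos_nhdsGT] with r hr hr0 θ
  obtain ⟨d, h1, h2, h3⟩ := hr θ
  have : C * r ^ k ≤ D * r ^ k := by gcongr
  exact ⟨d, h1, h2.trans this, h3.trans this⟩

theorem DerivBound.add {C D : ℝ} {k : ℕ} {h l : ℝ → ℝ → ℝ} (hh : DerivBound C k h)
    (hl : DerivBound D k l) : DerivBound (C + D) k (fun r θ => h r θ + l r θ) := by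
  filter_upwards [hh, hl, eventually_pos_nhdsGT] with r hr hr' hr0 θ
  obtain ⟨d, h1, h2, h3⟩ := hr θ
  obtain ⟨e, l1, l2, l3⟩ := hr' θ
  refine ⟨d + e, h1.add l1, (abs_add_le _ _).trans (by linarith), ?_⟩
  have := mul_le_mul_of_nonneg_left (abs_add_le d e) hr0.le
  linarith

theorem DerivBound.neg {C : ℝ} {k : ℕ} {h : ℝ → ℝ → ℝ} (hh : DerivBound C k h) :
    DerivBound C k (fun r θ => -h r θ) := by
  filter_upwards [hh] with r hr θ
  obtain ⟨d, h1, h2, h3⟩ := hr θ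
  exact ⟨-d, h1.neg, by rwa [abs_neg], by rwa [abs_neg]⟩

theorem DerivBound.mul {C D : ℝ} {j k : ℕ} {h l : ℝ → ℝ → ℝ} (hC : 0 ≤ C)
    (hh : DerivBound C j h) (hl : DerivBound D k l) :
    DerivBound (2 * C * D) (j + k) (fun r θ => h r θ * l r θ) := by
  filter_upwards [hh, hl, eventually_pos_nhdsGT] with r hr hr' hr0 θ
  obtain ⟨d, h1, h2, h3⟩ := hr θ
  obtain ⟨e, l1, l2, l3⟩ := hr' θ
  have hCr : 0 ≤ C * r ^ j := by positivity
  have hDr : 0 ≤ D * r ^ k := (abs_nonneg _).trans l2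
  have e0 : |h r θ| * |l r θ| ≤ C * r ^ j * (D * r ^ k) := mul_le_mul h2 l2 (abs_nonneg _) hCr
  have e1 : r * |d| * |l r θ| ≤ C * r ^ j * (D * r ^ k) := mul_le_mul h3 l2 (abs_nonneg _) hCr
  have e2 : |h r θ| * (r * |e|) ≤ C * r ^ j * (D * r ^ k) :=
    mul_le_mul h2 l3 (by positivity) hCr
  have e3 : 2 * C * D * r ^ (j + k) = 2 * (C * r ^ j * (D * r ^ k)) := by rw [pow_add]; ring
  have e4 : 0 ≤ C * r ^ j * (D * r ^ k) := mul_nonneg hCr hDr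
  refine ⟨d * l r θ + h r θ * e, h1.mul l1, ?_, ?_⟩
  · rw [abs_mul]; linarith
  · have := mul_le_mul_of_nonneg_left (abs_add_le (d * l r θ) (h r θ * e)) hr0.le
    rw [abs_mul, abs_mul] at this
    linarith [mul_assoc r |d| |l r θ|, mul_left_comm r |h r θ| |e|]

theorem DerivBound.div_radius {C : ℝ} {k : ℕ} {h : ℝ → ℝ → ℝ} (hh : DerivBound C (k + 1) h) :
    DerivBound (2 * C) k (fun r θ => h r θ / r) := by
  filter_upwards [hh, eventually_pos_nhdsGT] with r hr hr0 θ
  obtain ⟨d, h1, h2, h3⟩ := hr θ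
  refine ⟨_, h1.div (hasDerivAt_id' r) hr0.ne', ?_, ?_⟩
  · rw [abs_div, abs_of_pos hr0, div_le_iff₀ hr0]
    rw [pow_succ] at h2
    linarith [abs_nonneg (h r θ)]
  · rw [abs_div, abs_of_pos (by positivity : (0 : ℝ) < r ^ 2), mul_div_assoc',
      div_le_iff₀ (by positivity)]
    have := abs_sub (d * r) (h r θ * 1)
    rw [abs_mul, abs_of_pos hr0, mul_one] at this
    calc r * |d * r - h r θ * 1| ≤ r * (|d| * r + |h r θ|) := by
          rw [mul_one]; gcongr
      _ = r * (r * |d| + |h r θ|) := by ring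
      _ ≤ r * (C * r ^ (k + 1) + C * r ^ (k + 1)) := by gcongr
      _ = 2 * C * r ^ k * r ^ 2 := by ring

theorem DerivBound.congr {C : ℝ} {k : ℕ} {h l : ℝ → ℝ → ℝ} (hh : DerivBound C k h)
    (hl : ∀ᶠ r in 𝓝[>] (0 : ℝ), ∀ θ, l r θ = h r θ) : DerivBound C k l := by
  filter_upwards [hh, hl, eventually_eventually_nhdsWithin.2 hl, eventually_pos_nhdsGT]
    with r hr hr' hr'' hr0 θ
  obtain ⟨d, h1, h2, h3⟩ := hr θ
  rw [IsOpen.nhdsWithin_eq isOpen_Ioi hr0] at hr''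
  refine ⟨d, h1.congr_of_eventuallyEq (hr''.mono fun x hx => hx θ), ?_, h3⟩
  rwa [hr' θ]

theorem DerivBigO.add {k : ℕ} {h l : ℝ → ℝ → ℝ} (hh : DerivBigO k h) (hl : DerivBigO k l) :
    DerivBigO k (fun r θ => h r θ + l r θ) := by
  obtain ⟨C, hC, h1⟩ := hh
  obtain ⟨D, hD, l1⟩ := hl
  exact ⟨C + D, by positivity, h1.add l1⟩

theorem DerivBigO.mul {j k : ℕ} {h l : ℝ → ℝ → ℝ} (hh : DerivBigO j h) (hl : DerivBigO k l) :
    DerivBigO (j + k) (fun r θ => h r θ * l r θ) := by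
  obtain ⟨C, hC, h1⟩ := hh
  obtain ⟨D, hD, l1⟩ := hl
  exact ⟨2 * C * D, by positivity, h1.mul hC l1⟩

theorem DerivBigO.div_radius {k : ℕ} {h : ℝ → ℝ → ℝ} (hh : DerivBigO (k + 1) h) :
    DerivBigO k (fun r θ => h r θ / r) := by
  obtain ⟨C, hC, h1⟩ := hh
  exact ⟨2 * C, by positivity, h1.div_radius⟩

theorem DerivBigO.congr {k : ℕ} {h l : ℝ → ℝ → ℝ} (hh : DerivBigO k h)
    (hl : ∀ᶠ r in 𝓝[>] (0 : ℝ), ∀ θ, l r θ = h r θ) : DerivBigO k l := by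
  obtain ⟨C, hC, h1⟩ := hh
  exact ⟨C, hC, h1.congr hl⟩

theorem DerivLittleO.add {k : ℕ} {h l : ℝ → ℝ → ℝ} (hh : DerivLittleO k h)
    (hl : DerivLittleO k l) : DerivLittleO k (fun r θ => h r θ + l r θ) := fun ε hε =>
  ((hh _ (half_pos hε)).add (hl _ (half_pos hε))).mono (by linarith)

theorem DerivLittleO.neg {k : ℕ} {h : ℝ → ℝ → ℝ} (hh : DerivLittleO k h) :
    DerivLittleO k (fun r θ => -h r θ) := fun ε hε => (hh ε hε).neg

theorem DerivLittleO.sub {k : ℕ} {h l : ℝ → ℝ → ℝ} (hh : DerivLittleO k h)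
    (hl : DerivLittleO k l) : DerivLittleO k (fun r θ => h r θ - l r θ) := by
  simpa only [sub_eq_add_neg] using hh.add hl.neg

theorem DerivLittleO.bigO {k : ℕ} {h : ℝ → ℝ → ℝ} (hh : DerivLittleO k h) : DerivBigO k h :=
  ⟨1, zero_le_one, hh 1 one_pos⟩

theorem DerivBigO.mul_littleO {j k : ℕ} {h l : ℝ → ℝ → ℝ} (hh : DerivBigO j h)
    (hl : DerivLittleO k l) : DerivLittleO (j + k) (fun r θ => h r θ * l r θ) := by
  obtain ⟨C, hC, h1⟩ := hh
  intro ε hε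
  refine (h1.mul hC (hl (ε / (2 * C + 1)) (by positivity))).mono ?_
  rw [mul_div_assoc', div_le_iff₀ (by positivity)]
  nlinarith

theorem DerivLittleO.div_radius {k : ℕ} {h : ℝ → ℝ → ℝ} (hh : DerivLittleO (k + 1) h) :
    DerivLittleO k (fun r θ => h r θ / r) := fun ε hε =>
  (hh _ (half_pos hε)).div_radius.mono (by linarith)

theorem DerivLittleO.congr {k : ℕ} {h l : ℝ → ℝ → ℝ} (hh : DerivLittleO k h)
    (hl : ∀ᶠ r in 𝓝[>] (0 : ℝ), ∀ θ, l r θ = h r θ) : DerivLittleO k l := fun ε hε =>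
  (hh ε hε).congr hl

theorem DerivBigO.littleO_of_succ {k : ℕ} {h : ℝ → ℝ → ℝ} (hh : DerivBigO (k + 1) h) :
    DerivLittleO k h := by
  obtain ⟨C, hC, h1⟩ := hh
  intro ε hε
  filter_upwards [h1, eventually_pos_nhdsGT,
    eventually_lt_nhdsGT (show 0 < ε / (C + 1) by positivity)] with r hr hr0 hr1 θ
  obtain ⟨d, h1, h2, h3⟩ := hr θ
  have : C * r ^ (k + 1) ≤ ε * r ^ k := by
    rw [lt_div_iff₀ (by positivity)] at hr1
    have : C * r ≤ ε := by nlinarith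
    calc C * r ^ (k + 1) = C * r * r ^ k := by ring
      _ ≤ ε * r ^ k := by gcongr
  exact ⟨d, h1, h2.trans this, h3.trans this⟩

theorem derivBigO_radius : DerivBigO 1 (fun r _ => r) := by
  refine ⟨1, zero_le_one, ?_⟩
  filter_upwards [eventually_pos_nhdsGT] with r hr θ
  exact ⟨1, hasDerivAt_id' r, by simp [abs_of_pos hr], by simp⟩

theorem derivBigO_angle {a : ℝ → ℝ} {C : ℝ} (ha : ∀ θ, |a θ| ≤ C) :
    DerivBigO 0 (fun _ θ => a θ) := by
  have hC : 0 ≤ C := (abs_nonneg _).trans (ha 0)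
  refine ⟨C, hC, ?_⟩
  filter_upwards with r θ
  exact ⟨0, hasDerivAt_const _ _, by simpa using ha θ, by simpa using hC⟩

theorem derivBigO_angle_of_periodic {a : ℝ → ℝ} (hc : Continuous a)
    (hp : Function.Periodic a (2 * π)) : DerivBigO 0 (fun _ θ => a θ) := by
  obtain ⟨C, hC⟩ := (isCompact_Icc (a := (0 : ℝ)) (b := 2 * π)).exists_bound_of_continuousOn
    hc.continuousOn
  refine derivBigO_angle (C := C) fun θ => ?_
  obtain ⟨y, hy, hy'⟩ := hp.exists_mem_Ico₀ two_pi_pos θ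
  rw [hy']
  exact hC y (Ico_subset_Icc_self hy)

theorem DerivBigO.inv_one_add {P : ℝ → ℝ → ℝ} (hP : DerivBigO 1 P) :
    DerivBigO 0 (fun r θ => 1 / (1 + P r θ)) := by
  refine ⟨4, by norm_num, ?_⟩
  filter_upwards [hP.littleO_of_succ (1 / 2) (by norm_num), eventually_pos_nhdsGT]
    with r hr hr0 θ
  obtain ⟨d, h1, h2, h3⟩ := hr θ
  simp only [pow_zero, mul_one] at h2 h3 ⊢
  have h4 : 1 / 2 ≤ 1 + P r θ := by linarith [(abs_le.1 h2).1]
  have h5 : 0 < 1 + P r θ := by linarith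
  refine ⟨_, (hasDerivAt_const r (1 : ℝ)).div (h1.const_add 1) h5.ne', ?_, ?_⟩
  · rw [abs_of_pos (by positivity), div_le_iff₀ h5]; linarith
  · rw [zero_mul, zero_sub, one_mul, abs_div, abs_neg, mul_div_assoc',
      abs_of_pos (by positivity : 0 < (1 + P r θ) ^ 2), div_le_iff₀ (by positivity)]
    nlinarith

theorem isLittleO_pow_succ_of_deriv {e : ℝ → ℝ} {k : ℕ} (h0 : e 0 = 0)
    (hd : ∀ᶠ x in 𝓝 (0 : ℝ), DifferentiableAt ℝ e x)
    (ho : deriv e =o[𝓝 0] (fun x => x ^ k)) : e =o[𝓝 0] (fun x => x ^ (k + 1)) := by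
  refine isLittleO_iff.2 fun ε hε => ?_
  obtain ⟨η, hη, H⟩ := Metric.eventually_nhds_iff_ball.1 (hd.and (isLittleO_iff.1 ho hε))
  filter_upwards [Metric.ball_mem_nhds 0 hη] with x hx
  have hsub : ∀ y ∈ Metric.closedBall (0 : ℝ) |x|, y ∈ Metric.ball (0 : ℝ) η := fun y hy => by
    rw [mem_ball_zero_iff] at hx ⊢
    rw [mem_closedBall_zero_iff] at hy
    exact hy.trans_lt hx
  have := (convex_closedBall (0 : ℝ) |x|).norm_image_sub_le_of_norm_deriv_le
    (f := e) (C := ε * |x| ^ k) (fun y hy => (H y (hsub y hy)).1) (fun y hy => ?_)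
    (Metric.mem_closedBall_self (abs_nonneg x)) (y := x) (by simp)
  · rw [h0, sub_zero, sub_zero] at this
    rw [norm_pow, pow_succ, ← mul_assoc]
    simpa using this
  · refine (H y (hsub y hy)).2.trans ?_
    rw [norm_pow]
    rw [mem_closedBall_zero_iff] at hy
    gcongr

theorem derivLittleO_comp_cos {e : ℝ → ℝ} {k : ℕ} (h0 : e 0 = 0)
    (hd : ∀ᶠ x in 𝓝 (0 : ℝ), DifferentiableAt ℝ e x)
    (ho : deriv e =o[𝓝 0] (fun x => x ^ k)) :
    DerivLittleO (k + 1) (fun r θ => e (r * cos θ)) := by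
  intro ε hε
  obtain ⟨η, hη, H⟩ := Metric.eventually_nhds_iff_ball.1 (hd.and ((isLittleO_iff.1 ho hε).and
    (isLittleO_iff.1 (isLittleO_pow_succ_of_deriv h0 hd ho) hε)))
  filter_upwards [eventually_pos_nhdsGT, eventually_lt_nhdsGT hη] with r hr0 hr θ
  have hle : |r * cos θ| ≤ r := by
    rw [abs_mul, abs_of_pos hr0]
    exact mul_le_of_le_one_right hr0.le (abs_cos_le_one θ)
  obtain ⟨h1, h2, h3⟩ := H (r * cos θ) (by rw [mem_ball_zero_iff]; exact hle.trans_lt hr)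
  rw [norm_pow, norm_eq_abs, norm_eq_abs] at h2 h3
  refine ⟨deriv e (r * cos θ) * (1 * cos θ), ?_, ?_, ?_⟩
  · exact h1.hasDerivAt.comp r ((hasDerivAt_id' r).mul_const (cos θ))
  · refine h3.trans ?_
    gcongr
  · rw [one_mul, abs_mul]
    calc r * (|deriv e (r * cos θ)| * |cos θ|) ≤ r * (ε * |r * cos θ| ^ k * 1) := by
          gcongr; exact abs_cos_le_one θ
      _ ≤ r * (ε * r ^ k * 1) := by gcongr
      _ = ε * r ^ (k + 1) := by ring

/-- Local expansions at `0` of the data of the planar system `x' = y - F x`, `y' = -(x + γ x)`,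
with `FF` a primitive of `F`. -/
structure LienardExpansion (F FF γ : ℝ → ℝ) (φ α β : ℝ) : Prop where
  F_zero : F 0 = 0
  FF_zero : FF 0 = 0
  γ_zero : γ 0 = 0
  F_diff : ∀ᶠ x in 𝓝 (0 : ℝ), DifferentiableAt ℝ F x
  FF_deriv : ∀ᶠ x in 𝓝 (0 : ℝ), HasDerivAt FF (F x) x
  γ_diff : ∀ᶠ x in 𝓝 (0 : ℝ), DifferentiableAt ℝ γ x
  F_exp : (fun x => deriv F x - φ * x) =o[𝓝 0] fun x => x
  γ_exp : (fun x => deriv γ x - (α * x + β * x ^ 2 / 2)) =o[𝓝 0] fun x => x ^ 2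

/-- Radial speed in the polar coordinates `x = r cos θ`, `y = -r sin θ`. -/
noncomputable def radialRate (F γ : ℝ → ℝ) (r θ : ℝ) : ℝ :=
  γ (r * cos θ) * sin θ - F (r * cos θ) * cos θ

/-- Angular speed minus one in the polar coordinates `x = r cos θ`, `y = -r sin θ`. -/
noncomputable def angularExcess (F γ : ℝ → ℝ) (r θ : ℝ) : ℝ :=
  (γ (r * cos θ) * cos θ + F (r * cos θ) * sin θ) / r

/-- The equation of the orbits in polar coordinates is `dr/dθ = orbitSlope F γ r θ`. -/
noncomputable def orbitSlope (F γ : ℝ → ℝ) (r θ : ℝ) : ℝ :=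
  radialRate F γ r θ * (1 / (1 + angularExcess F γ r θ))

noncomputable def slopeCoeff (φ α θ : ℝ) : ℝ := (α * cos θ ^ 2 * sin θ - φ * cos θ ^ 3) / 2

noncomputable def excessCoeff (φ α θ : ℝ) : ℝ := (α * cos θ ^ 3 + φ * cos θ ^ 2 * sin θ) / 2

noncomputable def correctionCoeff (φ α θ : ℝ) : ℝ :=
  φ * cos θ ^ 3 / 6 - α / 2 * (sin θ - sin θ ^ 3 / 3)

/-- The coefficient of `r ^ 2` in the averaged time element. -/
noncomputable def periodCoeff (φ α β : ℝ) : ℝ := (5 * α ^ 2 - 3 * β + 2 * φ ^ 2) / 48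

noncomputable def oscRate (φ α β θ : ℝ) : ℝ :=
  excessCoeff φ α θ ^ 2 - β * cos θ ^ 4 / 6 - correctionCoeff φ α θ * slopeCoeff φ α θ
    - periodCoeff φ α β

/-- A periodic primitive of `oscRate`. -/
noncomputable def oscPrimitive (φ α β θ : ℝ) : ℝ :=
  α ^ 2 * ((sin θ * cos θ ^ 5 / 6 + 5 * sin θ * cos θ ^ 3 / 24 + 5 * sin θ * cos θ / 16) / 6
      - (sin θ * cos θ ^ 3 / 4 + 3 * sin θ * cos θ / 8) / 12 + sin θ * cos θ / 12)
    + φ ^ 2 * ((sin θ * cos θ ^ 3 / 4 + 3 * sin θ * cos θ / 8) / 4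
      - (sin θ * cos θ ^ 5 / 6 + 5 * sin θ * cos θ ^ 3 / 24 + 5 * sin θ * cos θ / 16) / 6)
    + α * φ * (cos θ ^ 4 / 24 - cos θ ^ 6 / 18)
    - β * (sin θ * cos θ ^ 3 / 4 + 3 * sin θ * cos θ / 8) / 6

theorem hasDerivAt_oscPrimitive (φ α β θ : ℝ) :
    HasDerivAt (oscPrimitive φ α β) (oscRate φ α β θ) θ := by
  have hs := hasDerivAt_sin θ
  have hc := hasDerivAt_cos θ
  have a2 := hs.mul hc
  have a4 := hs.mul (hc.pow 3)
  have a6 := hs.mul (hc.pow 5)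
  have A4 := (a4.div_const 4).add (a2.const_mul (3 / 8))
  have A6 := ((a6.div_const 6).add (a4.const_mul (5 / 24))).add (a2.const_mul (5 / 16))
  have := (((((A6.div_const 6).sub (A4.div_const 12)).add (a2.div_const 12)).const_mul (α ^ 2)).add
    (((A4.div_const 4).sub (A6.div_const 6)).const_mul (φ ^ 2))).add
    ((((hc.pow 4).div_const 24).sub ((hc.pow 6).div_const 18)).const_mul (α * φ)) |>.sub
    (A4.const_mul (β / 6))
  refine (this.congr_deriv ?_).congr_of_eventuallyEq (Eventually.of_forall fun x => ?_)
  · simp only [Pi.pow_apply]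
    unfold oscRate excessCoeff correctionCoeff slopeCoeff periodCoeff
    have h2 : sin θ ^ 2 = 1 - cos θ ^ 2 := sin_sq θ
    have h3 : sin θ ^ 3 = sin θ * (1 - cos θ ^ 2) := by rw [← h2]; ring
    have h4 : sin θ ^ 4 = (1 - cos θ ^ 2) ^ 2 := by rw [← h2]; ring
    push_cast
    ring_nf
    simp only [h2, h3, h4]
    ring
  · simp only [oscPrimitive, Pi.add_apply, Pi.mul_apply, Pi.sub_apply, Pi.pow_apply]
    ring

/-- The function whose total derivative removes the oscillating part of the time element. -/
noncomputable def timeCorrection (FF : ℝ → ℝ) (φ α β r θ : ℝ) : ℝ :=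
  FF (r * cos θ) / r ^ 2 - r * (α / 2) * (sin θ - sin θ ^ 3 / 3) + r ^ 2 * oscPrimitive φ α β θ

noncomputable def timeCorrectionRadial (F FF : ℝ → ℝ) (φ α β r θ : ℝ) : ℝ :=
  cos θ * (F (r * cos θ) / r / r) - 2 * (FF (r * cos θ) / r / r / r)
    - α / 2 * (sin θ - sin θ ^ 3 / 3) + 2 * r * oscPrimitive φ α β θ

noncomputable def timeCorrectionAngular (F : ℝ → ℝ) (φ α β r θ : ℝ) : ℝ :=
  -sin θ * (F (r * cos θ) / r) - r * (α / 2) * cos θ ^ 3 + r ^ 2 * oscRate φ α β θ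

/-- The corrected time element. -/
noncomputable def averagedTime (F FF γ : ℝ → ℝ) (φ α β r θ : ℝ) : ℝ :=
  1 / (1 + angularExcess F γ r θ) - timeCorrectionRadial F FF φ α β r θ * orbitSlope F γ r θ
    - timeCorrectionAngular F φ α β r θ

namespace LienardExpansion

variable {F FF γ : ℝ → ℝ} {φ α β : ℝ}

theorem F_sub_isLittleO (H : LienardExpansion F FF γ φ α β) :
    (∀ᶠ x in 𝓝 (0 : ℝ), DifferentiableAt ℝ (fun x => F x - φ * x ^ 2 / 2) x) ∧
    deriv (fun x => F x - φ * x ^ 2 / 2) =o[𝓝 0] fun x => x ^ 1 := by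
  constructor
  · filter_upwards [H.F_diff] with x hx
    fun_prop
  · refine H.F_exp.congr' ?_ (by simp)
    filter_upwards [H.F_diff] with x hx
    have := hx.hasDerivAt.sub (((hasDerivAt_pow 2 x).const_mul φ).div_const 2)
    have h : HasDerivAt (fun x => F x - φ * x ^ 2 / 2) (deriv F x - φ * x) x :=
      this.congr_deriv (by norm_num; ring)
    exact h.deriv.symm

theorem F_littleO (H : LienardExpansion F FF γ φ α β) :
    DerivLittleO 2 (fun r θ => F (r * cos θ) - φ * (r * cos θ) ^ 2 / 2) :=
  derivLittleO_comp_cos (e := fun x => F x - φ * x ^ 2 / 2) (by simp [H.F_zero])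
    H.F_sub_isLittleO.1 H.F_sub_isLittleO.2

theorem FF_littleO (H : LienardExpansion F FF γ φ α β) :
    DerivLittleO 3 (fun r θ => FF (r * cos θ) - φ * (r * cos θ) ^ 3 / 6) := by
  refine derivLittleO_comp_cos (e := fun x => FF x - φ * x ^ 3 / 6) (by simp [H.FF_zero]) ?_ ?_
  · filter_upwards [H.FF_deriv] with x hx
    have := hx.differentiableAt
    fun_prop
  · refine (isLittleO_pow_succ_of_deriv (by simp [H.F_zero]) H.F_sub_isLittleO.1
      H.F_sub_isLittleO.2).congr' ?_ EventuallyEq.rfl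
    filter_upwards [H.FF_deriv] with x hx
    have := hx.sub (((hasDerivAt_pow 3 x).const_mul φ).div_const 6)
    have h : HasDerivAt (fun x => FF x - φ * x ^ 3 / 6) (F x - φ * x ^ 2 / 2) x :=
      this.congr_deriv (by norm_num; ring)
    exact h.deriv.symm

theorem γ_littleO (H : LienardExpansion F FF γ φ α β) : DerivLittleO 3
    (fun r θ => γ (r * cos θ) - (α * (r * cos θ) ^ 2 / 2 + β * (r * cos θ) ^ 3 / 6)) := by
  refine derivLittleO_comp_cos (e := fun x => γ x - (α * x ^ 2 / 2 + β * x ^ 3 / 6))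
    (by simp [H.γ_zero]) ?_ ?_
  · filter_upwards [H.γ_diff] with x hx
    fun_prop
  · refine H.γ_exp.congr' ?_ EventuallyEq.rfl
    filter_upwards [H.γ_diff] with x hx
    have := hx.hasDerivAt.sub ((((hasDerivAt_pow 2 x).const_mul α).div_const 2).add
      (((hasDerivAt_pow 3 x).const_mul β).div_const 6))
    have h : HasDerivAt (fun x => γ x - (α * x ^ 2 / 2 + β * x ^ 3 / 6)) (deriv γ x - (α * x + β * x ^ 2 / 2)) x :=
      this.congr_deriv (by norm_num; ring)
    exact h.deriv.symm

theorem derivBigO_cos : DerivBigO 0 (fun _ θ => cos θ) := derivBigO_angle abs_cos_le_one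

theorem derivBigO_sin : DerivBigO 0 (fun _ θ => sin θ) := derivBigO_angle abs_sin_le_one

theorem derivBigO_radius_sq : DerivBigO 2 (fun r _ => r * r) :=
  derivBigO_radius.mul derivBigO_radius

theorem derivBigO_slopeCoeff (φ α : ℝ) : DerivBigO 0 (fun _ θ => slopeCoeff φ α θ) :=
  derivBigO_angle_of_periodic (by unfold slopeCoeff; fun_prop) (fun θ => by simp [slopeCoeff])

theorem derivBigO_excessCoeff (φ α : ℝ) : DerivBigO 0 (fun _ θ => excessCoeff φ α θ) :=
  derivBigO_angle_of_periodic (by unfold excessCoeff; fun_prop) (fun θ => by simp [excessCoeff])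

theorem derivBigO_correctionCoeff (φ α : ℝ) : DerivBigO 0 (fun _ θ => correctionCoeff φ α θ) :=
  derivBigO_angle_of_periodic (by unfold correctionCoeff; fun_prop)
    (fun θ => by simp [correctionCoeff])

theorem derivBigO_oscPrimitive (φ α β : ℝ) : DerivBigO 0 (fun _ θ => oscPrimitive φ α β θ) :=
  derivBigO_angle_of_periodic (by unfold oscPrimitive; fun_prop) (fun θ => by simp [oscPrimitive])

theorem γ_littleO_two (H : LienardExpansion F FF γ φ α β) : DerivLittleO 2
    (fun r θ => γ (r * cos θ) - α * (r * cos θ) ^ 2 / 2) := by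
  have h1 : DerivLittleO 2 (fun r θ => r * (r * r) * (β * cos θ ^ 3 / 6)) :=
    ((derivBigO_radius.mul derivBigO_radius_sq).mul
      (derivBigO_angle_of_periodic (a := fun θ => β * cos θ ^ 3 / 6) (by fun_prop)
        (fun θ => by simp))).littleO_of_succ
  refine (H.γ_littleO.bigO.littleO_of_succ.add h1).congr (Eventually.of_forall fun r θ => ?_)
  ring

theorem radialRate_littleO (H : LienardExpansion F FF γ φ α β) :
    DerivLittleO 2 (fun r θ => radialRate F γ r θ - r * r * slopeCoeff φ α θ) := by
  refine ((derivBigO_sin.mul_littleO H.γ_littleO_two).sub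
    (derivBigO_cos.mul_littleO H.F_littleO)).congr (Eventually.of_forall fun r θ => ?_)
  unfold radialRate slopeCoeff
  ring

theorem radialRate_bigO (H : LienardExpansion F FF γ φ α β) : DerivBigO 2 (radialRate F γ) :=
  (H.radialRate_littleO.bigO.add (derivBigO_radius_sq.mul (derivBigO_slopeCoeff φ α))).congr
    (Eventually.of_forall fun r θ => by ring)

theorem angularExcess_littleO (H : LienardExpansion F FF γ φ α β) :
    DerivLittleO 1 (fun r θ => angularExcess F γ r θ - r * excessCoeff φ α θ) := by
  refine ((derivBigO_cos.mul_littleO H.γ_littleO_two).add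
    (derivBigO_sin.mul_littleO H.F_littleO)).div_radius.congr ?_
  filter_upwards [eventually_pos_nhdsGT] with r hr θ
  unfold angularExcess excessCoeff
  field_simp
  ring

theorem angularExcess_bigO (H : LienardExpansion F FF γ φ α β) :
    DerivBigO 1 (angularExcess F γ) :=
  (H.angularExcess_littleO.bigO.add (derivBigO_radius.mul (derivBigO_excessCoeff φ α))).congr
    (Eventually.of_forall fun r θ => by ring)

theorem one_add_angularExcess_pos (H : LienardExpansion F FF γ φ α β) :
    ∀ᶠ r in 𝓝[>] (0 : ℝ), ∀ θ, 1 / 2 ≤ 1 + angularExcess F γ r θ := by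
  filter_upwards [H.angularExcess_bigO.littleO_of_succ (1 / 2) (by norm_num)] with r hr θ
  obtain ⟨d, -, h, -⟩ := hr θ
  rw [pow_zero, mul_one] at h
  linarith [(abs_le.1 h).1]

theorem orbitSlope_bigO (H : LienardExpansion F FF γ φ α β) : DerivBigO 2 (orbitSlope F γ) :=
  H.radialRate_bigO.mul H.angularExcess_bigO.inv_one_add

theorem timeCorrectionRadial_littleO (H : LienardExpansion F FF γ φ α β) : DerivLittleO 0
    (fun r θ => timeCorrectionRadial F FF φ α β r θ - correctionCoeff φ α θ) := by
  have h1 := derivBigO_cos.mul_littleO H.F_littleO.div_radius.div_radius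
  have h2 : DerivLittleO 0 (fun r _ => r) := derivBigO_radius.littleO_of_succ
  have h3 := H.FF_littleO.div_radius.div_radius.div_radius
  have h4 := (derivBigO_oscPrimitive φ α β).mul_littleO h2
  refine (((h1.sub h3).sub h3).add (h4.add h4)).congr ?_
  filter_upwards [eventually_pos_nhdsGT] with r hr θ
  unfold timeCorrectionRadial correctionCoeff
  field_simp
  ring

theorem averagedTime_littleO (H : LienardExpansion F FF γ φ α β) : DerivLittleO 2
    (fun r θ => averagedTime F FF γ φ α β r θ - 1 - periodCoeff φ α β * r ^ 2) := by
  have hI := H.angularExcess_bigO.inv_one_add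
  have hP := H.angularExcess_bigO
  have hN := H.radialRate_bigO
  have hk := derivBigO_correctionCoeff φ α
  have hI1 := (hP.mul hI).littleO_of_succ
  have e1 : DerivLittleO 2 (fun r θ => (angularExcess F γ r θ + r * excessCoeff φ α θ) *
      (angularExcess F γ r θ - r * excessCoeff φ α θ)) :=
    (hP.add (derivBigO_radius.mul (derivBigO_excessCoeff φ α))).mul_littleO
      H.angularExcess_littleO
  have e2 := (hP.mul hP).mul_littleO hI1
  have e3 := (hN.mul hI).mul_littleO H.timeCorrectionRadial_littleO
  have e4 := (hk.mul hI).mul_littleO H.radialRate_littleO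
  have e5 := (hk.mul (derivBigO_radius_sq.mul (derivBigO_slopeCoeff φ α))).mul_littleO hI1
  have e6 := (derivBigO_cos.mul_littleO H.γ_littleO).div_radius
  refine (((((e1.sub e2).sub e3).sub e4).add e5).sub e6).congr ?_
  filter_upwards [eventually_pos_nhdsGT, H.one_add_angularExcess_pos] with r hr hr' θ
  have hP0 : 1 + angularExcess F γ r θ ≠ 0 := by linarith [hr' θ]
  have hF : F (r * cos θ) * sin θ = angularExcess F γ r θ * r - γ (r * cos θ) * cos θ := by
    unfold angularExcess
    field_simp
    ring
  have hF' : timeCorrectionAngular F φ α β r θ = -(angularExcess F γ r θ)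
      + γ (r * cos θ) * cos θ / r - r * (α / 2) * cos θ ^ 3 + r ^ 2 * oscRate φ α β θ := by
    unfold timeCorrectionAngular
    rw [mul_div_assoc', neg_mul, mul_comm (sin θ), hF]
    field_simp
    ring
  unfold averagedTime orbitSlope
  rw [hF']
  unfold oscRate
  generalize angularExcess F γ r θ = P at *
  generalize radialRate F γ r θ = N at *
  generalize timeCorrectionRadial F FF φ α β r θ = K at *
  generalize correctionCoeff φ α θ = k0 at *
  generalize slopeCoeff φ α θ = n at *
  generalize excessCoeff φ α θ = p at *
  field_simp
  ring

theorem exists_strictMonoOn_averagedTime (H : LienardExpansion F FF γ φ α β) {s : ℝ}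
    (hs : 0 < s * periodCoeff φ α β) :
    ∃ M, 0 < M ∧ ∀ θ, StrictMonoOn (fun r => s * averagedTime F FF γ φ α β r θ) (Ioo 0 M) := by
  have hs0 : 0 < |s| := abs_pos.2 fun h => by simp [h] at hs
  obtain ⟨M, hM, h⟩ := mem_nhdsGT_iff_exists_Ioo_subset.1
    (H.averagedTime_littleO (s * periodCoeff φ α β / |s|) (by positivity))
  refine ⟨M, hM, fun θ => ?_⟩
  have key : ∀ r ∈ Ioo 0 M, ∃ d, HasDerivAt (fun r => s * averagedTime F FF γ φ α β r θ) d r ∧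
      0 < d := by
    intro r hr
    obtain ⟨d, h1, -, h3⟩ := h hr θ
    have h4 := ((h1.add_const 1).add
      ((hasDerivAt_pow 2 r).const_mul (periodCoeff φ α β))).const_mul s
    refine ⟨_, h4.congr_of_eventuallyEq (Eventually.of_forall fun x => ?_), ?_⟩
    · simp only [Pi.add_apply]
      ring
    · have hr0 : 0 < r := hr.1
      have h5 : |d| ≤ s * periodCoeff φ α β / |s| * r := by
        have : r * |d| ≤ r * (s * periodCoeff φ α β / |s| * r) := by
          calc _ ≤ _ := h3
            _ = _ := by ring
        exact le_of_mul_le_mul_left this hr0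
      have h6 : |s * d| ≤ s * periodCoeff φ α β * r := by
        rw [abs_mul]
        calc |s| * |d| ≤ |s| * (s * periodCoeff φ α β / |s| * r) := by gcongr
          _ = _ := by field_simp
      have h7 := (abs_le.1 h6).1
      have h8 : 0 < s * periodCoeff φ α β * r := by positivity
      norm_num
      nlinarith
  refine strictMonoOn_of_deriv_pos (convex_Ioo 0 M) (fun r hr => ?_) (fun r hr => ?_)
  · exact (key r hr).choose_spec.1.continuousAt.continuousWithinAt
  · rw [interior_Ioo] at hr
    rw [(key r hr).choose_spec.1.deriv]
    exact (key r hr).choose_spec.2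

end LienardExpansion

theorem le_four_mul_of_abs_deriv_le_right {e e' : ℝ → ℝ} {a b m : ℝ} (hab : b ≤ a + 20)
    (he : ∀ t ∈ Icc a b, HasDerivAt e (e' t) t)
    (hB : ∀ t ∈ Icc a b, e t ≤ 4 * m → |e' t| ≤ e t / 20)
    (hm : 0 < m) (ha : e a ≤ m) : ∀ t ∈ Icc a b, e t ≤ 4 * m := by
  have hexp : exp (5 / 4) ≤ 4 := by
    have h1 : exp (1 / 4) ≤ 4 / 3 := by
      have := one_sub_le_exp_neg (1 / 4)
      rw [exp_neg, le_inv_comm₀ (by norm_num) (exp_pos _)] at this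
      linarith
    have h2 := exp_one_lt_d9
    have h3 : exp (5 / 4) = exp 1 * exp (1 / 4) := by rw [← exp_add]; norm_num
    rw [h3]
    nlinarith [exp_pos 1, exp_pos (1 / 4)]
  have hle : ∀ t ∈ Icc a b, m * exp ((t - a) / 16) ≤ 4 * m := fun t ht => by
    have : exp ((t - a) / 16) ≤ exp (5 / 4) := exp_le_exp.2 (by linarith [ht.2])
    nlinarith
  have key := image_le_of_deriv_right_lt_deriv_boundary (f := e) (f' := e') (a := a) (b := b)
    (B := fun t => m * exp ((t - a) / 16)) (B' := fun t => m * (exp ((t - a) / 16) * (1 / 16)))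
    (fun t ht => (he t ht).continuousAt.continuousWithinAt)
    (fun t ht => (he t (Ico_subset_Icc_self ht)).hasDerivWithinAt) (by simpa using ha)
    (fun t => (((((hasDerivAt_id' t).sub_const a).div_const 16).exp).const_mul m))
    (fun t ht h => by
      have ht' := Ico_subset_Icc_self ht
      have h1 := hB t ht' (h.le.trans (hle t ht'))
      have h2 : 0 < m * exp ((t - a) / 16) := by positivity
      have h3 := (le_abs_self _).trans h1
      rw [h] at h3
      linarith)
  exact fun t ht => (key ht).trans (hle t ht)

theorem le_four_mul_of_abs_deriv_le {e e' : ℝ → ℝ} {s t m : ℝ} (hst : |t - s| ≤ 20)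
    (he : ∀ x ∈ uIcc s t, HasDerivAt e (e' x) x)
    (hB : ∀ x ∈ uIcc s t, e x ≤ 4 * m → |e' x| ≤ e x / 20)
    (hm : 0 < m) (hs : e s ≤ m) : e t ≤ 4 * m := by
  rcases le_total s t with h | h
  · rw [uIcc_of_le h] at he hB
    exact le_four_mul_of_abs_deriv_le_right (by linarith [(abs_le.1 hst).2]) he hB hm hs t
      ⟨h, le_rfl⟩
  · rw [uIcc_of_ge h] at he hB
    have hneg : ∀ x ∈ Icc (-s) (-t), -x ∈ Icc t s := fun x hx =>
      ⟨by linarith [hx.2], by linarith [hx.1]⟩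
    have := le_four_mul_of_abs_deriv_le_right (e := fun x => e (-x)) (e' := fun x => -e' (-x))
      (a := -s) (b := -t) (m := m) (by linarith [(abs_le.1 hst).1])
      (fun x hx => ((he (-x) (hneg x hx)).comp x (hasDerivAt_neg' x)).congr_deriv (by ring))
      (fun x hx h => by rw [abs_neg]; exact hB (-x) (hneg x hx) h) hm (by simpa using hs) (-t)
      ⟨by linarith, le_rfl⟩
    simpa using this

theorem eq_zero_of_abs_deriv_le {e e' : ℝ → ℝ} {s t : ℝ} (hst : |t - s| ≤ 20)
    (he : ∀ x ∈ uIcc s t, HasDerivAt e (e' x) x) (hB : ∀ x ∈ uIcc s t, |e' x| ≤ e x / 20)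
    (h0 : 0 ≤ e t) (hs : e s = 0) : e t = 0 := by
  refine le_antisymm (le_of_forall_pos_le_add fun ε hε => ?_) h0
  have := le_four_mul_of_abs_deriv_le (m := ε / 4) hst he (fun x hx _ => hB x hx) (by positivity)
    (by rw [hs]; positivity)
  linarith

/-- Orbits of the planar system `x' = y - F x`, `y' = -(x + γ x)`, where the second equation is
only required for `|x| < η`. -/
structure IsPlanarSolution (F γ : ℝ → ℝ) (η : ℝ) (X Y : ℝ → ℝ) : Prop where
  deriv_fst : ∀ t, HasDerivAt X (Y t - F (X t)) t
  differentiable_snd : Differentiable ℝ Y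
  deriv_snd : ∀ t, |X t| < η → deriv Y t = -(X t + γ (X t))

/-- The perturbation terms are `1 / 80`-Lipschitz on `(-η, η)`. -/
structure SmallLipschitz (F γ : ℝ → ℝ) (η : ℝ) : Prop where
  pos : 0 < η
  fst_zero : F 0 = 0
  snd_zero : γ 0 = 0
  fst : ∀ x y, |x| < η → |y| < η → |F x - F y| ≤ |x - y| / 80
  snd : ∀ x y, |x| < η → |y| < η → |γ x - γ y| ≤ |x - y| / 80

theorem SmallLipschitz.fst_le {F γ : ℝ → ℝ} {η x : ℝ} (h : SmallLipschitz F γ η) (hx : |x| < η) :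
    |F x| ≤ |x| / 80 := by
  simpa [h.fst_zero] using h.fst x 0 hx (by simpa using h.pos)

theorem SmallLipschitz.snd_le {F γ : ℝ → ℝ} {η x : ℝ} (h : SmallLipschitz F γ η) (hx : |x| < η) :
    |γ x| ≤ |x| / 80 := by
  simpa [h.snd_zero] using h.snd x 0 hx (by simpa using h.pos)

theorem abs_energy_rate_le {x y p q : ℝ} (hp : |p| ≤ |x| / 80) (hq : |q| ≤ |x| / 80) :
    |-(2 * (x * p)) - 2 * (y * q)| ≤ (x ^ 2 + y ^ 2) / 20 := by
  have h1 : |x * p| ≤ |x| * (|x| / 80) := by rw [abs_mul]; gcongr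
  have h2 : |y * q| ≤ |y| * (|x| / 80) := by rw [abs_mul]; gcongr
  have h3 := abs_le.1 h1
  have h4 := abs_le.1 h2
  rw [← sq_abs x, ← sq_abs y, abs_le]
  constructor <;> nlinarith [sq_nonneg (|x| - |y|), sq_nonneg |x|, sq_nonneg |y|]

namespace IsPlanarSolution

variable {F γ : ℝ → ℝ} {η : ℝ} {X Y X₁ Y₁ X₂ Y₂ : ℝ → ℝ}

theorem shift (h : IsPlanarSolution F γ η X Y) (τ : ℝ) :
    IsPlanarSolution F γ η (fun t => X (t + τ)) (fun t => Y (t + τ)) where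
  deriv_fst t := (h.deriv_fst (t + τ)).comp_add_const t τ
  differentiable_snd := h.differentiable_snd.comp (by fun_prop)
  deriv_snd t ht := by
    rw [deriv_comp_add_const]
    exact h.deriv_snd (t + τ) ht

theorem zero (hL : SmallLipschitz F γ η) : IsPlanarSolution F γ η (fun _ => 0) (fun _ => 0) where
  deriv_fst t := by simpa [hL.fst_zero] using hasDerivAt_const t (0 : ℝ)
  differentiable_snd := by fun_prop
  deriv_snd t _ := by simp [hL.snd_zero]

theorem continuous_fst (h : IsPlanarSolution F γ η X Y) : Continuous X :=
  continuous_iff_continuousAt.2 fun t => (h.deriv_fst t).continuousAt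

theorem hasDerivAt_energy (h : IsPlanarSolution F γ η X Y) (t : ℝ) :
    HasDerivAt (fun t => X t ^ 2 + Y t ^ 2)
      (2 * X t * (Y t - F (X t)) + 2 * Y t * deriv Y t) t := by
  have := ((h.deriv_fst t).pow 2).add ((h.differentiable_snd t).hasDerivAt.pow 2)
  refine this.congr_deriv ?_
  norm_num

theorem abs_fst_lt {m : ℝ} {t : ℝ} (hη : 0 < η) (ht : X t ^ 2 + Y t ^ 2 ≤ m) (hm : m < η ^ 2) :
    |X t| < η :=
  abs_lt_of_sq_lt_sq (by nlinarith [sq_nonneg (Y t)]) hη.le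

theorem energy_le (h : IsPlanarSolution F γ η X Y) (hL : SmallLipschitz F γ η) {m s t : ℝ}
    (hm : 0 < m) (hmη : 4 * m < η ^ 2) (hs : X s ^ 2 + Y s ^ 2 ≤ m) (hst : |t - s| ≤ 20) :
    X t ^ 2 + Y t ^ 2 ≤ 4 * m := by
  refine le_four_mul_of_abs_deriv_le (e := fun t => X t ^ 2 + Y t ^ 2) hst
    (fun x _ => h.hasDerivAt_energy x) (fun x _ hx => ?_) hm hs
  have hX := abs_fst_lt hL.pos hx hmη
  rw [h.deriv_snd x hX]
  convert abs_energy_rate_le (y := Y x) (hL.fst_le hX) (hL.snd_le hX) using 2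
  ring

theorem energy_ge (h : IsPlanarSolution F γ η X Y) (hL : SmallLipschitz F γ η) {m s t : ℝ}
    (hm : 0 < m) (hmη : 4 * m < η ^ 2) (hs : X s ^ 2 + Y s ^ 2 ≤ m) (hst : |t - s| ≤ 20) :
    X s ^ 2 + Y s ^ 2 ≤ 4 * (X t ^ 2 + Y t ^ 2) := by
  by_contra! hlt
  obtain ⟨m', h1, h2⟩ := exists_between (show X t ^ 2 + Y t ^ 2 < (X s ^ 2 + Y s ^ 2) / 4 by
    linarith)
  have := h.energy_le hL (m := m') (s := t) (t := s) (by nlinarith [sq_nonneg (X t), sq_nonneg (Y t)])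
    (by linarith) h1.le (by rwa [abs_sub_comm])
  linarith

theorem eq_of_eq (h₁ : IsPlanarSolution F γ η X₁ Y₁) (h₂ : IsPlanarSolution F γ η X₂ Y₂)
    (hL : SmallLipschitz F γ η) {m s t : ℝ} (hm : 0 < m) (hmη : 4 * m < η ^ 2)
    (hs : X₁ s ^ 2 + Y₁ s ^ 2 ≤ m) (hX : X₁ s = X₂ s) (hY : Y₁ s = Y₂ s) (hst : |t - s| ≤ 20) :
    X₁ t = X₂ t ∧ Y₁ t = Y₂ t := by
  have key : (X₁ t - X₂ t) ^ 2 + (Y₁ t - Y₂ t) ^ 2 = 0 := by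
    refine eq_zero_of_abs_deriv_le (e := fun t => (X₁ t - X₂ t) ^ 2 + (Y₁ t - Y₂ t) ^ 2) hst
      (fun x _ => ((((h₁.deriv_fst x).sub (h₂.deriv_fst x)).pow 2).add
        (((h₁.differentiable_snd x).hasDerivAt.sub
          (h₂.differentiable_snd x).hasDerivAt).pow 2))) (fun x hx => ?_) (by positivity)
      (by simp [hX, hY])
    have hxs : |x - s| ≤ 20 := (abs_sub_left_of_mem_uIcc hx).trans hst
    have a₁ := abs_fst_lt hL.pos (h₁.energy_le hL hm hmη hs hxs) hmη
    have a₂ := abs_fst_lt hL.pos (h₂.energy_le hL hm hmη (by rwa [← hX, ← hY]) hxs) hmη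
    rw [h₁.deriv_snd x a₁, h₂.deriv_snd x a₂]
    convert abs_energy_rate_le (y := Y₁ x - Y₂ x) (hL.fst _ _ a₁ a₂) (hL.snd _ _ a₁ a₂) using 2
    simp only [Pi.sub_apply]
    norm_num
    ring
  constructor <;> nlinarith [sq_nonneg (X₁ t - X₂ t), sq_nonneg (Y₁ t - Y₂ t)]

end IsPlanarSolution

theorem exists_inverse_primitive {H : ℝ → ℝ} (hH : Continuous H) (h : ∀ t, 1 / 2 ≤ H t)
    (t₀ θ₀ : ℝ) : ∃ Θ k : ℝ → ℝ, Θ t₀ = θ₀ ∧ k θ₀ = t₀ ∧ (∀ t, HasDerivAt Θ (H t) t) ∧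
      (∀ θ, Θ (k θ) = θ) ∧ (∀ θ, HasDerivAt k (1 / H (k θ)) θ) ∧
      ∀ θ, |k θ - t₀| ≤ 2 * |θ - θ₀| := by
  have hd : ∀ t, HasDerivAt (fun t => θ₀ + ∫ x in t₀..t, H x) (H t) t := fun t =>
    (hH.integral_hasStrictDerivAt t₀ t).hasDerivAt.const_add θ₀
  set Θ : ℝ → ℝ := fun t => θ₀ + ∫ x in t₀..t, H x with hΘ
  have h0 : Θ t₀ = θ₀ := by simp [hΘ]
  have hmono : StrictMono Θ := strictMono_of_deriv_pos fun t => by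
    rw [(hd t).deriv]; linarith [h t]
  have hlin : Monotone fun t => Θ t - t / 2 := by
    have hd' : ∀ t, HasDerivAt (fun t => Θ t - t / 2) (H t - 1 / 2) t := fun t =>
      (hd t).sub ((hasDerivAt_id' t).div_const 2)
    exact monotone_of_deriv_nonneg (fun t => (hd' t).differentiableAt)
      fun t => by rw [(hd' t).deriv]; linarith [h t]
  have hcont : Continuous Θ := continuous_iff_continuousAt.2 fun t => (hd t).continuousAt
  have hsurj : Function.Surjective Θ := by
    refine hcont.surjective ?_ ?_
    · refine tendsto_atTop_mono' atTop (f₁ := fun t => t / 2 + (Θ t₀ - t₀ / 2)) ?_ ?_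
      · filter_upwards [eventually_ge_atTop t₀] with t ht
        have := hlin ht
        simp only at this
        linarith
      · exact tendsto_atTop_add_const_right _ _ (tendsto_id.atTop_div_const (by norm_num))
    · refine tendsto_atBot_mono' atBot (f₁ := fun t => t / 2 + (Θ t₀ - t₀ / 2)) ?_ ?_
      · filter_upwards [eventually_le_atBot t₀] with t ht
        have := hlin ht
        simp only at this
        linarith
      · exact tendsto_atBot_add_const_right _ _ (tendsto_id.atBot_div_const (by norm_num))
  let e := hmono.orderIsoOfSurjective Θ hsurj
  have hek : ∀ θ, Θ (e.symm θ) = θ := fun θ => e.apply_symm_apply θ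
  have hk : ∀ θ, HasDerivAt e.symm (1 / H (e.symm θ)) θ := fun θ => by
    rw [one_div]
    exact HasDerivAt.of_local_left_inverse e.symm.continuous.continuousAt (hd _)
      (by linarith [h (e.symm θ)]) (Eventually.of_forall hek)
  have hk0 : e.symm θ₀ = t₀ := by rw [← h0]; exact e.symm_apply_apply t₀
  refine ⟨Θ, e.symm, h0, hk0, hd, hek, hk, fun θ => ?_⟩
  have := convex_univ.norm_image_sub_le_of_norm_hasDerivWithin_le (f := e.symm) (C := 2)
    (fun x _ => (hk x).hasDerivWithinAt) (fun x _ => ?_) (mem_univ θ₀) (mem_univ θ)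
  · rwa [hk0, Real.norm_eq_abs, Real.norm_eq_abs] at this
  · have := h (e.symm x)
    rw [Real.norm_eq_abs, abs_of_pos (by positivity), div_le_iff₀ (by linarith)]
    linarith

theorem SmallLipschitz.continuousOn_fst {F γ : ℝ → ℝ} {η : ℝ} (h : SmallLipschitz F γ η) :
    ContinuousOn F {x | |x| < η} :=
  (LipschitzOnWith.of_dist_le_mul (K := 1 / 80) fun x hx y hy =>
    (h.fst x y hx hy).trans_eq (by rw [Real.dist_eq]; push_cast; ring)).continuousOn

theorem SmallLipschitz.continuousOn_snd {F γ : ℝ → ℝ} {η : ℝ} (h : SmallLipschitz F γ η) :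
    ContinuousOn γ {x | |x| < η} :=
  (LipschitzOnWith.of_dist_le_mul (K := 1 / 80) fun x hx y hy =>
    (h.snd x y hx hy).trans_eq (by rw [Real.dist_eq]; push_cast; ring)).continuousOn

/-- Polar representation `X = ρ cos θ`, `Y = -ρ sin θ` of a planar orbit over slightly more than
one turn on each side, with the time `k` as a function of the angle. -/
structure IsPolarLift (F γ X Y ρ k : ℝ → ℝ) : Prop where
  deriv_time : ∀ θ ∈ Ioo (-8 : ℝ) 8, HasDerivAt k (1 / (1 + angularExcess F γ (ρ θ) θ)) θ
  deriv_radius : ∀ θ ∈ Ioo (-8 : ℝ) 8, HasDerivAt ρ (orbitSlope F γ (ρ θ) θ) θ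
  speed_ge : ∀ θ ∈ Ioo (-8 : ℝ) 8, 1 / 2 ≤ 1 + angularExcess F γ (ρ θ) θ
  radius_pos : ∀ θ ∈ Ioo (-8 : ℝ) 8, 0 < ρ θ
  fst_eq : ∀ θ ∈ Ioo (-8 : ℝ) 8, X (k θ) = ρ θ * cos θ
  snd_eq : ∀ θ ∈ Ioo (-8 : ℝ) 8, Y (k θ) = -(ρ θ * sin θ)

theorem abs_turn_rate_le {x y p q : ℝ} (hp : |p| ≤ |x| / 80) (hq : |q| ≤ |x| / 80) :
    |x * q - y * p| ≤ (x ^ 2 + y ^ 2) / 20 := by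
  have h1 : |x * q| ≤ |x| * (|x| / 80) := by rw [abs_mul]; gcongr
  have h2 : |y * p| ≤ |y| * (|x| / 80) := by rw [abs_mul]; gcongr
  have h3 := abs_le.1 h1
  have h4 := abs_le.1 h2
  rw [← sq_abs x, ← sq_abs y, abs_le]
  constructor <;> nlinarith [sq_nonneg (|x| - |y|), sq_nonneg |x|, sq_nonneg |y|]

theorem radial_residual_identity {x y R : ℝ} (hR : 0 < R) (h : R ^ 2 = x ^ 2 + y ^ 2)
    (p q c s : ℝ) :
    2 * (x - R * c) * (y - p - ((2 * x * (y - p) + 2 * y * -(x + q)) / (2 * R) * c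
        + R * (-s * (1 + (x * q - y * p) / (x ^ 2 + y ^ 2)))))
      + 2 * (y + R * s) * (-(x + q) + ((2 * x * (y - p) + 2 * y * -(x + q)) / (2 * R) * s
        + R * (c * (1 + (x * q - y * p) / (x ^ 2 + y ^ 2)))))
    = (2 * x * (y - p) + 2 * y * -(x + q)) / (x ^ 2 + y ^ 2)
      * ((x - R * c) ^ 2 + (y + R * s) ^ 2) := by
  obtain ⟨σ, hσ⟩ : ∃ σ, σ = (2 * x * (y - p) + 2 * y * -(x + q)) / (2 * R ^ 2) := ⟨_, rfl⟩
  obtain ⟨w, hw⟩ : ∃ w, w = 1 + (x * q - y * p) / R ^ 2 := ⟨_, rfl⟩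
  have h1 : (2 * x * (y - p) + 2 * y * -(x + q)) / (2 * R) = σ * R := by rw [hσ]; field_simp
  have h2 : (2 * x * (y - p) + 2 * y * -(x + q)) / R ^ 2 = 2 * σ := by rw [hσ]; field_simp
  have h3 : y - p = σ * x + w * y := by
    rw [hσ, hw]; field_simp; linear_combination (-p) * h
  have h4 : -(x + q) = σ * y - w * x := by
    rw [hσ, hw]; field_simp; linear_combination (-q) * h
  rw [h1, ← h, ← hw, h2, h3, h4]
  ring

theorem radial_rate_identity {R : ℝ} (hR : 0 < R) (p q c s : ℝ) :
    (2 * (R * c) * (-(R * s) - p) + 2 * -(R * s) * -(R * c + q)) / (2 * R) = q * s - p * c := by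
  field_simp
  ring

theorem IsPlanarSolution.exists_polarLift {F γ X Y : ℝ → ℝ} {η t₀ θ₀ ρ₀ : ℝ}
    (h : IsPlanarSolution F γ η X Y) (hL : SmallLipschitz F γ η) (hρ : 0 < ρ₀)
    (hη : 2 * ρ₀ < η) (hθ : |θ₀| ≤ 1) (hX : X t₀ = ρ₀ * cos θ₀) (hY : Y t₀ = -(ρ₀ * sin θ₀)) :
    ∃ ρ k, IsPolarLift F γ X Y ρ k ∧ k θ₀ = t₀ ∧ ρ θ₀ = ρ₀ ∧
      (∀ θ ∈ Ioo (-8 : ℝ) 8, ρ₀ / 2 ≤ ρ θ ∧ ρ θ ≤ 2 * ρ₀) ∧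
      ∀ θ, |k θ - t₀| ≤ 2 * |θ - θ₀| := by
  set E : ℝ → ℝ := fun t => X t ^ 2 + Y t ^ 2 with hE
  have hE0 : E t₀ = ρ₀ ^ 2 := by
    simp only [hE, hX, hY]
    linear_combination ρ₀ ^ 2 * sin_sq_add_cos_sq θ₀
  have hm : 0 < ρ₀ ^ 2 := by positivity
  have hmη : 4 * ρ₀ ^ 2 < η ^ 2 := by nlinarith
  have hle : ∀ t, |t - t₀| ≤ 20 → E t ≤ 4 * ρ₀ ^ 2 := fun t ht =>
    h.energy_le hL hm hmη hE0.le ht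
  have hge : ∀ t, |t - t₀| ≤ 20 → ρ₀ ^ 2 ≤ 4 * E t := fun t ht =>
    hE0.ge.trans (h.energy_ge hL hm hmη hE0.le ht)
  have hXη : ∀ t, |t - t₀| ≤ 20 → |X t| < η := fun t ht => abs_fst_lt hL.pos (hle t ht) hmη
  have hEpos : ∀ t, |t - t₀| ≤ 20 → 0 < E t := fun t ht => by linarith [hge t ht]
  set w : ℝ → ℝ := fun t => 1 + (X t * γ (X t) - Y t * F (X t)) / E t with hw
  have hXc := h.continuous_fst
  have hYc := h.differentiable_snd.continuous
  have hwin : ∀ t ∈ Icc (t₀ - 20) (t₀ + 20), |t - t₀| ≤ 20 := fun t ht =>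
    abs_le.2 ⟨by linarith [ht.1], by linarith [ht.2]⟩
  have hwc : ContinuousOn w (Icc (t₀ - 20) (t₀ + 20)) := by
    have hmaps : MapsTo X (Icc (t₀ - 20) (t₀ + 20)) {x | |x| < η} := fun t ht => hXη t (hwin t ht)
    have hF := hL.continuousOn_fst.comp hXc.continuousOn hmaps
    have hγ := hL.continuousOn_snd.comp hXc.continuousOn hmaps
    exact continuousOn_const.add (((hXc.continuousOn.mul hγ).sub (hYc.continuousOn.mul hF)).div
      ((hXc.pow 2).add (hYc.pow 2)).continuousOn fun t ht => (hEpos t (hwin t ht)).ne')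
  have hwb : ∀ t, |t - t₀| ≤ 20 → 1 / 2 ≤ w t := fun t ht => by
    have h1 := abs_turn_rate_le (y := Y t) (hL.fst_le (hXη t ht)) (hL.snd_le (hXη t ht))
    have h2 : -(1 / 20) ≤ (X t * γ (X t) - Y t * F (X t)) / E t := by
      rw [le_div_iff₀ (hEpos t ht)]
      have := (abs_le.1 h1).1
      simp only [hE]
      linarith
    simp only [hw]
    linarith
  have hI : t₀ - 20 ≤ t₀ + 20 := by linarith
  obtain ⟨Θ, k, hΘ0, hk0, hΘd, hΘk, hkd, hkb⟩ := exists_inverse_primitive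
    (H := IccExtend hI ((Icc (t₀ - 20) (t₀ + 20)).domRestrict w))
    (continuousOn_iff_continuous_domRestrict.1 hwc).Icc_extend'
    (fun t => hwb _ (hwin _ (projIcc _ _ hI t).2)) t₀ θ₀
  have hext : ∀ t, |t - t₀| ≤ 20 → IccExtend hI ((Icc (t₀ - 20) (t₀ + 20)).domRestrict w) t = w t :=
    fun t ht => by
      have ht' := abs_le.1 ht
      exact IccExtend_of_mem hI _ ⟨by linarith [ht'.1], by linarith [ht'.2]⟩
  have hpolar : ∀ t, |t - t₀| ≤ 20 → X t = √(E t) * cos (Θ t) ∧ Y t = -(√(E t) * sin (Θ t)) := by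
    intro t ht
    have hzero := eq_zero_of_abs_deriv_le
      (e := fun t => (X t - √(E t) * cos (Θ t)) ^ 2 + (Y t + √(E t) * sin (Θ t)) ^ 2)
      (e' := fun t => (2 * X t * (Y t - F (X t)) + 2 * Y t * deriv Y t) / E t *
        ((X t - √(E t) * cos (Θ t)) ^ 2 + (Y t + √(E t) * sin (Θ t)) ^ 2)) ht
      (fun x hx => ?_) (fun x hx => ?_) (by positivity) ?_
    · constructor <;> nlinarith [sq_nonneg (X t - √(E t) * cos (Θ t)),
        sq_nonneg (Y t + √(E t) * sin (Θ t))]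
    · have hxs : |x - t₀| ≤ 20 := (abs_sub_left_of_mem_uIcc hx).trans ht
      have hEx := hEpos x hxs
      have hs := (h.hasDerivAt_energy x).sqrt hEx.ne'
      have hθ := hΘd x
      rw [hext x hxs] at hθ
      have h1 := (h.deriv_fst x).sub (hs.mul hθ.cos)
      have h2 := (h.differentiable_snd x).hasDerivAt.add (hs.mul hθ.sin)
      refine ((h1.pow 2).add (h2.pow 2)).congr_deriv ?_
      have hdY := h.deriv_snd x (hXη x hxs)
      rw [hdY]
      have hfin := radial_residual_identity (sqrt_pos.2 hEx) (sq_sqrt hEx.le) (F (X x)) (γ (X x))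
        (cos (Θ x)) (sin (Θ x))
      simp only [hE] at hfin
      simp only [Pi.sub_apply, Pi.add_apply, Pi.mul_apply, hw, hE]
      rw [← hfin]
      norm_num
    · have hxs : |x - t₀| ≤ 20 := (abs_sub_left_of_mem_uIcc hx).trans ht
      have hEx := hEpos x hxs
      have hn : 0 ≤ (X x - √(E x) * cos (Θ x)) ^ 2 + (Y x + √(E x) * sin (Θ x)) ^ 2 := by
        positivity
      generalize (X x - √(E x) * cos (Θ x)) ^ 2 + (Y x + √(E x) * sin (Θ x)) ^ 2 = D at hn ⊢
      have := abs_energy_rate_le (y := Y x) (hL.fst_le (hXη x hxs)) (hL.snd_le (hXη x hxs))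
      rw [h.deriv_snd x (hXη x hxs), abs_mul, abs_div, abs_of_pos hEx, abs_of_nonneg hn,
        show 2 * X x * (Y x - F (X x)) + 2 * Y x * -(X x + γ (X x)) =
        -(2 * (X x * F (X x))) - 2 * (Y x * γ (X x)) by ring, div_mul_eq_mul_div,
        div_le_iff₀ hEx]
      have h2 := mul_le_mul_of_nonneg_right this hn
      simp only [hE] at h2 ⊢
      linarith
    · simp [hΘ0, hE0, sqrt_sq hρ.le, hX, hY]
  have hkw : ∀ θ ∈ Ioo (-8 : ℝ) 8, |k θ - t₀| ≤ 20 := fun θ hθ' => by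
    have h1 : |θ - θ₀| ≤ 9 := by
      have := abs_le.1 hθ
      exact abs_le.2 ⟨by linarith [hθ'.1], by linarith [hθ'.2]⟩
    linarith [hkb θ]
  have hsq : ∀ θ ∈ Ioo (-8 : ℝ) 8, √(E (k θ)) ^ 2 = E (k θ) := fun θ hθ =>
    sq_sqrt (hEpos _ (hkw θ hθ)).le
  have hpos : ∀ θ ∈ Ioo (-8 : ℝ) 8, 0 < √(E (k θ)) := fun θ hθ =>
    sqrt_pos.2 (hEpos _ (hkw θ hθ))
  have hXk : ∀ θ ∈ Ioo (-8 : ℝ) 8, X (k θ) = √(E (k θ)) * cos θ := fun θ hθ => by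
    simpa [hΘk] using (hpolar _ (hkw θ hθ)).1
  have hYk : ∀ θ ∈ Ioo (-8 : ℝ) 8, Y (k θ) = -(√(E (k θ)) * sin θ) := fun θ hθ => by
    simpa [hΘk] using (hpolar _ (hkw θ hθ)).2
  have hwk : ∀ θ ∈ Ioo (-8 : ℝ) 8, w (k θ) = 1 + angularExcess F γ (√(E (k θ))) θ :=
    fun θ hθ => by
      have := hpos θ hθ
      simp only [hw, angularExcess]
      rw [← hXk θ hθ]
      have hx := hXk θ hθ
      have hy := hYk θ hθ
      have hs := hsq θ hθ
      generalize √(E (k θ)) = R at this hx hy hs ⊢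
      rw [← hs, hy]
      generalize γ (X (k θ)) = q
      generalize F (X (k θ)) = p
      rw [hx]
      field_simp
      ring
  have hkd' : ∀ θ ∈ Ioo (-8 : ℝ) 8,
      HasDerivAt k (1 / (1 + angularExcess F γ (√(E (k θ))) θ)) θ := fun θ hθ => by
    have := hkd θ
    rwa [hext _ (hkw θ hθ), hwk θ hθ] at this
  refine ⟨fun θ => √(E (k θ)), k, ⟨hkd', fun θ hθ => ?_, fun θ hθ => ?_, hpos, hXk, hYk⟩, hk0,
    by simp only [hk0, hE0, sqrt_sq hρ.le], fun θ hθ => ⟨?_, ?_⟩, hkb⟩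
  · have h1 := ((h.hasDerivAt_energy (k θ)).sqrt (hEpos _ (hkw θ hθ)).ne').comp θ (hkd' θ hθ)
    refine h1.congr_deriv ?_
    have hid := radial_rate_identity (hpos θ hθ) (F (X (k θ))) (γ (X (k θ))) (cos θ) (sin θ)
    rw [← hXk θ hθ, ← hYk θ hθ] at hid
    rw [h.deriv_snd _ (hXη _ (hkw θ hθ))]
    simp only [orbitSlope, radialRate]
    rw [← hXk θ hθ]
    congr 1
  · rw [← hwk θ hθ]
    exact hwb _ (hkw θ hθ)
  · exact le_sqrt_of_sq_le (by nlinarith [hge _ (hkw θ hθ)])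
  · exact (sqrt_le_left (by positivity)).2 (by nlinarith [hle _ (hkw θ hθ)])

/-- Uniform control of `orbitSlope` for radii in `(0, M)`. -/
structure OrbitSlopeBounds (F γ : ℝ → ℝ) (M : ℝ) (K : NNReal) : Prop where
  pos : 0 < M
  lipschitz : ∀ θ, LipschitzOnWith K (fun r => orbitSlope F γ r θ) (Ioo 0 M)
  le : ∀ θ, ∀ r ∈ Ioo 0 M, |orbitSlope F γ r θ| ≤ K * r ^ 2

theorem OrbitSlopeBounds.mono {F γ : ℝ → ℝ} {M M' : ℝ} {K : NNReal}
    (h : OrbitSlopeBounds F γ M K) (hM' : 0 < M') (hM : M' ≤ M) : OrbitSlopeBounds F γ M' K where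
  pos := hM'
  lipschitz θ := (h.lipschitz θ).mono (Ioo_subset_Ioo_right hM)
  le θ r hr := h.le θ r (Ioo_subset_Ioo_right hM hr)

theorem LienardExpansion.exists_orbitSlopeBounds {F FF γ : ℝ → ℝ} {φ α β : ℝ}
    (H : LienardExpansion F FF γ φ α β) : ∃ M K, OrbitSlopeBounds F γ M K := by
  obtain ⟨C, hC, hb⟩ := H.orbitSlope_bigO
  lift C to NNReal using hC
  obtain ⟨M, hM, h⟩ := mem_nhdsGT_iff_exists_Ioo_subset.1 hb
  have hM : 0 < M := hM
  have hmem : ∀ r ∈ Ioo 0 (min M 1), r ∈ Ioo 0 M := fun r hr =>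
    ⟨hr.1, hr.2.trans_le (min_le_left _ _)⟩
  refine ⟨min M 1, C, lt_min hM one_pos, fun θ => ?_, fun θ r hr => ?_⟩
  · choose! d hd using fun r hr => h (hmem r hr) θ
    refine (convex_Ioo _ _).lipschitzOnWith_of_nnnorm_hasDerivWithin_le (f' := d)
      (fun r hr => (hd r hr).1.hasDerivWithinAt) fun r hr => ?_
    rw [← NNReal.coe_le_coe, coe_nnnorm, Real.norm_eq_abs]
    have h1 := (hd r hr).2.2
    have hr1 : r < 1 := hr.2.trans_le (min_le_right _ _)
    have h2 : |d r| ≤ C * r := by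
      refine le_of_mul_le_mul_left ?_ hr.1
      linarith
    exact h2.trans (mul_le_of_le_one_right C.2 hr1.le)
  · obtain ⟨d, -, h1, -⟩ := h (hmem r hr) θ
    exact h1

/-- `ρ` is an orbit of the polar equation over the angles in `(a, b)`, with values in `(0, M)`. -/
def IsPolarOrbit (F γ : ℝ → ℝ) (M a b : ℝ) (ρ : ℝ → ℝ) : Prop :=
  ∀ θ ∈ Ioo a b, HasDerivAt ρ (orbitSlope F γ (ρ θ) θ) θ ∧ ρ θ ∈ Ioo 0 M

namespace IsPolarOrbit

variable {F γ ρ ρ₁ ρ₂ : ℝ → ℝ} {M a b θ₀ θ : ℝ} {K : NNReal}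

theorem mono {a' b' : ℝ} (h : IsPolarOrbit F γ M a b ρ) (ha : a ≤ a') (hb : b' ≤ b) :
    IsPolarOrbit F γ M a' b' ρ := fun θ hθ => h θ (Ioo_subset_Ioo ha hb hθ)

theorem continuousOn (h : IsPolarOrbit F γ M a b ρ) : ContinuousOn ρ (Ioo a b) := fun θ hθ =>
  (h θ hθ).1.continuousAt.continuousWithinAt

theorem eqOn (hK : OrbitSlopeBounds F γ M K) (h₁ : IsPolarOrbit F γ M a b ρ₁)
    (h₂ : IsPolarOrbit F γ M a b ρ₂) (hθ₀ : θ₀ ∈ Ioo a b) (heq : ρ₁ θ₀ = ρ₂ θ₀) :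
    EqOn ρ₁ ρ₂ (Ioo a b) :=
  ODE_solution_unique_of_mem_Ioo (v := fun θ r => orbitSlope F γ r θ) (s := fun _ => Ioo 0 M)
    (fun θ _ => hK.lipschitz θ) hθ₀ h₁ h₂ heq

theorem lt_of_lt (hK : OrbitSlopeBounds F γ M K) (h₁ : IsPolarOrbit F γ M a b ρ₁)
    (h₂ : IsPolarOrbit F γ M a b ρ₂) (hθ₀ : θ₀ ∈ Ioo a b) (hlt : ρ₁ θ₀ < ρ₂ θ₀)
    (hθ : θ ∈ Ioo a b) : ρ₁ θ < ρ₂ θ := by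
  by_contra! hle
  obtain ⟨ξ, hξ, heq⟩ := isPreconnected_Ioo.intermediate_value₂ hθ₀ hθ h₁.continuousOn
    h₂.continuousOn hlt.le hle
  exact hlt.ne (eqOn hK h₁ h₂ hξ heq hθ₀)

theorem comp_add_two_pi (h : IsPolarOrbit F γ M a b ρ) :
    IsPolarOrbit F γ M (a - 2 * π) (b - 2 * π) (fun θ => ρ (θ + 2 * π)) := fun θ hθ => by
  have := h (θ + 2 * π) ⟨by linarith [hθ.1], by linarith [hθ.2]⟩
  refine ⟨(this.1.comp_add_const θ (2 * π)).congr_deriv ?_, this.2⟩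
  simp [orbitSlope, radialRate, angularExcess]

end IsPolarOrbit

theorem LienardExpansion.exists_smallLipschitz {F FF γ : ℝ → ℝ} {φ α β : ℝ}
    (H : LienardExpansion F FF γ φ α β) : ∃ η, SmallLipschitz F γ η := by
  have hF : Tendsto (deriv F) (𝓝 0) (𝓝 0) := by
    have h1 := (H.F_exp.trans_tendsto tendsto_id).add
      ((continuous_const.mul continuous_id).tendsto' (0 : ℝ) 0 (by simp) :
        Tendsto (fun x => φ * x) (𝓝 0) (𝓝 0))
    simpa using h1
  have hγ : Tendsto (deriv γ) (𝓝 0) (𝓝 0) := by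
    have h1 := (H.γ_exp.trans_tendsto ((continuous_pow 2).tendsto' (0 : ℝ) 0 (by simp))).add
      (Continuous.tendsto' (by fun_prop) (0 : ℝ) 0 (by simp) :
        Tendsto (fun x => α * x + β * x ^ 2 / 2) (𝓝 0) (𝓝 0))
    simpa using h1
  have hF' : ∀ᶠ x in 𝓝 0, |deriv F x| < 1 / 80 := by
    exact hF.abs.eventually_lt_const (by norm_num)
  have hγ' : ∀ᶠ x in 𝓝 0, |deriv γ x| < 1 / 80 := by
    exact hγ.abs.eventually_lt_const (by norm_num)
  obtain ⟨η, hη, h⟩ := Metric.eventually_nhds_iff.1 ((hF'.and hγ').and (H.F_diff.and H.γ_diff))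
  have key : ∀ G : ℝ → ℝ, (∀ x, |x| < η → DifferentiableAt ℝ G x ∧ |deriv G x| ≤ 1 / 80) →
      ∀ x y, |x| < η → |y| < η → |G x - G y| ≤ |x - y| / 80 := fun G hG x y hx hy => by
    have hmem : ∀ z, z ∈ Ioo (-η) η ↔ |z| < η := fun z => abs_lt.symm
    have := (convex_Ioo (-η) η).norm_image_sub_le_of_norm_deriv_le (f := G) (C := 1 / 80)
      (fun z hz => (hG z ((hmem z).1 hz)).1) (fun z hz => (hG z ((hmem z).1 hz)).2)
      ((hmem y).2 hy) ((hmem x).2 hx)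
    rw [Real.norm_eq_abs, Real.norm_eq_abs] at this
    linarith
  have hη' := fun x (hx : |x| < η) => h (y := x) (by simpa using hx)
  exact ⟨η, hη, H.F_zero, H.γ_zero, key F fun x hx => ⟨(hη' x hx).2.1, (hη' x hx).1.1.le⟩,
    key γ fun x hx => ⟨(hη' x hx).2.2, (hη' x hx).1.2.le⟩⟩

theorem eq_zero_of_sin_eq_zero_of_cos_pos {θ : ℝ} (hθ : θ ∈ Ico 0 (2 * π)) (hs : sin θ = 0)
    (hc : 0 < cos θ) : θ = 0 := by
  have h1 : cos θ = 1 := by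
    have := sin_sq_add_cos_sq θ
    rw [hs] at this
    nlinarith
  exact (cos_eq_one_iff_of_lt_of_lt (by linarith [hθ.1, pi_pos]) hθ.2).1 h1

namespace IsPolarLift

variable {F γ X Y ρ k : ℝ → ℝ}

theorem isPolarOrbit {M : ℝ} (h : IsPolarLift F γ X Y ρ k)
    (hM : ∀ θ ∈ Ioo (-8 : ℝ) 8, ρ θ < M) : IsPolarOrbit F γ M (-8) 8 ρ :=
  fun θ hθ => ⟨h.deriv_radius θ hθ, h.radius_pos θ hθ, hM θ hθ⟩

theorem continuousOn_time (h : IsPolarLift F γ X Y ρ k) : ContinuousOn k (Ioo (-8) 8) :=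
  fun θ hθ => (h.deriv_time θ hθ).continuousAt.continuousWithinAt

theorem strictMonoOn_time (h : IsPolarLift F γ X Y ρ k) : StrictMonoOn k (Ioo (-8) 8) :=
  strictMonoOn_of_deriv_pos (convex_Ioo _ _) h.continuousOn_time fun θ hθ => by
    rw [interior_Ioo] at hθ
    rw [(h.deriv_time θ hθ).deriv]
    have := h.speed_ge θ hθ
    positivity

end IsPolarLift

theorem zero_mem_turn : (0 : ℝ) ∈ Ioo (-8 : ℝ) 8 := by constructor <;> norm_num

theorem two_pi_mem_turn : 2 * π ∈ Ioo (-8 : ℝ) 8 :=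
  ⟨by linarith [pi_pos], by linarith [pi_lt_four, pi_lt_d2]⟩

theorem neg_two_pi_mem_turn : -(2 * π) ∈ Ioo (-8 : ℝ) 8 :=
  ⟨by linarith [pi_lt_d2], by linarith [pi_pos]⟩

/-- During its first turn an orbit meets the positive `X`-axis only at the start. -/
theorem IsPolarLift.ne_of_mem {F γ X Y ρ k : ℝ → ℝ} (h : IsPolarLift F γ X Y ρ k) {t : ℝ}
    (ht : t ∈ Ico (k 0) (k (2 * π))) (hX : 0 < X t) (hY : Y t = 0) : t = k 0 := by
  obtain ⟨θ, hθ, rfl⟩ : ∃ θ ∈ Ico 0 (2 * π), k θ = t :=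
    intermediate_value_Ico (by positivity) (h.continuousOn_time.mono
      fun θ hθ => ⟨by linarith [hθ.1], hθ.2.trans_lt two_pi_mem_turn.2⟩) ht
  have hθ' : θ ∈ Ioo (-8 : ℝ) 8 := ⟨by linarith [hθ.1], hθ.2.trans two_pi_mem_turn.2⟩
  have hρ := h.radius_pos θ hθ'
  rw [h.fst_eq θ hθ'] at hX
  rw [h.snd_eq θ hθ', neg_eq_zero] at hY
  rw [eq_zero_of_sin_eq_zero_of_cos_pos hθ ((mul_eq_zero.1 hY).resolve_left hρ.ne')
    (pos_of_mul_pos_right hX hρ.le)]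

namespace IsPlanarSolution

variable {F γ X Y : ℝ → ℝ} {η p : ℝ}

theorem periodic_snd (h : IsPlanarSolution F γ η X Y) (hX : Function.Periodic X p) :
    Function.Periodic Y p := fun t => by
  have h1 := (h.deriv_fst (t + p)).comp_add_const t p
  have h2 := h.deriv_fst t
  rw [funext hX] at h1
  have := h1.unique h2
  rw [hX t] at this
  linarith

theorem le_of_return (h : IsPlanarSolution F γ η X Y) (hL : SmallLipschitz F γ η)
    (hp : IsLeast {p | 0 < p ∧ ∀ t, X (t + p) = X t} p) {m t₀ τ : ℝ} (hm : 0 < m)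
    (hmη : 4 * m < η ^ 2) (ht₀ : X t₀ ^ 2 + Y t₀ ^ 2 ≤ m) (hτ : 0 < τ) (hτ' : τ ≤ 20)
    (hX : X (t₀ + τ) = X t₀) (hY : Y (t₀ + τ) = Y t₀) : p ≤ τ := by
  have hstep : ∀ n : ℕ, X (t₀ + n * τ) = X t₀ ∧ Y (t₀ + n * τ) = Y t₀ := fun n => by
    induction n with
    | zero => simp
    | succ n ih =>
      have := (h.shift (n * τ)).eq_of_eq h hL (s := t₀) (t := t₀ + τ) hm hmη
        (by simpa only [ih.1, ih.2] using ht₀) ih.1 ih.2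
        (by rw [add_sub_cancel_left, abs_of_pos hτ]; exact hτ')
      rw [hX, hY] at this
      convert this using 3 <;> push_cast <;> ring
  have hfwd : ∀ t, t₀ ≤ t → X (t + τ) = X t := fun t ht => by
    have hq : 0 ≤ (t - t₀) / τ := div_nonneg (by linarith) hτ.le
    set n := ⌊(t - t₀) / τ⌋₊ with hn
    have h1 : n * τ ≤ t - t₀ := (le_div_iff₀ hτ).1 (Nat.floor_le hq)
    have h2 : t - t₀ < (n + 1) * τ := (div_lt_iff₀ hτ).1 (Nat.lt_floor_add_one _)
    have h3 := hstep n
    have h4 := hstep (n + 1)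
    have := (h.shift (((n + 1 : ℕ) : ℝ) * τ)).eq_of_eq (h.shift (n * τ)) hL (s := t₀)
      (t := t - n * τ) hm hmη (by simpa only [h4.1, h4.2] using ht₀) (h4.1.trans h3.1.symm)
      (h4.2.trans h3.2.symm) (abs_le.2 ⟨by linarith, by linarith⟩)
    convert this.1 using 2
    · push_cast; ring
    · ring
  refine hp.2 ⟨hτ, fun t => ?_⟩
  have hper : Function.Periodic X p := hp.1.2
  obtain ⟨n, hn⟩ := exists_nat_gt ((t₀ - t) / p)
  rw [div_lt_iff₀ hp.1.1] at hn
  have h1 := hper.nat_mul n t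
  have h2 := hper.nat_mul n (t + τ)
  rw [← h1, ← h2, add_right_comm]
  exact hfwd _ (by linarith)

/-- A small periodic orbit makes exactly one turn during its least period. -/
theorem exists_closed_polarLift (h : IsPlanarSolution F γ η X Y) (hL : SmallLipschitz F γ η)
    {M : ℝ} {K : NNReal} (hK : OrbitSlopeBounds F γ M K)
    (hp : IsLeast {p | 0 < p ∧ ∀ t, X (t + p) = X t} p) {t₀ θ₀ ρ₀ : ℝ} (hρ : 0 < ρ₀)
    (hη : 4 * ρ₀ < η) (hM : 4 * ρ₀ < M) (hθ : |θ₀| ≤ 1)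
    (hX : X t₀ = ρ₀ * cos θ₀) (hY : Y t₀ = -(ρ₀ * sin θ₀)) :
    ∃ ρ k, IsPolarLift F γ X Y ρ k ∧ IsPolarOrbit F γ M (-8) 8 ρ ∧ ρ θ₀ = ρ₀ ∧
      (∀ θ ∈ Ioo (-8 : ℝ) 8, ρ θ ≤ 2 * ρ₀) ∧ ρ (2 * π) = ρ 0 ∧ k (2 * π) - k 0 = p := by
  obtain ⟨ρs, ks, hs, -, hs0, hsb, -⟩ :=
    h.exists_polarLift hL hρ (by linarith) hθ hX hY
  have hso : IsPolarOrbit F γ M (-8) 8 ρs :=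
    hs.isPolarOrbit fun θ hθ => by linarith [(hsb θ hθ).2]
  have hperX : Function.Periodic X p := hp.1.2
  have hperY := h.periodic_snd hperX
  have hper : Function.Periodic (fun t => (X t, Y t)) p := fun t => by
    simp only [hperX t, hperY t]
  have hXs : X (ks 0) = ρs 0 := by simpa using hs.fst_eq 0 zero_mem_turn
  have hYs : Y (ks 0) = 0 := by simpa using hs.snd_eq 0 zero_mem_turn
  have hρs := hs.radius_pos 0 zero_mem_turn
  obtain ⟨tm, htm, hmin⟩ : ∃ tm, (Y tm = 0 ∧ 0 ≤ X tm) ∧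
      ∀ t, Y t = 0 → 0 ≤ X t → X tm ≤ X t := by
    have hcpt : IsCompact (Icc 0 p ∩ {t | Y t = 0 ∧ 0 ≤ X t}) :=
      isCompact_Icc.inter_right ((isClosed_eq h.differentiable_snd.continuous
        continuous_const).inter (isClosed_le continuous_const h.continuous_fst))
    have hmem : ∀ t, Y t = 0 → 0 ≤ X t →
        ∃ t' ∈ Icc 0 p ∩ {t | Y t = 0 ∧ 0 ≤ X t}, X t = X t' := fun t hYt hXt => by
      obtain ⟨t', ht', heq⟩ := hper.exists_mem_Ico₀ hp.1.1 t
      rw [Prod.mk.injEq] at heq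
      exact ⟨t', ⟨Ico_subset_Icc_self ht', heq.2 ▸ hYt, heq.1 ▸ hXt⟩, heq.1⟩
    obtain ⟨t', ht', -⟩ := hmem (ks 0) hYs (hXs ▸ hρs.le)
    obtain ⟨tm, htm, hmin⟩ := hcpt.exists_isMinOn ⟨t', ht'⟩ h.continuous_fst.continuousOn
    refine ⟨tm, htm.2, fun t h1 h2 => ?_⟩
    obtain ⟨t', ht', heq⟩ := hmem t h1 h2
    rw [heq]
    exact hmin ht'
  obtain ⟨r, hr⟩ : ∃ r, X tm = r := ⟨_, rfl⟩
  rw [hr] at htm hmin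
  have hr2 : r ≤ 2 * ρ₀ := by
    linarith [hmin (ks 0) hYs (hXs ▸ hρs.le), (hsb 0 zero_mem_turn).2]
  have hm : 0 < (2 * ρ₀) ^ 2 := by positivity
  have hmη : 4 * (2 * ρ₀) ^ 2 < η ^ 2 := by nlinarith
  have hEm : X tm ^ 2 + Y tm ^ 2 ≤ (2 * ρ₀) ^ 2 := by
    rw [hr, htm.1]; nlinarith [htm.2]
  have hr0 : 0 < r := by
    refine lt_of_le_of_ne htm.2 fun hr0 => ?_
    have hpos : 0 < min (p / 2) 20 := lt_min (half_pos hp.1.1) (by norm_num)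
    have := h.eq_of_eq (zero hL) hL (s := tm) (t := tm + min (p / 2) 20) hm hmη hEm
      (by rw [hr, hr0]) htm.1
      (by rw [add_sub_cancel_left, abs_of_pos hpos]; exact min_le_right _ _)
    have hle := h.le_of_return hL hp hm hmη hEm hpos (min_le_right _ _)
      (by rw [this.1, hr, hr0]) (by rw [this.2, htm.1])
    linarith [min_le_left (p / 2) 20, hp.1.1]
  obtain ⟨ρ, k, hl, hk0, hρ0, hb, hkb⟩ := h.exists_polarLift hL (t₀ := tm) (θ₀ := 0) hr0
    (by linarith) (by simp) (by simp [hr]) (by simp [htm.1])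
  have ho : IsPolarOrbit F γ M (-8) 8 ρ :=
    hl.isPolarOrbit fun θ hθ => by linarith [(hb θ hθ).2]
  have hret : ρ (2 * π) = ρ 0 := by
    have h1 : r ≤ ρ (2 * π) := by
      have := hmin (k (2 * π)) (by simpa using hl.snd_eq _ two_pi_mem_turn)
        (by simpa [hl.fst_eq _ two_pi_mem_turn] using (hl.radius_pos _ two_pi_mem_turn).le)
      simpa [hl.fst_eq _ two_pi_mem_turn] using this
    have h2 : r ≤ ρ (-(2 * π)) := by
      have := hmin (k (-(2 * π))) (by simpa using hl.snd_eq _ neg_two_pi_mem_turn)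
        (by simpa [hl.fst_eq _ neg_two_pi_mem_turn] using
          (hl.radius_pos _ neg_two_pi_mem_turn).le)
      simpa [hl.fst_eq _ neg_two_pi_mem_turn] using this
    by_contra hne
    have hlt : ρ 0 < ρ (0 + 2 * π) := by
      rw [zero_add, hρ0]
      exact lt_of_le_of_ne h1 fun heq => hne (by rw [hρ0, heq])
    have := IsPolarOrbit.lt_of_lt hK (ho.mono (a' := -8) (b' := 8 - 2 * π) le_rfl
      (by linarith [pi_pos])) (ho.comp_add_two_pi.mono (by linarith [pi_pos]) le_rfl)
      (θ₀ := 0) (θ := -(2 * π)) ⟨by norm_num, by linarith [two_pi_mem_turn.2]⟩ hlt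
      ⟨neg_two_pi_mem_turn.1, by linarith⟩
    simp only [neg_add_cancel, hρ0] at this
    linarith
  have hτ : k 0 < k (2 * π) := hl.strictMonoOn_time zero_mem_turn two_pi_mem_turn (by positivity)
  have hτ' : k (2 * π) - k 0 ≤ 20 := by
    have := (le_abs_self _).trans (hkb (2 * π))
    rw [sub_zero, abs_of_pos two_pi_pos] at this
    rw [hk0]
    linarith [pi_lt_four]
  have hXk : X (k (2 * π)) = r := by
    rw [hl.fst_eq _ two_pi_mem_turn, hret, hρ0, cos_two_pi, mul_one]
  have hYk : Y (k (2 * π)) = 0 := by simpa using hl.snd_eq _ two_pi_mem_turn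
  have hpτ : p ≤ k (2 * π) - k 0 := by
    refine h.le_of_return hL hp hm hmη hEm (sub_pos.2 hτ) hτ' ?_ ?_
    · rw [← hk0, add_sub_cancel, hXk, hk0, hr]
    · rw [← hk0, add_sub_cancel, hYk, hk0, htm.1]
  have hτp : k (2 * π) - k 0 ≤ p := by
    by_contra! hlt
    have := hl.ne_of_mem (t := k 0 + p) ⟨by linarith [hp.1.1], by linarith⟩
      (by rwa [hperX, hk0, hr]) (by rw [hperY, hk0, htm.1])
    linarith [hp.1.1]
  have hrs : ρs 0 = ρ 0 := by
    obtain ⟨t', ht', heq⟩ := hper.exists_mem_Ico hp.1.1 (ks 0) (k 0)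
    rw [Prod.mk.injEq] at heq
    have := hl.ne_of_mem (t := t') ⟨ht'.1, by linarith [ht'.2]⟩
      (by rwa [← heq.1, hXs]) (by rw [← heq.2, hYs])
    rw [← hXs, heq.1, this, hk0, hr, hρ0]
  have hEq := IsPolarOrbit.eqOn hK hso ho zero_mem_turn hrs
  have hθ₀ : θ₀ ∈ Ioo (-8 : ℝ) 8 := by
    have := abs_le.1 hθ
    exact ⟨by linarith, by linarith⟩
  exact ⟨ρ, k, hl, ho, by rw [← hEq hθ₀, hs0], fun θ hθ => by
    rw [← hEq hθ]; exact (hsb θ hθ).2, hret, by linarith⟩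

end IsPlanarSolution

/-- The polar angle of the point `(c, F c)`, where `x' = 0`. -/
noncomputable def startAngle (F : ℝ → ℝ) (c : ℝ) : ℝ := arctan (-(F c / c))

/-- The polar radius of the point `(c, F c)`, where `x' = 0`. -/
noncomputable def startRadius (F : ℝ → ℝ) (c : ℝ) : ℝ := √(c ^ 2 + F c ^ 2)

theorem startRadius_eq_mul {F : ℝ → ℝ} {c : ℝ} (hc : 0 < c) :
    startRadius F c = c * √(1 + (-(F c / c)) ^ 2) := by
  rw [startRadius, ← sqrt_sq hc.le, ← sqrt_mul (by positivity), sqrt_sq hc.le]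
  congr 1
  field_simp

theorem startRadius_mul_cos {F : ℝ → ℝ} {c : ℝ} (hc : 0 < c) :
    startRadius F c * cos (startAngle F c) = c := by
  have : 0 < √(1 + (-(F c / c)) ^ 2) := by positivity
  rw [startRadius_eq_mul hc, startAngle, cos_arctan]
  field_simp

theorem startRadius_mul_sin {F : ℝ → ℝ} {c : ℝ} (hc : 0 < c) :
    startRadius F c * sin (startAngle F c) = -F c := by
  have : 0 < √(1 + (-(F c / c)) ^ 2) := by positivity
  rw [startRadius_eq_mul hc, startAngle, sin_arctan]
  field_simp

theorem abs_arctan_sub_arctan_le (x y : ℝ) : |arctan x - arctan y| ≤ |x - y| := by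
  have := convex_univ.norm_image_sub_le_of_norm_hasDerivWithin_le (f := arctan) (C := 1)
    (fun x _ => (hasDerivAt_arctan x).hasDerivWithinAt) (fun x _ => ?_) (mem_univ y) (mem_univ x)
  · simpa using this
  · rw [Real.norm_eq_abs, abs_of_pos (by positivity), div_le_one (by positivity)]
    nlinarith

theorem SmallLipschitz.startRadius_le {F γ : ℝ → ℝ} {η c : ℝ} (hL : SmallLipschitz F γ η)
    (hc : c ∈ Ioo 0 η) : startRadius F c ≤ 81 / 80 * c := by
  have h := hL.fst_le (x := c) (by rw [abs_of_pos hc.1]; exact hc.2)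
  rw [abs_of_pos hc.1] at h
  have h2 := sq_le_sq' (abs_le.1 h).1 (abs_le.1 h).2
  refine (sqrt_le_left (by linarith [hc.1])).2 ?_
  nlinarith [sq_nonneg c]

theorem SmallLipschitz.abs_startAngle_le {F γ : ℝ → ℝ} {η c : ℝ} (hL : SmallLipschitz F γ η)
    (hc : c ∈ Ioo 0 η) : |startAngle F c| ≤ 1 := by
  have h := hL.fst_le (x := c) (by rw [abs_of_pos hc.1]; exact hc.2)
  have h1 := abs_arctan_sub_arctan_le (-(F c / c)) 0
  rw [arctan_zero, sub_zero, sub_zero, abs_neg, abs_div] at h1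
  refine h1.trans ((div_le_one (abs_pos.2 hc.1.ne')).2 ?_)
  linarith [abs_nonneg c]

theorem SmallLipschitz.startRadius_add_le {F γ : ℝ → ℝ} {η c₁ c₂ : ℝ}
    (hL : SmallLipschitz F γ η) (h₁ : 0 < c₁) (h : c₁ < c₂) (h₂ : c₂ < η) :
    startRadius F c₁ + (c₂ - c₁) / 2 ≤ startRadius F c₂ := by
  have hr := hL.startRadius_le (c := c₁) ⟨h₁, by linarith⟩
  have hsq : startRadius F c₁ ^ 2 = c₁ ^ 2 + F c₁ ^ 2 := sq_sqrt (by positivity)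
  have hd := hL.fst c₁ c₂ (by rw [abs_of_pos h₁]; linarith) (by rw [abs_of_pos] <;> linarith)
  have hF := hL.fst_le (x := c₁) (by rw [abs_of_pos h₁]; linarith)
  rw [abs_of_pos h₁] at hF
  rw [abs_sub_comm c₁, abs_of_pos (sub_pos.2 h)] at hd
  refine le_sqrt_of_sq_le ?_
  have hr0 : 0 ≤ startRadius F c₁ := sqrt_nonneg _
  obtain ⟨d, hd'⟩ : ∃ d, d = c₂ - c₁ := ⟨_, rfl⟩
  obtain rfl : c₂ = c₁ + d := by linarith
  have hd0 : 0 < d := by linarith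
  have h3 : F c₁ ^ 2 - F (c₁ + d) ^ 2 ≤ d * c₁ / 2 + d ^ 2 / 4 := by
    have h4 := abs_le.1 hd
    have h5 := abs_le.1 hF
    have h6 : |(F c₁ - F (c₁ + d)) * F c₁| ≤ d / 80 * (c₁ / 80) := by
      rw [abs_mul]
      have : |F c₁ - F (c₁ + d)| ≤ d / 80 := by convert hd using 1; ring
      gcongr
    have h7 := (abs_le.1 h6).2
    nlinarith [sq_nonneg (F c₁ - F (c₁ + d)), mul_pos hd0 h₁]
  nlinarith [mul_le_mul_of_nonneg_right hr hd0.le, mul_pos hd0 h₁]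

theorem LienardExpansion.exists_startAngle_lipschitz {F FF γ : ℝ → ℝ} {φ α β : ℝ}
    (H : LienardExpansion F FF γ φ α β) : ∃ M L, 0 < M ∧ 0 ≤ L ∧ ∀ c₁ ∈ Ioo 0 M, ∀ c₂ ∈ Ioo 0 M,
      |startAngle F c₁ - startAngle F c₂| ≤ L * |c₁ - c₂| := by
  have hF : DerivBigO 2 (fun r θ => F (r * cos θ)) := by
    have h1 : DerivBigO 0 (fun _ θ => φ / 2 * cos θ ^ 2) :=
      derivBigO_angle_of_periodic (by fun_prop) (fun θ => by simp)
    have h2 : DerivBigO 2 (fun r θ => φ / 2 * cos θ ^ 2 * (r * r)) := h1.mul derivBigO_radius_sq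
    have h3 : DerivBigO 2 (fun r θ => F (r * cos θ) - φ * (r * cos θ) ^ 2 / 2) := H.F_littleO.bigO
    refine (h3.add h2).congr (Eventually.of_forall fun r θ => ?_)
    ring
  obtain ⟨C, hC, hb⟩ := hF.div_radius
  obtain ⟨M, hM, h⟩ := mem_nhdsGT_iff_exists_Ioo_subset.1 hb
  refine ⟨M, C, hM, hC, fun c₁ h₁ c₂ h₂ => (abs_arctan_sub_arctan_le _ _).trans ?_⟩
  have h' : ∀ r ∈ Ioo 0 M, ∃ d, HasDerivAt (fun x => F (x * cos 0) / x) d r ∧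
      |F (r * cos 0) / r| ≤ C * r ^ 1 ∧ r * |d| ≤ C * r ^ 1 := fun r hr => h hr 0
  choose! d hd using h'
  have := (convex_Ioo 0 M).norm_image_sub_le_of_norm_hasDerivWithin_le (C := C)
    (fun r hr => (hd r hr).1.hasDerivWithinAt) (fun r hr => ?_) h₁ h₂
  · simp only [cos_zero, mul_one, Real.norm_eq_abs] at this
    rw [abs_sub_comm c₁]
    refine (le_of_eq ?_).trans this
    congr 1
    ring
  · have h1 := (hd r hr).2.2
    rw [pow_one] at h1
    refine le_of_mul_le_mul_left ?_ hr.1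
    rw [Real.norm_eq_abs]
    linarith

/-- Orbits starting further out stay further out. -/
theorem IsPolarOrbit.lt_of_start_lt {F γ ρ₁ ρ₂ : ℝ → ℝ} {η M L c₁ c₂ : ℝ} {K : NNReal}
    (hL : SmallLipschitz F γ η) (hK : OrbitSlopeBounds F γ M K) (h : c₁ < c₂)
    (hc₁ : 0 < c₁) (hc₂ : c₂ < η) (hρ₁ : IsPolarOrbit F γ M (-8) 8 ρ₁)
    (hρ₂ : IsPolarOrbit F γ M (-8) 8 ρ₂) (hs₁ : ρ₁ (startAngle F c₁) = startRadius F c₁)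
    (hs₂ : ρ₂ (startAngle F c₂) = startRadius F c₂)
    (hb : ∀ θ ∈ Ioo (-8 : ℝ) 8, ρ₁ θ ≤ 2 * startRadius F c₁) (hL0 : 0 ≤ L)
    (hang : |startAngle F c₂ - startAngle F c₁| ≤ L * |c₂ - c₁|) (hKL : 64 * (K * L) * c₁ ^ 2 ≤ 1)
    {θ : ℝ} (hθ : θ ∈ Ioo (-8 : ℝ) 8) : ρ₁ θ < ρ₂ θ := by
  have hmem : ∀ c ∈ Ioo 0 η, startAngle F c ∈ Ioo (-8 : ℝ) 8 := fun c hc => by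
    have := abs_le.1 (hL.abs_startAngle_le hc)
    exact ⟨by linarith, by linarith⟩
  have hm₁ := hmem c₁ ⟨hc₁, h.trans hc₂⟩
  have hm₂ := hmem c₂ ⟨hc₁.trans h, hc₂⟩
  refine lt_of_lt hK hρ₁ hρ₂ hm₂ ?_ hθ
  have hr := hL.startRadius_le ⟨hc₁, h.trans hc₂⟩
  have hadd := hL.startRadius_add_le hc₁ h hc₂
  have hr0 : 0 ≤ startRadius F c₁ := sqrt_nonneg _
  have hmv := (convex_Ioo (-8 : ℝ) 8).norm_image_sub_le_of_norm_hasDerivWithin_le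
    (C := K * (2 * startRadius F c₁) ^ 2) (fun θ hθ => (hρ₁ θ hθ).1.hasDerivWithinAt)
    (fun θ hθ => (hK.le θ _ (hρ₁ θ hθ).2).trans (by
      have := (hρ₁ θ hθ).2.1
      have := hb θ hθ
      gcongr)) hm₁ hm₂
  rw [hs₁, Real.norm_eq_abs, Real.norm_eq_abs] at hmv
  rw [abs_of_pos (sub_pos.2 h)] at hang
  have hd := sub_pos.2 h
  have h4 : K * (2 * startRadius F c₁) ^ 2 * |startAngle F c₂ - startAngle F c₁|
      ≤ K * (2 * (81 / 80 * c₁)) ^ 2 * (L * (c₂ - c₁)) := by gcongr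
  have h5 : K * (2 * (81 / 80 * c₁)) ^ 2 * (L * (c₂ - c₁)) ≤ (c₂ - c₁) / 4 := by
    have h6 : 0 ≤ K * L * c₁ ^ 2 := by positivity
    have h7 : K * L * (2 * (81 / 80 * c₁)) ^ 2 ≤ 1 / 4 := by nlinarith
    nlinarith
  have h8 := (le_abs_self _).trans (hmv.trans (h4.trans h5))
  rw [hs₂]
  linarith

theorem SmallLipschitz.mono {F γ : ℝ → ℝ} {η η' : ℝ} (h : SmallLipschitz F γ η) (h0 : 0 < η')
    (hη : η' ≤ η) : SmallLipschitz F γ η' where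
  pos := h0
  fst_zero := h.fst_zero
  snd_zero := h.snd_zero
  fst x y hx hy := h.fst x y (hx.trans_le hη) (hy.trans_le hη)
  snd x y hx hy := h.snd x y (hx.trans_le hη) (hy.trans_le hη)

theorem IsPlanarSolution.mono {F γ X Y : ℝ → ℝ} {η η' : ℝ} (h : IsPlanarSolution F γ η X Y)
    (hη : η' ≤ η) : IsPlanarSolution F γ η' X Y where
  deriv_fst := h.deriv_fst
  differentiable_snd := h.differentiable_snd
  deriv_snd t ht := h.deriv_snd t (ht.trans_le hη)

theorem hasDerivAt_timeCorrection_comp {F FF ρ : ℝ → ℝ} (φ α β : ℝ) {ρ' θ : ℝ}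
    (hρ : HasDerivAt ρ ρ' θ) (h0 : ρ θ ≠ 0)
    (hFF : HasDerivAt FF (F (ρ θ * cos θ)) (ρ θ * cos θ)) :
    HasDerivAt (fun θ => timeCorrection FF φ α β (ρ θ) θ)
      (timeCorrectionRadial F FF φ α β (ρ θ) θ * ρ' + timeCorrectionAngular F φ α β (ρ θ) θ) θ := by
  have hs := hasDerivAt_sin θ
  have hc := hasDerivAt_cos θ
  have h1 := (hFF.comp θ (hρ.mul hc)).div (hρ.pow 2) (pow_ne_zero 2 h0)
  have h2 := (hρ.mul_const (α / 2)).mul (hs.sub ((hs.pow 3).div_const 3))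
  have h3 := (hρ.pow 2).mul (hasDerivAt_oscPrimitive φ α β θ)
  refine ((h1.sub h2).add h3).congr_deriv ?_
  have hcc : cos θ ^ 3 = cos θ * (1 - sin θ ^ 2) := by rw [← cos_sq']; ring
  simp only [timeCorrectionRadial, timeCorrectionAngular, hcc, Function.comp_apply, Pi.mul_apply,
    Pi.pow_apply, Pi.sub_apply, Nat.cast_ofNat]
  field_simp
  ring

theorem timeCorrection_two_pi (FF : ℝ → ℝ) (φ α β r : ℝ) :
    timeCorrection FF φ α β r (2 * π) = timeCorrection FF φ α β r 0 := by
  simp [timeCorrection, oscPrimitive]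

/-- The time along a lift minus the correction term has the corrected time element as
derivative. -/
theorem IsPolarLift.hasDerivAt_sub_timeCorrection {F FF γ X Y ρ k : ℝ → ℝ} (φ α β : ℝ)
    (h : IsPolarLift F γ X Y ρ k) {θ : ℝ} (hθ : θ ∈ Ioo (-8 : ℝ) 8)
    (hFF : HasDerivAt FF (F (ρ θ * cos θ)) (ρ θ * cos θ)) :
    HasDerivAt (fun θ => k θ - timeCorrection FF φ α β (ρ θ) θ)
      (averagedTime F FF γ φ α β (ρ θ) θ) θ := by
  refine ((h.deriv_time θ hθ).sub (hasDerivAt_timeCorrection_comp φ α β (h.deriv_radius θ hθ)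
    (h.radius_pos θ hθ).ne' hFF)).congr_deriv ?_
  unfold averagedTime
  ring

/-- Comparison of the turning times of two nested closed orbits. -/
theorem IsPolarLift.turnTime_lt {F FF γ X₁ Y₁ ρ₁ k₁ X₂ Y₂ ρ₂ k₂ : ℝ → ℝ} {φ α β s M : ℝ}
    (h₁ : IsPolarLift F γ X₁ Y₁ ρ₁ k₁) (h₂ : IsPolarLift F γ X₂ Y₂ ρ₂ k₂)
    (hFF : ∀ x, |x| < M → HasDerivAt FF (F x) x)
    (hmono : ∀ θ, StrictMonoOn (fun r => s * averagedTime F FF γ φ α β r θ) (Ioo 0 M))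
    (hM₁ : ∀ θ ∈ Ioo (-8 : ℝ) 8, ρ₁ θ ∈ Ioo 0 M) (hM₂ : ∀ θ ∈ Ioo (-8 : ℝ) 8, ρ₂ θ ∈ Ioo 0 M)
    (hlt : ∀ θ ∈ Ioo (-8 : ℝ) 8, ρ₁ θ < ρ₂ θ)
    (hc₁ : ρ₁ (2 * π) = ρ₁ 0) (hc₂ : ρ₂ (2 * π) = ρ₂ 0) :
    s * (k₁ (2 * π) - k₁ 0) < s * (k₂ (2 * π) - k₂ 0) := by
  have hd : ∀ {ρ X Y k : ℝ → ℝ}, IsPolarLift F γ X Y ρ k → (∀ θ ∈ Ioo (-8 : ℝ) 8, ρ θ ∈ Ioo 0 M) →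
      ∀ θ ∈ Ioo (-8 : ℝ) 8, HasDerivAt (fun θ => k θ - timeCorrection FF φ α β (ρ θ) θ)
        (averagedTime F FF γ φ α β (ρ θ) θ) θ := fun {ρ X Y k} h hM θ hθ => by
    refine h.hasDerivAt_sub_timeCorrection φ α β hθ (hFF _ ?_)
    rw [abs_mul, abs_of_pos (hM θ hθ).1]
    nlinarith [abs_cos_le_one θ, (hM θ hθ).1, (hM θ hθ).2]
  have hdiff := fun θ hθ => ((hd h₂ hM₂ θ hθ).sub (hd h₁ hM₁ θ hθ)).const_mul s
  have hsub : Icc 0 (2 * π) ⊆ Ioo (-8 : ℝ) 8 := fun θ hθ =>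
    ⟨by linarith [hθ.1], by linarith [hθ.2, pi_lt_four]⟩
  have := strictMonoOn_of_deriv_pos (convex_Icc 0 (2 * π))
    (fun θ hθ => (hdiff θ (hsub hθ)).continuousAt.continuousWithinAt) (fun θ hθ => by
      have hθ' := hsub (interior_subset hθ)
      rw [(hdiff θ hθ').deriv, mul_sub, sub_pos]
      exact hmono θ (hM₁ θ hθ') (hM₂ θ hθ') (hlt θ hθ'))
    (left_mem_Icc.2 two_pi_pos.le) (right_mem_Icc.2 two_pi_pos.le) two_pi_pos
  simp only [Pi.sub_apply, hc₁, hc₂, timeCorrection_two_pi] at this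
  linarith

/-- Near the origin the minimal periods of periodic orbits are strictly monotone in the
amplitude, the direction being given by the sign of the period coefficient. -/
theorem LienardExpansion.exists_period_lt {F FF γ : ℝ → ℝ} {φ α β s η : ℝ}
    (H : LienardExpansion F FF γ φ α β) (hs : 0 < s * periodCoeff φ α β) (hη : 0 < η) :
    ∃ c₀, 0 < c₀ ∧ ∀ c₁ c₂, 0 < c₁ → c₁ < c₂ → c₂ < c₀ → ∀ X₁ Y₁ X₂ Y₂ : ℝ → ℝ, ∀ p₁ p₂ : ℝ,
      IsPlanarSolution F γ η X₁ Y₁ → IsPlanarSolution F γ η X₂ Y₂ →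
      X₁ 0 = c₁ → Y₁ 0 = F c₁ → X₂ 0 = c₂ → Y₂ 0 = F c₂ →
      IsLeast {p | 0 < p ∧ ∀ t, X₁ (t + p) = X₁ t} p₁ →
      IsLeast {p | 0 < p ∧ ∀ t, X₂ (t + p) = X₂ t} p₂ → s * p₁ < s * p₂ := by
  obtain ⟨η₁, hL⟩ := H.exists_smallLipschitz
  obtain ⟨M₁, K, hK⟩ := H.exists_orbitSlopeBounds
  obtain ⟨M₂, hM₂, hmono⟩ := H.exists_strictMonoOn_averagedTime hs
  obtain ⟨M₃, L, hM₃, hL0, hang⟩ := H.exists_startAngle_lipschitz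
  obtain ⟨M₄, hM₄, hFF⟩ := Metric.eventually_nhds_iff.1 H.FF_deriv
  obtain ⟨η', hη'⟩ : ∃ η', η' = min η η₁ := ⟨_, rfl⟩
  obtain ⟨M, hM⟩ : ∃ M, M = min M₁ (min M₂ M₄) := ⟨_, rfl⟩
  have hη0 : 0 < η' := hη' ▸ lt_min hη hL.pos
  have hM0 : 0 < M := hM ▸ lt_min hK.pos (lt_min hM₂ hM₄)
  have hM1 : M ≤ M₁ := hM ▸ min_le_left _ _
  have hM2 : M ≤ M₂ := hM ▸ (min_le_right _ _).trans (min_le_left _ _)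
  have hM4 : M ≤ M₄ := hM ▸ (min_le_right _ _).trans (min_le_right _ _)
  replace hL := hL.mono hη0 (hη' ▸ min_le_right _ _)
  replace hK := hK.mono hM0 hM1
  have hKL0 : 0 ≤ K * L := by positivity
  have hq : 0 < 1 / (64 * (K * L) + 1) := by positivity
  refine ⟨min (min (η' / 5) (M / 5)) (min M₃ (min 1 (1 / (64 * (K * L) + 1)))), by positivity, ?_⟩
  intro c₁ c₂ hc₁ hc hc₂ X₁ Y₁ X₂ Y₂ p₁ p₂ h₁ h₂ hX₁ hY₁ hX₂ hY₂ hp₁ hp₂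
  simp only [lt_min_iff] at hc₂
  obtain ⟨⟨hcη, hcM⟩, hcL, hc1, hcK⟩ := hc₂
  have key : ∀ (c p : ℝ) (X Y : ℝ → ℝ), 0 < c → c ≤ c₂ → IsPlanarSolution F γ η X Y → X 0 = c →
      Y 0 = F c → IsLeast {p | 0 < p ∧ ∀ t, X (t + p) = X t} p →
      ∃ ρ k, IsPolarLift F γ X Y ρ k ∧ IsPolarOrbit F γ M (-8) 8 ρ ∧
        ρ (startAngle F c) = startRadius F c ∧
        (∀ θ ∈ Ioo (-8 : ℝ) 8, ρ θ ≤ 2 * startRadius F c) ∧ ρ (2 * π) = ρ 0 ∧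
        k (2 * π) - k 0 = p := by
    intro c p X Y hc0 hcc h hX hY hp
    have hmem : c ∈ Ioo 0 η' := ⟨hc0, by linarith⟩
    have hr := hL.startRadius_le hmem
    refine (h.mono (hη' ▸ min_le_left _ _ : η' ≤ η)).exists_closed_polarLift hL hK hp (t₀ := 0)
      (sqrt_pos.2 (by positivity)) (by linarith) (by linarith) (hL.abs_startAngle_le hmem) ?_ ?_
    · rw [startRadius_mul_cos hc0, hX]
    · rw [startRadius_mul_sin hc0, hY, neg_neg]
  obtain ⟨ρ₁, k₁, hl₁, ho₁, hs₁, hb₁, hcl₁, rfl⟩ := key c₁ p₁ X₁ Y₁ hc₁ hc.le h₁ hX₁ hY₁ hp₁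
  obtain ⟨ρ₂, k₂, hl₂, ho₂, hs₂, -, hcl₂, rfl⟩ :=
    key c₂ p₂ X₂ Y₂ (hc₁.trans hc) le_rfl h₂ hX₂ hY₂ hp₂
  refine hl₁.turnTime_lt hl₂ (M := M) (φ := φ) (α := α) (β := β) (FF := FF)
    (fun x hx => hFF (by rw [dist_zero_right, Real.norm_eq_abs]; linarith))
    (fun θ => (hmono θ).mono (Ioo_subset_Ioo_right hM2)) (fun θ hθ => (ho₁ θ hθ).2)
    (fun θ hθ => (ho₂ θ hθ).2) (fun θ hθ => ?_) hcl₁ hcl₂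
  refine ho₁.lt_of_start_lt hL hK hc hc₁ (by linarith) ho₂ hs₁ hs₂ hb₁ hL0
    (hang _ ⟨hc₁.trans hc, hcL⟩ _ ⟨hc₁, hc.trans hcL⟩) ?_ hθ
  have h3 : c₁ * (64 * (K * L) + 1) < 1 := by
    rw [← lt_div_iff₀ (by positivity)]
    exact hc.trans hcK
  nlinarith [mul_nonneg hKL0 hc₁.le, mul_nonneg (mul_nonneg hKL0 hc₁.le) hc₁.le]

theorem Continuous.exists_primitive {f : ℝ → ℝ} (hf : Continuous f) :
    ∃ F : ℝ → ℝ, F 0 = 0 ∧ ∀ x, HasDerivAt F (f x) x :=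
  ⟨fun x => ∫ t in (0 : ℝ)..x, f t, intervalIntegral.integral_same,
    fun x => (hf.integral_hasStrictDerivAt 0 x).hasDerivAt⟩

theorem HasDerivAt.isLittleO_sub_mul {h : ℝ → ℝ} {h' : ℝ} (hh : HasDerivAt h h' 0) (h0 : h 0 = 0) :
    (fun x => h x - h' * x) =o[𝓝 0] fun x => x := by
  refine (hasDerivAt_iff_isLittleO.1 hh).congr (fun x => ?_) fun x => sub_zero x
  simp only [h0, sub_zero, smul_eq_mul]
  ring

/-- The planar system, rescaled to linear frequency one, that corresponds to the Liénard
equation. -/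
theorem exists_lienardExpansion {a b : ℝ} (ha : a < 0) (hb : 0 < b) {f g : ℝ → ℝ}
    (hf : ContDiffOn ℝ 1 f (Icc a b)) (hg : ContDiffOn ℝ 3 g (Icc a b))
    (hf0 : f 0 = 0) (hg0 : g 0 = 0) {ω : ℝ} (hω : 0 < ω) (hω2 : ω ^ 2 = deriv g 0) :
    ∃ F FF, LienardExpansion F FF (fun x => g x / ω ^ 2 - x) (deriv f 0 / ω)
        (iteratedDeriv 2 g 0 / ω ^ 2) (iteratedDeriv 3 g 0 / ω ^ 2) ∧
      Differentiable ℝ F ∧ ∀ x ∈ Ioo a b, HasDerivAt F (f x / ω) x := by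
  have hab : a ≤ b := (ha.trans hb).le
  obtain ⟨F, hF0, hF⟩ := ((hf.continuousOn.domRestrict.Icc_extend' (h := hab)).div_const
    ω).exists_primitive
  have hFd : Differentiable ℝ F := fun x => (hF x).differentiableAt
  obtain ⟨FF, hFF0, hFF⟩ := hFd.continuous.exists_primitive
  have hFf : ∀ x ∈ Ioo a b, HasDerivAt F (f x / ω) x := fun x hx => by
    have := hF x
    rwa [IccExtend_of_mem _ _ (Ioo_subset_Icc_self hx)] at this
  have hnear : ∀ᶠ x in 𝓝 (0 : ℝ), x ∈ Ioo a b := Ioo_mem_nhds ha hb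
  have hg' := hg.mono Ioo_subset_Icc_self
  have hg1 : ContDiffOn ℝ 2 (deriv g) (Ioo a b) := hg'.deriv_of_isOpen isOpen_Ioo (by norm_num)
  have hg2 : ContDiffOn ℝ 1 (deriv (deriv g)) (Ioo a b) :=
    hg1.deriv_of_isOpen isOpen_Ioo (by norm_num)
  have hd : ∀ {h : ℝ → ℝ} {n : WithTop ℕ∞}, ContDiffOn ℝ n h (Ioo a b) → n ≠ 0 → ∀ x ∈ Ioo a b,
      DifferentiableAt ℝ h x := fun hh hn x hx =>
    (hh.differentiableOn hn).differentiableAt (isOpen_Ioo.mem_nhds hx)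
  have hd0 := hd hg' (by norm_num)
  have hd1 := hd hg1 (by norm_num)
  have hd2 := hd hg2 (by norm_num)
  have hi2 : iteratedDeriv 2 g = deriv (deriv g) := by
    rw [iteratedDeriv_succ, iteratedDeriv_one]
  have hi3 : iteratedDeriv 3 g = deriv (deriv (deriv g)) := by
    rw [iteratedDeriv_succ, hi2]
  have h0 : (0 : ℝ) ∈ Ioo a b := ⟨ha, hb⟩
  have hω0 : ω ^ 2 ≠ 0 := by positivity
  refine ⟨F, FF, ⟨hF0, hFF0, by simp [hg0], Eventually.of_forall hFd, Eventually.of_forall hFF,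
    ?_, ?_, ?_⟩, hFd, hFf⟩
  · filter_upwards [hnear] with x hx
    have := hd0 x hx
    fun_prop
  · have h1 := ((hd (hf.mono Ioo_subset_Icc_self) one_ne_zero 0 h0).hasDerivAt.div_const
      ω).isLittleO_sub_mul (by simp [hf0])
    refine h1.congr' ?_ EventuallyEq.rfl
    filter_upwards [hnear] with x hx
    rw [(hFf x hx).deriv]
  · rw [hi2, hi3]
    have he : ∀ x ∈ Ioo a b, HasDerivAt (fun x => deriv g x / ω ^ 2 - 1 -
        (deriv (deriv g) 0 / ω ^ 2 * x + deriv (deriv (deriv g)) 0 / ω ^ 2 * x ^ 2 / 2))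
        (deriv (deriv g) x / ω ^ 2 - deriv (deriv g) 0 / ω ^ 2
          - deriv (deriv (deriv g)) 0 / ω ^ 2 * x) x := fun x hx => by
      refine ((((hd1 x hx).hasDerivAt.div_const (ω ^ 2)).sub_const 1).sub
        (((hasDerivAt_id' x).const_mul (deriv (deriv g) 0 / ω ^ 2)).add
          (((hasDerivAt_pow 2 x).const_mul (deriv (deriv (deriv g)) 0 / ω ^ 2)).div_const
            2))).congr_deriv ?_
      push_cast
      ring
    have h1 := isLittleO_pow_succ_of_deriv (k := 1) (by simp [← hω2, hω0])
      (hnear.mono fun x hx => (he x hx).differentiableAt) (by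
        have h2 := ((((hd2 0 h0).hasDerivAt.div_const (ω ^ 2)).sub_const
          (deriv (deriv g) 0 / ω ^ 2)).isLittleO_sub_mul (by simp))
        refine h2.congr' ?_ (Eventually.of_forall fun x => (pow_one x).symm)
        filter_upwards [hnear] with x hx
        rw [(he x hx).deriv])
    refine h1.congr' ?_ EventuallyEq.rfl
    filter_upwards [hnear] with x hx
    have h3 := (((hd0 x hx).hasDerivAt.div_const (ω ^ 2)).sub (hasDerivAt_id' x)).deriv
    have h4 : deriv (fun x => g x / ω ^ 2 - x) x = deriv g x / ω ^ 2 - 1 := h3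
    rw [h4]

theorem IsLienardSolution.isPlanarSolution {f g u F : ℝ → ℝ} (hu : IsLienardSolution f g u)
    {ω η : ℝ} (hω : 0 < ω) (hFd : Differentiable ℝ F)
    (hF : ∀ x, |x| < η → HasDerivAt F (f x / ω) x) :
    IsPlanarSolution F (fun x => g x / ω ^ 2 - x) η (fun t => u (t / ω))
      (fun t => deriv u (t / ω) / ω + F (u (t / ω))) := by
  have hu1 : Differentiable ℝ u := hu.1.differentiable (by norm_num)
  have hu2 : Differentiable ℝ (deriv u) :=
    (hu.1.iterate_deriv' 1 1).differentiable (by norm_num)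
  have hid : ∀ t, HasDerivAt (fun t => t / ω) (1 / ω) t := fun t => (hasDerivAt_id' t).div_const ω
  have h1 : ∀ t, HasDerivAt (fun t => u (t / ω)) (deriv u (t / ω) / ω) t := fun t =>
    ((hu1 (t / ω)).hasDerivAt.comp t (hid t)).congr_deriv (by ring)
  have h2 : ∀ t, HasDerivAt (fun t => deriv u (t / ω) / ω) (deriv (deriv u) (t / ω) / ω ^ 2) t :=
    fun t => by
      have h := ((hu2 (t / ω)).hasDerivAt.comp t (hid t)).div_const ω
      exact h.congr_deriv (by ring)
  refine ⟨fun t => (h1 t).congr_deriv (by ring), fun t => ?_, fun t ht => ?_⟩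
  · exact (h2 t).differentiableAt.add ((hFd _).comp t (h1 t).differentiableAt)
  · refine ((h2 t).add ((hF _ ht).comp t (h1 t))).deriv.trans ?_
    have h3 : deriv (deriv u) (t / ω) = -(f (u (t / ω)) * deriv u (t / ω) + g (u (t / ω))) := by
      linarith [hu.2 (t / ω)]
    rw [h3]
    field_simp
    ring

theorem IsLeast.period_comp_div {u : ℝ → ℝ} {p ω : ℝ}
    (hp : IsLeast {p : ℝ | 0 < p ∧ ∀ t, u (t + p) = u t} p) (hω : 0 < ω) :
    IsLeast {p : ℝ | 0 < p ∧ ∀ t, u ((t + p) / ω) = u (t / ω)} (p * ω) := by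
  refine ⟨⟨mul_pos hp.1.1 hω, fun t => ?_⟩, fun q hq => ?_⟩
  · rw [add_div, mul_div_cancel_right₀ _ hω.ne', hp.1.2]
  · rw [← le_div_iff₀ hω]
    refine hp.2 ⟨div_pos hq.1 hω, fun t => ?_⟩
    have := hq.2 (t * ω)
    rwa [add_div, mul_div_cancel_right₀ _ hω.ne'] at this

theorem exists_period_lt_of_periodCoeff {a b : ℝ} (ha : a < 0) (hb : 0 < b) {f g : ℝ → ℝ}
    (hf : ContDiffOn ℝ 1 f (Icc a b)) (hg : ContDiffOn ℝ 3 g (Icc a b))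
    (hf0 : f 0 = 0) (hg0 : g 0 = 0) (hg'0 : 0 < deriv g 0) {δ : ℝ} (hδ : 0 < δ) {T : ℝ → ℝ}
    (hT : ∀ c ∈ Ioo (0 : ℝ) δ, ∃ u, IsLienardSolution f g u ∧ u 0 = c ∧ deriv u 0 = 0 ∧
      IsLeast {p : ℝ | 0 < p ∧ ∀ t, u (t + p) = u t} (T c)) {s : ℝ}
    (hs : 0 < s * -(deriv g 0 * iteratedDeriv 3 g 0 - 5 / 3 * iteratedDeriv 2 g 0 ^ 2
      - 2 / 3 * deriv f 0 ^ 2 * deriv g 0)) :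
    ∃ ε, 0 < ε ∧ ε ≤ δ ∧ StrictMonoOn (fun c => s * T c) (Ioo 0 ε) := by
  obtain ⟨ω, hω, hω2⟩ : ∃ ω, 0 < ω ∧ ω ^ 2 = deriv g 0 :=
    ⟨√(deriv g 0), sqrt_pos.2 hg'0, sq_sqrt hg'0.le⟩
  obtain ⟨F, FF, H, hFd, hF⟩ := exists_lienardExpansion ha hb hf hg hf0 hg0 hω hω2
  have hs' : 0 < s * periodCoeff (deriv f 0 / ω) (iteratedDeriv 2 g 0 / ω ^ 2)
      (iteratedDeriv 3 g 0 / ω ^ 2) := by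
    have : s * periodCoeff (deriv f 0 / ω) (iteratedDeriv 2 g 0 / ω ^ 2)
        (iteratedDeriv 3 g 0 / ω ^ 2) = s * -(deriv g 0 * iteratedDeriv 3 g 0
          - 5 / 3 * iteratedDeriv 2 g 0 ^ 2 - 2 / 3 * deriv f 0 ^ 2 * deriv g 0)
          / (16 * ω ^ 4) := by
      rw [← hω2, periodCoeff]
      field_simp
      ring
    rw [this]
    positivity
  obtain ⟨c₀, hc₀, hlt⟩ := H.exists_period_lt hs' (lt_min (neg_pos.2 ha) hb)
  refine ⟨min δ c₀, lt_min hδ hc₀, min_le_left _ _, fun c₁ h₁ c₂ h₂ h => ?_⟩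
  obtain ⟨u₁, hu₁, hc₁, hd₁, hp₁⟩ := hT c₁ ⟨h₁.1, h₁.2.trans_le (min_le_left _ _)⟩
  obtain ⟨u₂, hu₂, hc₂, hd₂, hp₂⟩ := hT c₂ ⟨h₂.1, h₂.2.trans_le (min_le_left _ _)⟩
  have hF' : ∀ x, |x| < min (-a) b → HasDerivAt F (f x / ω) x := fun x hx => by
    obtain ⟨hx1, hx2⟩ := lt_min_iff.1 hx
    exact hF x ⟨by linarith [neg_abs_le x], (le_abs_self x).trans_lt hx2⟩
  have := hlt c₁ c₂ h₁.1 h (h₂.2.trans_le (min_le_right _ _)) _ _ _ _ _ _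
    (hu₁.isPlanarSolution hω hFd hF') (hu₂.isPlanarSolution hω hFd hF')
    (by simp [hc₁]) (by simp [hc₁, hd₁]) (by simp [hc₂]) (by simp [hc₂, hd₂])
    (hp₁.period_comp_div hω) (hp₂.period_comp_div hω)
  rw [← mul_assoc, ← mul_assoc] at this
  exact lt_of_mul_lt_mul_right this hω.le

/-- If the origin is a center of the Liénard equation `x'' + f(x)x' + g(x) = 0` with period
function `T`, then `g'(0)g'''(0) − (5/3)g''(0)² − (2/3)f'(0)²g'(0) < 0` implies that `T` is
strictly increasing near `0`, and `g'(0)g'''(0) − (5/3)g''(0)² − (2/3)f'(0)²g'(0) > 0`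
implies that `T` is strictly decreasing near `0`. -/
theorem lienard_period_monotonicity
    (a b : ℝ) (ha : a < 0) (hb : 0 < b) (f g : ℝ → ℝ)
    (hf : ContDiffOn ℝ 1 f (Icc a b)) (hg : ContDiffOn ℝ 3 g (Icc a b))
    (hf0 : f 0 = 0) (hg0 : g 0 = 0) (hg'0 : 0 < deriv g 0)
    (δ : ℝ) (hδ : 0 < δ) (T : ℝ → ℝ)
    (hsol : ∀ c ∈ Ioo (0:ℝ) δ, ∃ u, IsLienardSolution f g u ∧ u 0 = c ∧ deriv u 0 = 0)
    (hcenter : ∀ c ∈ Ioo (0:ℝ) δ, ∀ u, IsLienardSolution f g u → u 0 = c → deriv u 0 = 0 →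
      ∃ p > 0, ∀ t, u (t + p) = u t)
    (hT : ∀ c ∈ Ioo (0:ℝ) δ, ∀ u, IsLienardSolution f g u → u 0 = c → deriv u 0 = 0 →
      IsLeast {p : ℝ | 0 < p ∧ ∀ t, u (t + p) = u t} (T c)) :
    (deriv g 0 * iteratedDeriv 3 g 0 - (5 / 3) * (iteratedDeriv 2 g 0) ^ 2
        - (2 / 3) * (deriv f 0) ^ 2 * deriv g 0 < 0 →
      ∃ ε, 0 < ε ∧ ε ≤ δ ∧ StrictMonoOn T (Ioo 0 ε)) ∧
    (0 < deriv g 0 * iteratedDeriv 3 g 0 - (5 / 3) * (iteratedDeriv 2 g 0) ^ 2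
        - (2 / 3) * (deriv f 0) ^ 2 * deriv g 0 →
      ∃ ε, 0 < ε ∧ ε ≤ δ ∧ StrictAntiOn T (Ioo 0 ε)) := by
  have hT' : ∀ c ∈ Ioo (0:ℝ) δ, ∃ u, IsLienardSolution f g u ∧ u 0 = c ∧ deriv u 0 = 0 ∧
      IsLeast {p : ℝ | 0 < p ∧ ∀ t, u (t + p) = u t} (T c) := fun c hc => by
    obtain ⟨u, hu, h0, h1⟩ := hsol c hc
    exact ⟨u, hu, h0, h1, hT c hc u hu h0 h1⟩
  refine ⟨fun h => ?_, fun h => ?_⟩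
  · obtain ⟨ε, hε, hεδ, hmono⟩ := exists_period_lt_of_periodCoeff (s := 1) ha hb hf hg hf0 hg0 hg'0
      hδ hT' (by linarith)
    exact ⟨ε, hε, hεδ, by simpa only [one_mul] using hmono⟩
  · obtain ⟨ε, hε, hεδ, hmono⟩ := exists_period_lt_of_periodCoeff (s := -1) ha hb hf hg hf0 hg0
      hg'0 hδ hT' (by linarith)
    exact ⟨ε, hε, hεδ, fun c₁ h₁ c₂ h₂ hc => by
      have := hmono h₁ h₂ hc
      simp only at this
      linarith⟩
end
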